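/- arXiv:math/0003204 — 6 statements merged into one kernel-verified Lean document; each statement's English description precedes it below -/
import Mathlib

section
/- Every surjective proper morphism p : X → Y of prevarieties over an algebraically closed field k satisfies the universal curve covering property, i.e. every base change of p along an arbitrary morphism of prevarieties satisfies the curve covering property. -/
open AlgebraicGeometry CategoryTheory CategoryTheory.Limits

universe u

noncomputable section

/-- A prevariety over a field `k`: a reduced scheme of finite type over `Spec k`
(not necessarily separated). -/
structure Prevariety (k : Type u) [Field k] where
  carrier : Scheme.{u}
  struct : carrier ⟶ Spec (CommRingCat.of k)
  reduced : IsReduced carrier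
  locallyOfFiniteType : LocallyOfFiniteType struct
  quasiCompact : QuasiCompact struct

/-- A curve in a scheme: a closed irreducible subset of topological Krull dimension 1. -/
def IsIrreducibleCurve {X : Scheme.{u}} (C : Set X) : Prop :=
  IsClosed C ∧ IsIrreducible C ∧ topologicalKrullDim C = 1

/-- The curve covering property for a morphism of schemes: for every irreducible curve
`C` in the target and every closed point `y ∈ C` there is an irreducible curve `C'` in the
source with `y ∈ p(C')`, `p(C') ⊆ C` and `p(C')` dense in `C`. -/
def CurveCoveringProperty {X Y : Scheme.{u}} (p : X ⟶ Y) : Prop :=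
  ∀ C : Set Y, IsIrreducibleCurve C → ∀ y ∈ C, IsClosed ({y} : Set Y) →
    ∃ C' : Set X, IsIrreducibleCurve C' ∧ y ∈ p.base '' C' ∧
      p.base '' C' ⊆ C ∧ C ⊆ closure (p.base '' C')

lemma mvPoly_height (k : Type*) [Field k] (n : ℕ) (M : Ideal (MvPolynomial (Fin n) k))
    [hM : M.IsMaximal] : M.height = n := by
  induction n with
  | zero =>
    have : M = ⊥ := by
      have e := (MvPolynomial.isEmptyAlgEquiv k (Fin 0)).toRingEquiv
      have hF : IsField (MvPolynomial (Fin 0) k) := e.toMulEquiv.isField (Field.toIsField k)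
      let := hF.toField
      exact Ideal.eq_bot_of_prime M
    subst this
    simp
  | succ n ih =>
    let e := (MvPolynomial.finSuccEquiv k n).toRingEquiv
    let M' := M.map e
    have hM' : M'.IsMaximal := Ideal.map_isMaximal_of_equiv e
    have h1 : M'.height = M.height := e.height_map M
    have h2 : (M'.comap Polynomial.C).IsMaximal :=
      Polynomial.isMaximal_comap_C_of_isJacobsonRing M'
    have h4 : M'.LiesOver (M'.comap Polynomial.C) := ⟨rfl⟩
    have h3 := Polynomial.height_eq_height_add_one (M'.comap Polynomial.C) M'
    rw [← h1, h3, ih]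
    simp

lemma covers_of_covers_domain (k : Type*) [Field k] (A : Type*) [CommRing A] [IsDomain A]
    [Algebra k A] [Algebra.FiniteType k A] (m m' : Ideal A) [m.IsMaximal] [m'.IsMaximal]
    (h : ∀ q : Ideal A, q.IsPrime → q < m → q = ⊥) :
    ∀ q : Ideal A, q.IsPrime → q < m' → q = ⊥ := by
  obtain ⟨s, g, ginj, gfin⟩ := exists_finite_inj_algHom_of_fg k A
  let P := MvPolynomial (Fin s) k
  let : Algebra P A := g.toRingHom.toAlgebra
  have : Module.Finite P A := gfin
  have : FaithfulSMul P A := (faithfulSMul_iff_algebraMap_injective P A).mpr ginj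
  have : Algebra.IsIntegral P A := inferInstance
  have hgd : Algebra.HasGoingDown P A := inferInstance
  have hm0 : (m.under P).IsMaximal := inferInstance
  have hm0' : (m'.under P).IsMaximal := inferInstance
  have hs : (m.under P).height ≤ 1 := by
    rw [show (1 : ℕ∞) = ((1 : ℕ) : ℕ∞) from rfl, Ideal.height_le_iff]
    intro q hq hlt
    obtain ⟨Q, hQ, hQp, hQo⟩ := Ideal.exists_ideal_lt_liesOver_of_lt m hlt
    have := h Q hQp hQ
    have hq0 : q = ⊥ := by
      rw [hQo.over, this]
      exact Ideal.under_bot P A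
    simp [hq0]
  rw [mvPoly_height] at hs
  intro q hq hlt
  by_contra hne
  have hs' : (m'.under P).height ≤ 1 := by rwa [mvPoly_height]
  rw [show (1 : ℕ∞) = ((1 : ℕ) : ℕ∞) from rfl, Ideal.height_le_iff] at hs'
  have h1 : q.under P < m'.under P := Ideal.IsIntegral.comap_lt_comap hlt
  have h2 := hs' _ inferInstance h1
  have h3 : (q.under P).height = 0 := by simpa using h2
  rw [Ideal.height_eq_zero_iff_eq_bot] at h3
  exact hne (Ideal.eq_bot_of_comap_eq_bot h3)

lemma covers_of_covers (k : Type*) [Field k] (R : Type*) [CommRing R] (φ : k →+* R)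
    (hφ : φ.FiniteType) (P m m' : Ideal R) [hP : P.IsPrime] [m.IsMaximal] [m'.IsMaximal]
    (hm : P ≤ m) (hm' : P ≤ m')
    (h : ∀ q : Ideal R, q.IsPrime → P ≤ q → q < m → q = P) :
    ∀ q : Ideal R, q.IsPrime → P ≤ q → q < m' → q = P := by
  let := φ.toAlgebra
  have : Algebra.FiniteType k R := hφ
  let π := Ideal.Quotient.mk P
  have hπ : Function.Surjective π := Ideal.Quotient.mk_surjective
  have hcm : ∀ q : Ideal R, P ≤ q → (q.map π).comap π = q := fun q hq => by
    rw [Ideal.comap_map_of_surjective' π hπ]; simpa [π] using hq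
  have hlt : ∀ q r : Ideal R, P ≤ q → P ≤ r → q < r → q.map π < r.map π := fun q r hq hr hqr => by
    refine lt_of_le_of_ne (Ideal.map_mono hqr.le) fun he => hqr.ne ?_
    rw [← hcm q hq, he, hcm r hr]
  have : (m.map π).IsMaximal := Ideal.IsMaximal.map_of_surjective_of_ker_le hπ (by simpa [π] using hm)
  have : (m'.map π).IsMaximal := Ideal.IsMaximal.map_of_surjective_of_ker_le hπ (by simpa [π] using hm')
  have key := covers_of_covers_domain k (R ⧸ P) (m.map π) (m'.map π) (by
    intro q hq hqm
    have h1 : P ≤ q.comap π := by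
      intro x hx
      rw [Ideal.mem_comap, Ideal.Quotient.eq_zero_iff_mem.mpr hx]; exact zero_mem _
    have h2 : q.comap π < m := by
      rw [← hcm m hm]
      refine lt_of_le_of_ne (Ideal.comap_mono hqm.le) fun he => hqm.ne ?_
      rw [← Ideal.map_comap_of_surjective π hπ q, he, Ideal.map_comap_of_surjective π hπ]
    have h3 := h _ inferInstance h1 h2
    rw [← Ideal.map_comap_of_surjective π hπ q, h3]
    exact Ideal.map_quotient_self P)
  intro q hq hPq hqm
  have h1 := key (q.map π) (Ideal.map_isPrime_of_surjective hπ (by simpa [π] using hPq))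
    (hlt _ _ hPq hm' hqm)
  rw [← hcm q hPq, h1]
  ext x; simp [π, Ideal.mem_comap, Ideal.Quotient.eq_zero_iff_mem]

/-- Noetherian local domain version -/
lemma covers_of_mem_local (A : Type*) [CommRing A] [IsDomain A] [IsLocalRing A]
    [IsNoetherianRing A] (f : A) (hf : f ≠ 0)
    (h : ∀ q : Ideal A, q.IsPrime → q ≠ ⊥ → f ∈ q) :
    ∀ q : Ideal A, q.IsPrime → q < IsLocalRing.maximalIdeal A → q = ⊥ := by
  classical
  set m := IsLocalRing.maximalIdeal A
  intro q hq hqm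
  have hfin := Ideal.finite_minimalPrimes_of_isNoetherianRing A (Ideal.span {f})
  have hsub : (m : Set A) ⊆ ⋃ p ∈ (hfin.toFinset : Set (Ideal A)), (p : Set A) := by
    intro a ha
    by_cases ha0 : a = 0
    · subst ha0
      by_contra hcon
      have hfm : f ∈ m := by
        apply h m inferInstance
        rintro hm
        rw [hm] at hqm
        exact not_lt_bot hqm
      obtain ⟨p, hp, hpm⟩ := Ideal.exists_minimalPrimes_le
        ((Ideal.span_singleton_le_iff_mem m).mpr hfm)
      exact hcon (Set.mem_biUnion (by simpa using hp) (zero_mem p))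
    · obtain ⟨r, hr, hrm⟩ := Ideal.exists_minimalPrimes_le
        ((Ideal.span_singleton_le_iff_mem m).mpr ha)
      have := hr.isPrime
      have har : a ∈ r := (Ideal.span_singleton_le_iff_mem r).mp hr.1.2
      have hr0 : r ≠ ⊥ := by
        rintro rfl
        exact ha0 (by simpa using har)
      have hr1 := Ideal.height_le_one_of_isPrincipal_of_mem_minimalPrimes _ _ hr
      obtain ⟨p, hp, hpr⟩ := Ideal.exists_minimalPrimes_le
        ((Ideal.span_singleton_le_iff_mem r).mpr (h r inferInstance hr0))
      have := hp.isPrime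
      have hpr' : p = r := by
        by_contra hne
        rw [show (1 : ℕ∞) = ((1 : ℕ) : ℕ∞) from rfl, Ideal.height_le_iff] at hr1
        have := hr1 p inferInstance (lt_of_le_of_ne hpr hne)
        have h3 : p.height = 0 := by simpa using this
        rw [Ideal.height_eq_zero_iff_eq_bot] at h3
        subst h3
        have : f ∈ (⊥ : Ideal A) := (Ideal.span_singleton_le_iff_mem _).mp hp.1.2
        exact hf (by simpa using this)
      exact Set.mem_biUnion (by simpa using hp) (hpr' ▸ har)
  obtain ⟨p, hp, hmp⟩ := (Ideal.subset_union_prime (s := hfin.toFinset) (f := id) ⊥ ⊥ (by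
    intro i hi _ _
    have : i ∈ (Ideal.span {f}).minimalPrimes := by simpa using hi
    exact this.isPrime)).mp hsub
  have hp' : p ∈ (Ideal.span {f}).minimalPrimes := by simpa using hp
  have := hp'.isPrime
  have hp1 := Ideal.height_le_one_of_isPrincipal_of_mem_minimalPrimes _ _ hp'
  rw [show (1 : ℕ∞) = ((1 : ℕ) : ℕ∞) from rfl, Ideal.height_le_iff] at hp1
  have := hp1 q hq (lt_of_lt_of_le hqm hmp)
  have h3 : q.height = 0 := by simpa using this
  rwa [Ideal.height_eq_zero_iff_eq_bot] at h3

lemma covers_of_mem (R : Type*) [CommRing R] [IsNoetherianRing R] (P m : Ideal R)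
    [hP : P.IsPrime] [hmp : m.IsPrime] (hm : P ≤ m) (f : R) (hf : f ∉ P)
    (h : ∀ q : Ideal R, q.IsPrime → P < q → q ≤ m → f ∈ q) :
    ∀ q : Ideal R, q.IsPrime → P ≤ q → q < m → q = P := by
  let π := Ideal.Quotient.mk P
  have hπ : Function.Surjective π := Ideal.Quotient.mk_surjective
  have hmm : (m.map π).IsPrime := Ideal.map_isPrime_of_surjective hπ (by simpa [π] using hm)
  let A := Localization.AtPrime (m.map π)
  let ψ : R →+* A := (algebraMap (R ⧸ P) A).comp π
  have hinj : Function.Injective (algebraMap (R ⧸ P) A) :=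
    IsLocalization.injective A (Ideal.primeCompl_le_nonZeroDivisors (m.map π))
  have : IsNoetherianRing A := IsLocalization.isNoetherianRing (m.map π).primeCompl A inferInstance
  have hker : ∀ x, ψ x = 0 ↔ x ∈ P := fun x => by
    simp only [ψ, RingHom.comp_apply]
    rw [map_eq_zero_iff _ hinj, Ideal.Quotient.eq_zero_iff_mem]
  have hPle : ∀ q : Ideal A, P ≤ q.comap ψ := fun q x hx => by
    rw [Ideal.mem_comap, (hker x).mpr hx]; exact zero_mem _
  have hcm : ∀ q : Ideal R, P ≤ q → (q.map π).comap π = q := fun q hq => by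
    rw [Ideal.comap_map_of_surjective' π hπ]; simpa [π] using hq
  have hmc : (IsLocalRing.maximalIdeal A).comap ψ = m := by
    rw [← Ideal.comap_comap, show Ideal.comap (algebraMap (R ⧸ P) A) (IsLocalRing.maximalIdeal A) = m.map π from
      Localization.AtPrime.under_maximalIdeal, hcm m hm]
  have key := covers_of_mem_local A (ψ f) (by rwa [Ne, hker]) (by
    intro q hq hq0
    have h2 : q.comap ψ ≤ m := by
      exact (Ideal.comap_mono (IsLocalRing.le_maximalIdeal hq.ne_top)).trans hmc.le
    refine h (q.comap ψ) inferInstance (lt_of_le_of_ne (hPle q) fun he => hq0 ?_) h2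
    rw [← IsLocalization.map_under (m.map π).primeCompl A q, Ideal.map_eq_bot_iff_of_injective hinj]
    rw [← Ideal.map_comap_of_surjective π hπ (Ideal.under _ q), Ideal.under, Ideal.comap_comap]
    rw [show Ideal.comap ((algebraMap (R ⧸ P) A).comp π) q = P from he.symm]
    exact Ideal.map_quotient_self P)
  intro q hq hPq hqm
  have hqp : (q.map π).IsPrime := Ideal.map_isPrime_of_surjective hπ (by simpa [π] using hPq)
  have hdisj : Disjoint ((m.map π).primeCompl : Set (R ⧸ P)) (q.map π : Set (R ⧸ P)) := by
    rw [Set.disjoint_left]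
    intro x hx hx'
    exact hx (Ideal.map_mono hqm.le hx')
  let Q := (q.map π).map (algebraMap (R ⧸ P) A)
  have hQp : Q.IsPrime := IsLocalization.isPrime_of_isPrime_disjoint _ A _ hqp hdisj
  have hQc : Q.comap ψ = q := by
    rw [← Ideal.comap_comap]
    have : Ideal.comap (algebraMap (R ⧸ P) A) Q = q.map π :=
      IsLocalization.under_map_of_isPrime_disjoint _ A hqp hdisj
    rw [this, hcm q hPq]
  have hQ := key Q hQp (lt_of_le_of_ne (IsLocalRing.le_maximalIdeal hQp.ne_top) fun he => hqm.ne (by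
    exact hQc.symm.trans ((congrArg (Ideal.comap ψ) he).trans hmc)))
  rw [← hQc, hQ]
  ext x
  simp [hker]

lemma exists_chart {k : Type u} [Field k] {Z : Scheme.{u}} (f : Z ⟶ Spec (CommRingCat.of k))
    [LocallyOfFiniteType f] (z : Z) :
    ∃ (R : CommRingCat.{u}) (j : Spec R ⟶ Z) (φ : k →+* R), IsOpenImmersion j ∧
      z ∈ Set.range j ∧ φ.FiniteType := by
  obtain ⟨U, hU, hzU, -⟩ := exists_isAffineOpen_mem_and_subset (x := z) (U := ⊤) trivial
  obtain ⟨φ, hφ⟩ := Spec.map_surjective (hU.fromSpec ≫ f)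
  refine ⟨Γ(Z, U), hU.fromSpec, φ.hom, inferInstance, by rw [hU.range_fromSpec]; exact hzU, ?_⟩
  rw [← HasRingHomProperty.Spec_iff (P := @LocallyOfFiniteType), hφ]
  infer_instance

lemma isMaximal_of_isClosed {R : CommRingCat.{u}} {Z : Scheme.{u}} (j : Spec R ⟶ Z)
    [IsOpenImmersion j] (a : PrimeSpectrum R) (h : IsClosed ({j a} : Set Z)) :
    a.asIdeal.IsMaximal := by
  rw [← PrimeSpectrum.isClosed_singleton_iff_isMaximal]
  have h1 := h.preimage j.continuous
  have h2 : (j : PrimeSpectrum R → Z) ⁻¹' {j a} = {a} :=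
    Set.ext fun b => j.isOpenEmbedding.injective.eq_iff (a := b) (b := a)
  exact h2 ▸ h1

lemma chart_specializes {R : CommRingCat.{u}} {Z : Scheme.{u}} (j : Spec R ⟶ Z)
    [IsOpenImmersion j] (a b : PrimeSpectrum R) : j a ⤳ j b ↔ a.asIdeal ≤ b.asIdeal := by
  exact (j.isOpenEmbedding.isInducing.specializes_iff (x := a) (y := b)).trans
    (PrimeSpectrum.le_iff_specializes a b).symm

lemma chart_mem {R : CommRingCat.{u}} {Z : Scheme.{u}} (j : Spec R ⟶ Z)
    [IsOpenImmersion j] {a : Z} {b : PrimeSpectrum R} (h : a ⤳ j b) :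
    ∃ c : PrimeSpectrum R, j c = a :=
  h.mem_open j.isOpenEmbedding.isOpen_range ⟨b, rfl⟩

lemma covers_chart {k : Type u} [Field k] {Z : Scheme.{u}} {R : CommRingCat.{u}} (j : Spec R ⟶ Z)
    [IsOpenImmersion j] (φ : k →+* R) (hφ : φ.FiniteType) (x z w : Z)
    (hz : IsClosed ({z} : Set Z)) (hw : IsClosed ({w} : Set Z)) (hxz : x ⤳ z) (hxw : x ⤳ w)
    (hzj : z ∈ Set.range j) (hwj : w ∈ Set.range j)
    (h : ∀ u, x ⤳ u → u ⤳ z → u = x ∨ u = z) :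
    ∀ u, x ⤳ u → u ⤳ w → u = x ∨ u = w := by
  obtain ⟨(ζ : PrimeSpectrum R), rfl⟩ := hzj
  obtain ⟨(ω : PrimeSpectrum R), rfl⟩ := hwj
  obtain ⟨ξ, rfl⟩ := chart_mem j hxz
  intro u hxu huw
  obtain ⟨υ, rfl⟩ := chart_mem j huw
  have := isMaximal_of_isClosed j ζ hz
  have := isMaximal_of_isClosed j ω hw
  rw [chart_specializes] at hxz hxw hxu huw
  by_cases heq : υ.asIdeal = ω.asIdeal
  · right; rw [PrimeSpectrum.ext heq]
  · left
    have := covers_of_covers k R φ hφ ξ.asIdeal ζ.asIdeal ω.asIdeal hxz hxw (by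
      intro q hq hPq hqm
      have h1 := h (j ⟨q, hq⟩) ((chart_specializes j ξ ⟨q, hq⟩).mpr hPq)
        ((chart_specializes j ⟨q, hq⟩ ζ).mpr hqm.le)
      rcases h1 with h1 | h1
      · have h2 := j.isOpenEmbedding.injective h1
        exact congrArg PrimeSpectrum.asIdeal h2
      · have h2 := j.isOpenEmbedding.injective h1
        exact absurd (congrArg PrimeSpectrum.asIdeal h2) hqm.ne) υ.asIdeal inferInstance hxu
        (lt_of_le_of_ne huw heq)
    rw [PrimeSpectrum.ext this]

lemma covers_scheme {k : Type u} [Field k] {Z : Scheme.{u}} (f : Z ⟶ Spec (CommRingCat.of k))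
    [LocallyOfFiniteType f] (x z w : Z)
    (hz : IsClosed ({z} : Set Z)) (hw : IsClosed ({w} : Set Z)) (hxz : x ⤳ z) (hxw : x ⤳ w)
    (h : ∀ u, x ⤳ u → u ⤳ z → u = x ∨ u = z) :
    ∀ u, x ⤳ u → u ⤳ w → u = x ∨ u = w := by
  have : JacobsonSpace Z := LocallyOfFiniteType.jacobsonSpace f
  obtain ⟨R, j, φ, hj, hzj, hφ⟩ := exists_chart f z
  obtain ⟨R', j', φ', hj', hwj', hφ'⟩ := exists_chart f w
  have ho := j.isOpenEmbedding.isOpen_range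
  have ho' := j'.isOpenEmbedding.isOpen_range
  have hxj := hxz.mem_open ho hzj
  have hxj' := hxw.mem_open ho' hwj'
  obtain ⟨v, ⟨⟨hvj, hvj'⟩, hxv⟩, hv⟩ := nonempty_inter_closedPoints
    (Z := (Set.range j ∩ Set.range j') ∩ closure {x}) ⟨x, ⟨hxj, hxj'⟩, subset_closure rfl⟩
    ((ho.inter ho').isLocallyClosed.inter isClosed_closure.isLocallyClosed)
  have hxv' : x ⤳ v := specializes_iff_mem_closure.mpr hxv
  exact covers_chart j' φ' hφ' x v w hv hw hxv' hxw hvj' hwj'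
    (covers_chart j φ hφ x z v hz hv hxz hxv' hzj hvj h)

lemma exists_minimal {k : Type u} [Field k] {Z : Scheme.{u}} (f : Z ⟶ Spec (CommRingCat.of k))
    [LocallyOfFiniteType f] (x₀ z : Z) (hxz : x₀ ⤳ z) (W : Set Z) (hW : IsClosed W)
    (hx₀ : x₀ ∉ W) (hz : z ∈ W) :
    ∃ x, x₀ ⤳ x ∧ x ⤳ z ∧ x ∉ W ∧ ∀ u, x ⤳ u → u ⤳ z → u = x ∨ u = z := by
  obtain ⟨R, j, φ, hj, ⟨(ζ : PrimeSpectrum R), rfl⟩, hφ⟩ := exists_chart f z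
  obtain ⟨ξ₀, rfl⟩ := chart_mem j hxz
  have hN : IsNoetherianRing R := by
    let := φ.toAlgebra
    have : Algebra.FiniteType k R := hφ
    exact Algebra.FiniteType.isNoetherianRing k R
  obtain ⟨P, ⟨hP, h1, h2, h3⟩, hmax⟩ := set_has_maximal_iff_noetherian.mpr hN
    {P : Ideal R | ∃ hP : P.IsPrime, ξ₀.asIdeal ≤ P ∧ P ≤ ζ.asIdeal ∧ j ⟨P, hP⟩ ∉ W}
    ⟨ξ₀.asIdeal, ξ₀.2, le_rfl, (chart_specializes j _ _).mp hxz, hx₀⟩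
  refine ⟨j ⟨P, hP⟩, (chart_specializes j ξ₀ ⟨P, hP⟩).mpr h1,
    (chart_specializes j ⟨P, hP⟩ ζ).mpr h2, h3, ?_⟩
  have hWj : IsClosed ((j : PrimeSpectrum R → Z) ⁻¹' W) := hW.preimage j.continuous
  obtain ⟨I, hI⟩ := (PrimeSpectrum.isClosed_iff_zeroLocus_ideal _).mp hWj
  have hIP : ¬ I ≤ P := by
    intro hle
    have : (⟨P, hP⟩ : PrimeSpectrum R) ∈ PrimeSpectrum.zeroLocus (I : Set R) := hle
    rw [← hI] at this
    exact h3 this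
  obtain ⟨a, haI, haP⟩ := SetLike.not_le_iff_exists.mp hIP
  intro u hxu huz
  obtain ⟨υ, rfl⟩ := chart_mem j huz
  have hxu' := (chart_specializes j ⟨P, hP⟩ υ).mp hxu
  have huz' := (chart_specializes j υ ζ).mp huz
  by_cases heq : υ.asIdeal = ζ.asIdeal
  · right; rw [PrimeSpectrum.ext heq]
  left
  have := covers_of_mem R P ζ.asIdeal h2 a haP (by
    intro q hq hPq hqm
    have hqW : (⟨q, hq⟩ : PrimeSpectrum R) ∈ (j : PrimeSpectrum R → Z) ⁻¹' W := by
      by_contra hcon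
      exact hmax q ⟨hq, h1.trans hPq.le, hqm, hcon⟩ hPq
    rw [hI] at hqW
    exact hqW haI) υ.asIdeal inferInstance hxu' (lt_of_le_of_ne huz' heq)
  have h4 : υ = ⟨P, hP⟩ := PrimeSpectrum.ext this
  rw [h4]

lemma dim_closed_iff {T : Type*} [TopologicalSpace T] [QuasiSober T] [T0Space T] (C : Set T)
    (hC : IsClosed C) (η : T) (hη : C = closure {η}) :
    topologicalKrullDim C = 1 ↔ ((∃ z, η ⤳ z ∧ z ≠ η) ∧
      ∀ a b, η ⤳ a → a ⤳ b → a = η ∨ a = b) := by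
  have hqs : QuasiSober C := hC.isClosedEmbedding_subtypeVal.quasiSober
  let : PartialOrder C := specializationOrder C
  have hmem : ∀ a, a ∈ C ↔ η ⤳ a := fun a => by
    rw [hη, specializes_iff_mem_closure]
  have hle : ∀ a b : C, a ≤ b ↔ (b : T) ⤳ (a : T) := fun a b => by
    rw [← subtype_specializes_iff]; rfl
  have hlt : ∀ a b : C, a < b ↔ (b : T) ⤳ (a : T) ∧ (a : T) ≠ b := fun a b => by
    rw [lt_iff_le_and_ne, hle, Ne, Subtype.ext_iff]
  rw [topologicalKrullDim, Order.krullDim_eq_of_orderIso (irreducibleSetEquivPoints (α := C)),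
    le_antisymm_iff, Order.krullDim_le_one_iff, Order.one_le_krullDim_iff, and_comm]
  have hηC : η ∈ C := (hmem η).mpr specializes_rfl
  refine and_congr ⟨?_, ?_⟩ ⟨?_, ?_⟩
  · rintro ⟨a, b, hab⟩
    rw [hlt] at hab
    refine ⟨a, (hmem _).mp a.2, fun he => hab.2 (he.trans ?_)⟩
    exact (((hmem _).mp b.2).antisymm (he ▸ hab.1)).eq
  · rintro ⟨z, hz, hne⟩
    exact ⟨⟨z, (hmem z).mpr hz⟩, ⟨η, hηC⟩, (hlt _ _).mpr ⟨hz, hne⟩⟩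
  · intro h a b ha hb
    rcases h ⟨a, (hmem a).mpr ha⟩ with h1 | h1
    · right
      have := h1 (b := ⟨b, (hmem b).mpr (ha.trans hb)⟩) ((hle _ _).mpr hb)
      exact ((hle _ _).mp this).antisymm hb |>.eq.symm
    · left
      have := h1 (b := ⟨η, hηC⟩) ((hle _ _).mpr ha)
      exact (((hle _ _).mp this).antisymm ha).eq
  · rintro h ⟨a, haC⟩
    have ha := (hmem a).mp haC
    by_cases hae : a = η
    · right
      rintro ⟨b, hb⟩ _
      rw [hle]
      subst hae
      exact (hmem b).mp hb
    · left
      rintro ⟨b, hb⟩ hba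
      rw [hle] at hba ⊢
      rcases h a b ha hba with h1 | h1
      · exact absurd h1 hae
      · subst h1; exact specializes_rfl

/-- Every surjective proper morphism of prevarieties over an algebraically closed field
satisfies the universal curve covering property: every base change of it along an
arbitrary morphism of prevarieties satisfies the curve covering property. -/
theorem surjective_proper_universal_curve_covering
    (k : Type u) [Field k] [IsAlgClosed k]
    (X Y : Prevariety k) (p : X.carrier ⟶ Y.carrier)
    (hp : p ≫ Y.struct = X.struct)
    (hsurj : Function.Surjective p.base)
    (hproper : IsProper p) :
    ∀ (Y' : Prevariety k) (g : Y'.carrier ⟶ Y.carrier), g ≫ Y.struct = Y'.struct →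
      CurveCoveringProperty (pullback.snd p g) := by
  intro Y' g hg C hC y hyC hy
  obtain ⟨hCc, hCi, hCd⟩ := hC
  have : Surjective p := ⟨hsurj⟩
  have := Y'.locallyOfFiniteType
  let q := pullback.snd p g
  have hqs : Function.Surjective q := (inferInstance : Surjective q).surj
  have hqc : IsClosedMap q := q.isClosedMap
  have hft : LocallyOfFiniteType (q ≫ Y'.struct) := inferInstance
  have hJ : JacobsonSpace (pullback p g : Scheme.{u}) :=
    LocallyOfFiniteType.jacobsonSpace (q ≫ Y'.struct)
  obtain ⟨η, hη⟩ := QuasiSober.sober hCi hCc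
  have hηC : C = closure {η} := hη.symm
  obtain ⟨⟨z', hz', hzne⟩, hchain⟩ := (dim_closed_iff C hCc η hηC).mp hCd
  have hηy : η ⤳ y := specializes_iff_mem_closure.mpr (hηC ▸ hyC)
  have hηney : η ≠ y := by
    rintro rfl
    exact hzne (hz'.mem_closed hy rfl)
  obtain ⟨x₀, hx₀⟩ := hqs η
  obtain ⟨z₀, hxz₀, hz₀⟩ : ∃ z₀, x₀ ⤳ z₀ ∧ q z₀ = y := by
    have h1 : IsClosed (q '' closure {x₀}) := hqc _ isClosed_closure
    have h2 : y ∈ q '' closure {x₀} :=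
      hηy.mem_closed h1 ⟨x₀, subset_closure rfl, hx₀⟩
    obtain ⟨z₀, h3, h4⟩ := h2
    exact ⟨z₀, specializes_iff_mem_closure.mpr h3, h4⟩
  obtain ⟨z, hzz, hz⟩ := nonempty_inter_closedPoints (Z := closure {z₀})
    ⟨z₀, subset_closure rfl⟩ isClosed_closure.isLocallyClosed
  have hz₀z : z₀ ⤳ z := specializes_iff_mem_closure.mpr hzz
  have hqz : q z = y := (hz₀z.map q.continuous).mem_closed hy hz₀
  obtain ⟨x, hx₀x, hxz, hxW, hmin⟩ := exists_minimal (q ≫ Y'.struct) x₀ z (hxz₀.trans hz₀z)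
    (q ⁻¹' {y}) (hy.preimage q.continuous) (fun h => hηney (hx₀.symm.trans h)) hqz
  have hqx : q x = η := by
    have h1 : η ⤳ q x := hx₀ ▸ hx₀x.map q.continuous
    have h2 : q x ⤳ y := hqz ▸ hxz.map q.continuous
    rcases hchain _ _ h1 h2 with h | h
    · exact h
    · exact absurd h hxW
  have hsub : q '' closure {x} ⊆ C := by
    rintro _ ⟨a, ha, rfl⟩
    rw [hηC, ← specializes_iff_mem_closure, ← hqx]
    exact (specializes_iff_mem_closure.mpr ha).map q.continuous
  refine ⟨closure {x}, ⟨isClosed_closure, isIrreducible_singleton.closure, ?_⟩,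
    ⟨z, specializes_iff_mem_closure.mp hxz, hqz⟩, hsub, ?_⟩
  · rw [dim_closed_iff _ isClosed_closure x rfl]
    refine ⟨⟨z, hxz, ?_⟩, ?_⟩
    · rintro rfl
      exact hxW hqz
    · intro a b hxa hab
      obtain ⟨w, hbw, hw⟩ := nonempty_inter_closedPoints (Z := closure {b})
        ⟨b, subset_closure rfl⟩ isClosed_closure.isLocallyClosed
      have hbw' : b ⤳ w := specializes_iff_mem_closure.mpr hbw
      rcases covers_scheme (q ≫ Y'.struct) x z w hz hw hxz (hxa.trans (hab.trans hbw')) hmin a hxa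
        (hab.trans hbw') with h | h
      · exact Or.inl h
      · right
        subst h
        exact (hab.antisymm hbw').eq
  · rw [hηC]
    apply closure_mono
    rintro _ rfl
    exact ⟨x, subset_closure rfl, hqx⟩
end
end

section
/- A surjective morphism p : X → Y of prevarieties over an algebraically closed field k satisfies the curve covering property if and only if it is submersive, i.e. Y carries the quotient topology with respect to p. -/
open AlgebraicGeometry CategoryTheory CategoryTheory.Limits

universe u

noncomputable section

open MvPolynomial in
lemma alg1 {k : Type*} [Field k] [IsAlgClosed k] (d : ℕ) (hd : 2 ≤ d)
    (n : Ideal (MvPolynomial (Fin d) k)) (hn : n.IsMaximal) (g : MvPolynomial (Fin d) k)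
    (hg : g ≠ 0) : ∃ q : Ideal (MvPolynomial (Fin d) k), q.IsPrime ∧ q < n ∧ q ≠ ⊥ ∧ g ∉ q := by
  classical
  obtain ⟨a, rfl⟩ := (isMaximal_iff_eq_vanishingIdeal_singleton (K := k)).mp hn
  obtain ⟨i, j, hij⟩ : ∃ i j : Fin d, i ≠ j := ⟨⟨0, by omega⟩, ⟨1, by omega⟩, by simp⟩
  set g' := g * (X i - C (a i)) with hg'
  have hXi : (X i - C (a i) : MvPolynomial (Fin d) k) ≠ 0 := by
    intro h
    have := congrArg (eval (fun _ => a i + 1)) h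
    simp at this
  have hg0 : g' ≠ 0 := mul_ne_zero hg hXi
  obtain ⟨b, hb⟩ : ∃ b, eval b g' ≠ 0 := by
    by_contra! h
    exact hg0 (MvPolynomial.funext (by simpa using h))
  let φ : MvPolynomial (Fin d) k →ₐ[k] Polynomial k :=
    aeval (fun l => Polynomial.C (a l) + Polynomial.C (b l - a l) * Polynomial.X)
  have h0 : ∀ f, (φ f).eval 0 = eval a f := by
    intro f
    have : ((Polynomial.aeval (0:k)).comp φ) = aeval a := by
      ext l; simp [φ]
    have := DFunLike.congr_fun this f
    simpa [Polynomial.aeval_def, aeval_eq_eval, Polynomial.eval₂_id] using this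
  have h1 : ∀ f, (φ f).eval 1 = eval b f := by
    intro f
    have : ((Polynomial.aeval (1:k)).comp φ) = aeval b := by
      ext l; simp [φ]
    have := DFunLike.congr_fun this f
    simpa [Polynomial.aeval_def, aeval_eq_eval, Polynomial.eval₂_id] using this
  have hgk : φ g' ≠ 0 := by
    intro h
    apply hb
    rw [← h1, h]; simp
  refine ⟨RingHom.ker φ, RingHom.ker_isPrime _, ?_, ?_, ?_⟩
  · refine lt_of_le_of_ne ?_ ?_
    · intro f hf
      rw [mem_vanishingIdeal_singleton_iff]
      rw [RingHom.mem_ker] at hf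
      rw [aeval_eq_eval]
      show eval a f = 0
      rw [← h0, hf]; simp
    · intro h
      apply hgk
      rw [← RingHom.mem_ker, h, mem_vanishingIdeal_singleton_iff]
      simp [hg']
  · intro h
    let v := b j - a j
    let ℓ : MvPolynomial (Fin d) k := C (b j - a j) * (X i - C (a i)) - C (b i - a i) * (X j - C (a j))
    have hℓ : ℓ ∈ RingHom.ker φ := by
      rw [RingHom.mem_ker]
      simp [ℓ, φ, ← MvPolynomial.algebraMap_eq]
      ring
    rw [h, Ideal.mem_bot] at hℓ
    have e1 := congrArg (eval (Function.update a i (a i + 1))) hℓ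
    simp [ℓ, hij.symm] at e1
    have e2 := congrArg (eval (Function.update a j (a j + 1))) hℓ
    simp [ℓ, hij] at e2
    have hm : X i - C (a i) ∈ RingHom.ker φ := by
      rw [RingHom.mem_ker]
      simp [φ, sub_eq_zero.mp e2, ← MvPolynomial.algebraMap_eq]
    rw [h, Ideal.mem_bot] at hm
    exact hXi hm
  · intro h
    apply hgk
    rw [RingHom.mem_ker] at h
    simp [hg', h]

lemma two_le_krullDim {α : Type*} [Preorder α] {a b c : α} (h : a < b) (h' : b < c) :
    2 ≤ Order.krullDim α := by
  let s : LTSeries α := ((RelSeries.singleton _ a).snoc b (by simpa using h)).snoc c (by simpa using h')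
  have := Order.le_krullDim_iff.mpr ⟨s, rfl⟩
  simpa [s] using this

lemma alg2 {k B : Type*} [Field k] [IsAlgClosed k] [CommRing B] [IsDomain B] [Algebra k B]
    [Algebra.FiniteType k B] (q₁ q₂ : Ideal B) (h1 : q₁.IsPrime) (h2 : q₂.IsPrime)
    (h01 : q₁ ≠ ⊥) (h12 : q₁ < q₂) (m : Ideal B) (hm : m.IsMaximal) (f : B) (hf : f ≠ 0) :
    ∃ Q : Ideal B, Q.IsPrime ∧ Q < m ∧ Q ≠ ⊥ ∧ f ∉ Q := by
  obtain ⟨d, g, hg, hgi⟩ := exists_integral_inj_algHom_of_fg k B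
  let R := MvPolynomial (Fin d) k
  let _ : Algebra R B := g.toRingHom.toAlgebra
  have hg' : Function.Injective (algebraMap R B) := hg
  have : Algebra.IsIntegral R B := ⟨hgi⟩
  have : FaithfulSMul R B := (faithfulSMul_iff_algebraMap_injective R B).mpr hg
  have hd : 2 ≤ d := by
    have a1 : (⊥ : Ideal B).comap (algebraMap R B) < q₁.comap (algebraMap R B) :=
      Ideal.IsIntegral.comap_lt_comap (bot_lt_iff_ne_bot.mpr h01)
    have a2 : q₁.comap (algebraMap R B) < q₂.comap (algebraMap R B) :=
      Ideal.IsIntegral.comap_lt_comap h12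
    have := two_le_krullDim (α := PrimeSpectrum R)
      (a := ⟨_, (inferInstance : ((⊥ : Ideal B).comap (algebraMap R B)).IsPrime)⟩)
      (b := ⟨_, (inferInstance : (q₁.comap (algebraMap R B)).IsPrime)⟩)
      (c := ⟨_, (inferInstance : (q₂.comap (algebraMap R B)).IsPrime)⟩) a1 a2
    change 2 ≤ ringKrullDim R at this
    rw [MvPolynomial.ringKrullDim_of_isNoetherianRing] at this
    simp at this
    exact_mod_cast this
  obtain ⟨r, hr, hdvd⟩ := (Algebra.IsIntegral.isIntegral (R := R) f).isAlgebraic.exists_nonzero_dvd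
    (mem_nonZeroDivisors_of_ne_zero hf)
  have hn : (m.under R).IsMaximal := Ideal.isMaximal_comap_of_isIntegral_of_isMaximal m
  obtain ⟨q, hq, hqn, hq0, hrq⟩ := alg1 d hd (m.under R) hn r hr
  have : (m.under R).IsPrime := hn.isPrime
  obtain ⟨Q, hQm, hQ, hQq⟩ := Ideal.exists_ideal_lt_liesOver_of_lt (q := m.under R) m hqn
  refine ⟨Q, hQ, hQm, ?_, ?_⟩
  · rintro rfl
    apply hq0
    rw [hQq.over]
    exact Ideal.comap_bot_of_injective _ hg'
  · intro hfQ
    apply hrq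
    rw [hQq.over]
    exact Ideal.mem_of_dvd Q hdvd hfQ

lemma alg3 {k A : Type*} [Field k] [IsAlgClosed k] [CommRing A] [Algebra k A]
    [Algebra.FiniteType k A] (P q₁ q₂ : PrimeSpectrum A)
    (h01 : P < q₁) (h12 : q₁ < q₂) (m : PrimeSpectrum A) (hm : IsClosed {m}) (hPm : P ≤ m)
    (V : Set (PrimeSpectrum A)) (hV : IsOpen V) (hPV : P ∈ V) :
    ∃ Q : PrimeSpectrum A, P < Q ∧ Q < m ∧ Q ∈ V := by
  rw [PrimeSpectrum.isClosed_singleton_iff_isMaximal] at hm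
  obtain ⟨_, ⟨f, rfl⟩, hPf, hfV⟩ :=
    PrimeSpectrum.isTopologicalBasis_basic_opens.exists_subset_of_mem_open hPV hV
  let π := Ideal.Quotient.mk P.asIdeal
  have hs : Function.Surjective π := Ideal.Quotient.mk_surjective
  have hker : RingHom.ker π = P.asIdeal := Ideal.mk_ker
  have key : ∀ I : Ideal A, P.asIdeal ≤ I → (I.map π).comap π = I := by
    intro I hI
    rw [Ideal.comap_map_of_surjective π hs]
    simpa [← RingHom.ker_eq_comap_bot, hker] using hI
  have hpr : ∀ I : PrimeSpectrum A, P ≤ I → (I.asIdeal.map π).IsPrime := fun I hI =>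
    Ideal.map_isPrime_of_surjective hs (by rw [hker]; exact hI)
  have hPq2 : P ≤ q₂ := (h01.trans h12).le
  have hmm : (m.asIdeal.map π).IsMaximal :=
    (Ideal.map_eq_top_or_isMaximal_of_surjective π hs hm).resolve_left (hpr m hPm).ne_top
  obtain ⟨Q, hQ, hQm, hQ0, hfQ⟩ := alg2 (k := k) (q₁.asIdeal.map π) (q₂.asIdeal.map π) (hpr _ h01.le)
    (hpr _ hPq2) (by
      intro h
      have := key _ h01.le
      rw [h, ← RingHom.ker_eq_comap_bot, hker] at this
      exact h01.ne (PrimeSpectrum.ext this)) (by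
      refine lt_of_le_of_ne (Ideal.map_mono h12.le) ?_
      intro h
      have := congrArg (Ideal.comap π) h
      rw [key _ h01.le, key _ hPq2] at this
      exact h12.ne (PrimeSpectrum.ext this)) (m.asIdeal.map π) hmm (π f) (by
      intro h
      exact hPf (Ideal.Quotient.eq_zero_iff_mem.mp h))
  refine ⟨⟨Q.comap π, inferInstance⟩, ?_, ?_, hfV ?_⟩
  · refine lt_of_le_of_ne ?_ ?_
    · show P.asIdeal ≤ Q.comap π
      exact hker.ge.trans (Ideal.comap_mono bot_le)
    · intro h
      have h : P.asIdeal = Q.comap π := congrArg PrimeSpectrum.asIdeal h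
      apply hQ0
      rw [← Ideal.map_comap_of_surjective π hs Q, ← h]
      exact Ideal.map_quotient_self _
  · refine lt_of_le_of_ne ?_ ?_
    · show Q.comap π ≤ m.asIdeal
      rw [← key _ hPm]
      exact Ideal.comap_mono hQm.le
    · intro h
      have h : Q.comap π = m.asIdeal := congrArg PrimeSpectrum.asIdeal h
      apply hQm.ne
      rw [← Ideal.map_comap_of_surjective π hs Q, ← h]
  · exact hfQ


lemma geo1 {k : Type u} [Field k] [IsAlgClosed k] {X : Scheme.{u}} (s : X ⟶ Spec (CommRingCat.of k))
    [LocallyOfFiniteType s] (R : CommRingCat.{u}) (j : Spec R ⟶ X) [IsOpenImmersion j]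
    {c z₁ z₀ x : X} (h1 : c ⤳ z₁) (h1' : c ≠ z₁) (h0 : z₁ ⤳ z₀) (h0' : z₁ ≠ z₀)
    (hz₀ : z₀ ∈ Set.range j) (hx : x ∈ Set.range j) (hxc : IsClosed {x}) (hcx : c ⤳ x)
    (V : Set X) (hV : IsOpen V) (hcV : c ∈ V) :
    ∃ z ∈ V, c ⤳ z ∧ c ≠ z ∧ z ⤳ x ∧ z ≠ x := by
  have hj := j.isOpenEmbedding
  have hz₁ : z₁ ∈ Set.range j := h0.mem_open hj.isOpen_range hz₀
  have hc : c ∈ Set.range j := h1.mem_open hj.isOpen_range hz₁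
  obtain ⟨z₀, rfl⟩ := hz₀
  obtain ⟨z₁, rfl⟩ := hz₁
  obtain ⟨c, rfl⟩ := hc
  obtain ⟨x, rfl⟩ := hx
  rw [hj.isInducing.specializes_iff] at h1 h0 hcx
  obtain ⟨φ, hφ⟩ := Spec.map_surjective (j ≫ s)
  have hft : LocallyOfFiniteType (Spec.map φ) := by rw [hφ]; infer_instance
  rw [HasRingHomProperty.Spec_iff (P := @LocallyOfFiniteType)] at hft
  let _ : Algebra k R := φ.hom.toAlgebra
  have : Algebra.FiniteType k R := hft
  have lt_of : ∀ a b : PrimeSpectrum R, a ⤳ b → a ≠ b → a < b := fun a b h h' =>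
    lt_of_le_of_ne ((PrimeSpectrum.le_iff_specializes a b).mpr h) h'
  obtain ⟨Q, hQ1, hQ2, hQ3⟩ := alg3 (k := k) (A := R) c z₁ z₀ (lt_of _ _ h1 (fun h => h1' (congrArg j h)))
    (lt_of _ _ h0 (fun h => h0' (congrArg j h))) x
    (by
      have := hxc.preimage hj.continuous
      rwa [← Set.image_singleton, Set.preimage_image_eq _ hj.injective] at this)
    ((PrimeSpectrum.le_iff_specializes c x).mpr hcx) (j ⁻¹' V) (hV.preimage hj.continuous) hcV
  exact ⟨j Q, hQ3, ((PrimeSpectrum.le_iff_specializes c Q).mp hQ1.le).map hj.continuous,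
    fun h => hQ1.ne (hj.injective h),
    ((PrimeSpectrum.le_iff_specializes Q x).mp hQ2.le).map hj.continuous,
    fun h => hQ2.ne (hj.injective h)⟩

lemma chart {X : Scheme.{u}} (x : X) : ∃ (R : CommRingCat.{u}) (j : Spec R ⟶ X),
    IsOpenImmersion j ∧ x ∈ Set.range j :=
  by
  obtain ⟨U, hU, hxU, -⟩ := exists_isAffineOpen_mem_and_subset (X := X) (x := x) (U := ⊤) trivial
  exact ⟨_, hU.fromSpec, inferInstance, by rw [hU.range_fromSpec]; exact hxU⟩

lemma geo2 {k : Type u} [Field k] [IsAlgClosed k] {X : Scheme.{u}} (s : X ⟶ Spec (CommRingCat.of k))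
    [LocallyOfFiniteType s]
    {c z₁ z₀ x : X} (h1 : c ⤳ z₁) (h1' : c ≠ z₁) (h0 : z₁ ⤳ z₀) (h0' : z₁ ≠ z₀)
    (hxc : IsClosed {x}) (hcx : c ⤳ x)
    (V : Set X) (hV : IsOpen V) (hcV : c ∈ V) :
    ∃ z ∈ V, c ⤳ z ∧ c ≠ z ∧ z ⤳ x ∧ z ≠ x := by
  have : JacobsonSpace X := LocallyOfFiniteType.jacobsonSpace s
  obtain ⟨R, j, hj, hi⟩ := chart z₀
  obtain ⟨R', j', hj', hi'⟩ := chart x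
  have ho := j.isOpenEmbedding.isOpen_range
  have ho' := j'.isOpenEmbedding.isOpen_range
  have hc : c ∈ Set.range j := (h1.trans h0).mem_open ho hi
  have hc' : c ∈ Set.range j' := hcx.mem_open ho' hi'
  obtain ⟨w, ⟨⟨hw, hw'⟩, hwc⟩, hwcl⟩ := nonempty_inter_closedPoints
    (Z := (Set.range j ∩ Set.range j') ∩ closure {c})
    ⟨c, ⟨hc, hc'⟩, subset_closure rfl⟩
    ((ho.inter ho').isLocallyClosed.inter isClosed_closure.isLocallyClosed)
  rw [mem_closedPoints_iff] at hwcl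
  obtain ⟨z, -, hz1, hz2, hz3, hz4⟩ := geo1 s _ j h1 h1' h0 h0' hi hw hwcl
    (specializes_iff_mem_closure.mpr hwc) Set.univ isOpen_univ trivial
  exact geo1 s _ j' hz1 hz2 hz3 hz4 hw' hi' hxc hcx V hV hcV


lemma closure_lt {X : Type*} [TopologicalSpace X] [T0Space X] (C : Set X) (a b : C)
    (h : (a : X) ⤳ b) (h' : (a : X) ≠ b) :
    (⟨closure {b}, isIrreducible_singleton.closure, isClosed_closure⟩ :
      TopologicalSpace.IrreducibleCloseds C) <
    ⟨closure {a}, isIrreducible_singleton.closure, isClosed_closure⟩ := by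
  have h2 : a ⤳ b := Topology.IsInducing.subtypeVal.specializes_iff.mp h
  refine lt_of_le_of_ne ?_ ?_
  · exact h2.closure_subset
  · intro e
    apply h'
    have : closure {b} = closure {a} := congrArg TopologicalSpace.IrreducibleCloseds.carrier e
    have h3 : b ⤳ a := by
      rw [specializes_iff_mem_closure, this]; exact subset_closure rfl
    exact congrArg Subtype.val (h2.antisymm h3).eq

/-- strict chains of specializations give chains of irreducible closed sets. -/
lemma two_le_topDim {X : Type*} [TopologicalSpace X] [T0Space X] (C : Set X) {c z₁ z₀ : X}
    (hc : c ∈ C) (hz₁ : z₁ ∈ C) (hz₀ : z₀ ∈ C)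
    (h1 : c ⤳ z₁) (h1' : c ≠ z₁) (h0 : z₁ ⤳ z₀) (h0' : z₁ ≠ z₀) : 2 ≤ topologicalKrullDim C :=
  two_le_krullDim (closure_lt C ⟨z₁, hz₁⟩ ⟨z₀, hz₀⟩ h0 h0') (closure_lt C ⟨c, hc⟩ ⟨z₁, hz₁⟩ h1 h1')

lemma topDim_closure_eq_one {X : Type*} [TopologicalSpace X] [T0Space X] [QuasiSober X] (c x : X)
    (hcx : c ⤳ x) (hne : c ≠ x)
    (h : ∀ z₁ z₀, c ⤳ z₁ → c ≠ z₁ → z₁ ⤳ z₀ → z₁ ≠ z₀ → False) :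
    topologicalKrullDim (closure {c} : Set X) = 1 := by
  have : QuasiSober (closure {c} : Set X) :=
    (isClosed_closure.isClosedEmbedding_subtypeVal).quasiSober
  have hg : ∀ Z : TopologicalSpace.IrreducibleCloseds (closure {c} : Set X),
      ∃ z : (closure {c} : Set X), IsGenericPoint z Z.carrier := fun Z =>
    QuasiSober.sober Z.isIrreducible' Z.isClosed'
  choose g hg using hg
  have hlt : ∀ Z Z' : TopologicalSpace.IrreducibleCloseds (closure {c} : Set X), Z < Z' →
      (g Z' : X) ⤳ g Z ∧ (g Z' : X) ≠ g Z := by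
    intro Z Z' hZ
    have hs : Z.carrier ⊆ Z'.carrier := hZ.le
    constructor
    · exact ((hg Z').specializes (hs (hg Z).mem)).map continuous_subtype_val
    · intro e
      have e : g Z' = g Z := Subtype.ext e
      apply hZ.ne
      ext1
      have h1 := (hg Z').def
      have h2 := (hg Z).def
      rw [e, h2] at h1
      exact h1
  apply le_antisymm
  · refine iSup_le fun p => ?_
    by_contra! hp
    have hp : 2 ≤ p.length := by
      have : 1 < p.length := by exact_mod_cast hp
      omega
    obtain ⟨a1, a2⟩ := hlt _ _ (p.strictMono (show (⟨0, by omega⟩ : Fin (p.length + 1)) < ⟨1, by omega⟩ from Nat.zero_lt_one))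
    obtain ⟨b1, b2⟩ := hlt _ _ (p.strictMono (show (⟨1, by omega⟩ : Fin (p.length + 1)) < ⟨2, by omega⟩ from Nat.one_lt_two))
    have hc : ∀ Z, c ⤳ (g Z : X) := fun Z => specializes_iff_mem_closure.mpr (g Z).2
    refine h _ _ (hc _) ?_ a1 a2
    intro e
    exact b2 (b1.antisymm (e ▸ hc _)).eq
  · have := closure_lt (closure {c}) ⟨c, subset_closure rfl⟩ ⟨x, specializes_iff_mem_closure.mp hcx⟩ hcx hne
    exact Order.one_le_krullDim_iff.mpr ⟨_, _, this⟩

lemma isNoeth {k : Type u} [Field k] {X : Scheme.{u}}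
    (s : X ⟶ Spec (CommRingCat.of k)) [LocallyOfFiniteType s] [QuasiCompact s] : IsNoetherian X := by
  have : IsLocallyNoetherian X := LocallyOfFiniteType.isLocallyNoetherian s
  have : CompactSpace X := QuasiCompact.compactSpace_of_compactSpace s
  exact {}

/-- The key lemma: curves through a closed point meeting an open set. -/
lemma exists_curve {k : Type u} [Field k] [IsAlgClosed k] {X : Scheme.{u}}
    (s : X ⟶ Spec (CommRingCat.of k)) [LocallyOfFiniteType s] [QuasiCompact s]
    {w x : X} (hwx : w ⤳ x) (hx : IsClosed {x}) (V : Set X) (hV : IsOpen V) (hwV : w ∈ V)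
    (hxV : x ∉ V) :
    ∃ c ∈ V, w ⤳ c ∧ c ⤳ x ∧ topologicalKrullDim (closure {c} : Set X) = 1 := by
  have : IsNoetherian X := isNoeth s
  let S : Set (TopologicalSpace.Closeds X) := {Z | ∃ c ∈ V, w ⤳ c ∧ c ⤳ x ∧ Z = .closure {c}}
  obtain ⟨Z, ⟨c, hcV, hwc, hcx, rfl⟩, hmin⟩ := WellFounded.has_min
    (wellFounded_lt (α := TopologicalSpace.Closeds X)) S ⟨_, w, hwV, specializes_rfl, hwx, rfl⟩
  refine ⟨c, hcV, hwc, hcx, topDim_closure_eq_one c x hcx (fun h => hxV (h ▸ hcV)) ?_⟩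
  intro z₁ z₀ h1 h1' h0 h0'
  obtain ⟨z, hzV, hcz, hcz', hzx, -⟩ := geo2 s h1 h1' h0 h0' hx hcx V hV hcV
  refine hmin (.closure {z}) ⟨z, hzV, hwc.trans hcz, hzx, rfl⟩ ?_
  refine lt_of_le_of_ne hcz.closure_subset ?_
  intro e
  have e : closure {z} = closure {c} := congrArg (fun Z : TopologicalSpace.Closeds X => (Z : Set X)) e
  have h3 : z ⤳ c := by
    rw [specializes_iff_mem_closure, e]; exact subset_closure rfl
  exact hcz' (hcz.antisymm h3).eq

lemma constr {X : Type*} [TopologicalSpace X] {S : Set X} (hS : Topology.IsConstructible S) (s : X) :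
    ∃ V : Set X, IsOpen V ∧ s ∈ V ∧ (V ∩ closure {s} ⊆ S ∨ V ∩ closure {s} ⊆ Sᶜ) := by
  induction hS using Topology.IsConstructible.empty_union_induction with
  | open_retrocompact U hU _ =>
    by_cases hs : s ∈ U
    · exact ⟨U, hU, hs, .inl Set.inter_subset_left⟩
    · refine ⟨Set.univ, isOpen_univ, trivial, .inr ?_⟩
      rw [Set.univ_inter]
      exact closure_minimal (by simpa using hs) hU.isClosed_compl
  | union A _ B _ hA hB =>
    obtain ⟨V, hV, hsV, h⟩ := hA
    obtain ⟨W, hW, hsW, h'⟩ := hB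
    refine ⟨V ∩ W, hV.inter hW, ⟨hsV, hsW⟩, ?_⟩
    rcases h with h | h
    · exact .inl fun a ha => .inl (h ⟨ha.1.1, ha.2⟩)
    rcases h' with h' | h'
    · exact .inl fun a ha => .inr (h' ⟨ha.1.2, ha.2⟩)
    · refine .inr fun a ha hab => ?_
      rcases hab with hab | hab
      · exact h ⟨ha.1.1, ha.2⟩ hab
      · exact h' ⟨ha.1.2, ha.2⟩ hab
  | compl A _ hA =>
    obtain ⟨V, hV, hsV, h⟩ := hA
    refine ⟨V, hV, hsV, ?_⟩
    rw [compl_compl]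
    exact h.symm

lemma constr' {X : Type*} [TopologicalSpace X] {S : Set X} (hS : Topology.IsConstructible S) {s : X}
    (hs : s ∈ S) : ∃ V : Set X, IsOpen V ∧ s ∈ V ∧ V ∩ closure {s} ⊆ S := by
  obtain ⟨V, hV, hsV, h | h⟩ := constr hS s
  · exact ⟨V, hV, hsV, h⟩
  · exact absurd hs (h ⟨hsV, subset_closure rfl⟩)

lemma exists_specializes {X : Type*} [TopologicalSpace X] [TopologicalSpace.NoetherianSpace X]
    [QuasiSober X] {E : Set X} (hE : Topology.IsConstructible E) {x : X} (hx : x ∈ closure E) :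
    ∃ w ∈ E, w ⤳ x := by
  have hfin := TopologicalSpace.NoetherianSpace.finite_irreducibleComponents (α := E)
  have hEu : E ⊆ ⋃ T ∈ irreducibleComponents E, closure (Subtype.val '' T) := by
    intro e he
    simp only [Set.mem_iUnion]
    exact ⟨irreducibleComponent ⟨e, he⟩, irreducibleComponent_mem_irreducibleComponents _,
      subset_closure ⟨_, mem_irreducibleComponent, rfl⟩⟩
  have hx' := closure_minimal hEu (hfin.isClosed_biUnion fun _ _ => isClosed_closure) hx
  simp only [Set.mem_iUnion] at hx'
  obtain ⟨T, hT, hxT⟩ := hx'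
  have hTi : IsIrreducible (Subtype.val '' T) := hT.1.image _ continuous_subtype_val.continuousOn
  obtain ⟨w, hw⟩ := QuasiSober.sober hTi.closure isClosed_closure
  refine ⟨w, ?_, hw.specializes hxT⟩
  obtain ⟨V, hV, hwV, h | h⟩ := constr hE w
  · exact h ⟨hwV, subset_closure rfl⟩
  · obtain ⟨t, htV, htT⟩ := mem_closure_iff.mp hw.mem V hV hwV
    have ht : t ∈ closure {w} := by rw [hw.def]; exact subset_closure htT
    obtain ⟨t, -, rfl⟩ := htT
    exact absurd t.2 (h ⟨htV, ht⟩)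

lemma constr_open {X : Type*} [TopologicalSpace X] [TopologicalSpace.NoetherianSpace X]
    {V : Set X} (hV : IsOpen V) : Topology.IsConstructible V :=
  IsRetrocompact.isConstructible hV
    (fun _ _ _ => TopologicalSpace.NoetherianSpace.isCompact _)

lemma mainA {k : Type u} [Field k] [IsAlgClosed k] {X Y : Scheme.{u}} (p : X ⟶ Y)
    (t : Y ⟶ Spec (CommRingCat.of k)) [LocallyOfFiniteType t] [QuasiCompact t]
    [LocallyOfFiniteType (p ≫ t)] [QuasiCompact (p ≫ t)]
    (hsurj : Function.Surjective p) (h : CurveCoveringProperty p) : Topology.IsQuotientMap p := by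
  have : IsNoetherian X := isNoeth (p ≫ t)
  have : IsNoetherian Y := isNoeth t
  have : JacobsonSpace Y := LocallyOfFiniteType.jacobsonSpace t
  have : LocallyOfFiniteType p := locallyOfFiniteType_of_comp p t
  rw [Topology.isQuotientMap_iff_isClosed]
  refine ⟨hsurj, fun A => ⟨fun hA => hA.preimage p.continuous, fun hA => ?_⟩⟩
  have hAc : Topology.IsConstructible A := by
    rw [← Set.image_preimage_eq A hsurj]
    apply p.isConstructible_image
    have := (constr_open hA.isOpen_compl).compl
    rwa [compl_compl] at this
  by_contra hcl
  obtain ⟨y', hy', hy'A⟩ : ∃ y ∈ closure A, y ∉ A := by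
    by_contra! hh
    exact hcl (closure_subset_iff_isClosed.mp hh)
  obtain ⟨V', hV', hyV', hV'A⟩ := constr' hAc.compl hy'A
  obtain ⟨y, ⟨hyV, hyc⟩, hy⟩ := nonempty_inter_closedPoints (Z := V' ∩ closure {y'})
    ⟨y', hyV', subset_closure rfl⟩ (hV'.isLocallyClosed.inter isClosed_closure.isLocallyClosed)
  rw [mem_closedPoints_iff] at hy
  have hyA : y ∉ A := hV'A ⟨hyV, hyc⟩
  have hyA' : y ∈ closure A :=
    (specializes_iff_mem_closure.mpr hyc).mem_closed isClosed_closure hy'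
  obtain ⟨a, haA, hay⟩ := exists_specializes hAc hyA'
  obtain ⟨V, hV, haV, hVA⟩ := constr' hAc haA
  have hyV : y ∉ V := fun hh => hyA (hVA ⟨hh, specializes_iff_mem_closure.mp hay⟩)
  obtain ⟨c, hcV, hac, hcy, hdim⟩ := exists_curve t hay hy V hV haV hyV
  obtain ⟨C', ⟨hC'cl, hC'i, -⟩, ⟨x, hxC', hxy⟩, hsub, hdense⟩ := h (closure {c})
    ⟨isClosed_closure, isIrreducible_singleton.closure, hdim⟩ y
    (specializes_iff_mem_closure.mp hcy) hy
  obtain ⟨_, htV, x', hx'C, rfl⟩ := mem_closure_iff.mp (hdense (subset_closure rfl)) V hV hcV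
  have hin : C' ∩ p ⁻¹' V ⊆ p ⁻¹' A := by
    rintro z ⟨hz, hzV⟩
    refine hVA ⟨hzV, ?_⟩
    have : p z ∈ closure {c} := hsub ⟨z, hz, rfl⟩
    exact closure_minimal (Set.singleton_subset_iff.mpr
      (specializes_iff_mem_closure.mp hac)) isClosed_closure this
  have hC'A : C' ⊆ p ⁻¹' A := by
    refine (subset_closure_inter_of_isPreirreducible_of_isOpen hC'i.2
      (hV.preimage p.continuous) ⟨x', hx'C, htV⟩).trans ?_
    exact closure_minimal hin hA
  apply hyA
  rw [← hxy]
  exact hC'A hxC'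

lemma mainB {k : Type u} [Field k] [IsAlgClosed k] {X Y : Scheme.{u}} (p : X ⟶ Y)
    (s : X ⟶ Spec (CommRingCat.of k)) [LocallyOfFiniteType s] [QuasiCompact s]
    (h : Topology.IsQuotientMap p) : CurveCoveringProperty p := by
  have : IsNoetherian X := isNoeth s
  have : JacobsonSpace X := LocallyOfFiniteType.jacobsonSpace s
  rintro C ⟨hC, hCi, hdim⟩ y hyC hy
  obtain ⟨η, hη⟩ := QuasiSober.sober hCi hC
  have hηy : η ≠ y := by
    rintro rfl
    have e : C = {η} := by rw [← hη.def, hy.closure_eq]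
    have hsub : Subsingleton C := by rw [e]; infer_instance
    have : DiscreteTopology C := inferInstance
    have := topologicalKrullDim_zero_of_discreteTopology C
    rw [hdim] at this
    exact absurd this (by decide)
  have hop : IsOpen (p ⁻¹' {y})ᶜ := (hy.preimage p.continuous).isOpen_compl
  have hCp : IsClosed (p ⁻¹' C) := hC.preimage p.continuous
  let E := p ⁻¹' C ∩ (p ⁻¹' {y})ᶜ
  have hEc : Topology.IsConstructible E := by
    refine Topology.IsConstructible.inter ?_ (constr_open hop)
    have := (constr_open hCp.isOpen_compl).compl
    rwa [compl_compl] at this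
  have hncl : ¬ IsClosed E := by
    intro hE
    have hE : IsClosed (C ∩ {y}ᶜ) := h.isClosed_preimage.mp hE
    have : C ⊆ C ∩ {y}ᶜ := by
      conv_lhs => rw [← hη.def]
      exact closure_minimal (Set.singleton_subset_iff.mpr ⟨hη.mem, hηy⟩) hE
    exact (this hyC).2 rfl
  obtain ⟨x', hx', hx'E⟩ : ∃ x ∈ closure E, x ∉ E := by
    by_contra! hh
    exact hncl (closure_subset_iff_isClosed.mp hh)
  obtain ⟨w, hwE, hwx'⟩ := exists_specializes hEc hx'
  have hx'C : x' ∈ p ⁻¹' C := hwx'.mem_closed hCp hwE.1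
  have hx'y : p x' = y := by
    by_contra hne
    exact hx'E ⟨hx'C, hne⟩
  obtain ⟨x, hxx', hx⟩ := nonempty_inter_closedPoints (Z := closure {x'})
    ⟨x', subset_closure rfl⟩ isClosed_closure.isLocallyClosed
  rw [mem_closedPoints_iff] at hx
  have hx'x : x' ⤳ x := specializes_iff_mem_closure.mpr hxx'
  have hxy : p x = y := hx'x.mem_closed (hy.preimage p.continuous) hx'y
  obtain ⟨c, hcV, hwc, hcx, hcd⟩ := exists_curve s (hwx'.trans hx'x) hx _ hop hwE.2
    (fun hh => hh hxy)
  have hcC : c ∈ p ⁻¹' C := hwc.mem_closed hCp hwE.1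
  have hpc : p c = η := by
    by_contra hne
    have h2 := two_le_topDim C hη.mem hcC hyC (hη.specializes hcC) (Ne.symm hne)
      (hxy ▸ hcx.map p.continuous) hcV
    rw [hdim] at h2
    exact absurd h2 (by decide)
  refine ⟨closure {c}, ⟨isClosed_closure, isIrreducible_singleton.closure, hcd⟩,
    ⟨x, specializes_iff_mem_closure.mp hcx, hxy⟩, ?_, ?_⟩
  · rintro _ ⟨z, hz, rfl⟩
    exact closure_minimal (Set.singleton_subset_iff.mpr hcC) hCp hz
  · conv_lhs => rw [← hη.def]
    refine closure_mono (Set.singleton_subset_iff.mpr ⟨c, subset_closure rfl, hpc⟩)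

/-- A surjective morphism of prevarieties over an algebraically closed field satisfies the
curve covering property if and only if it is submersive, i.e. the target carries the
quotient topology with respect to it. -/
theorem curve_covering_iff_submersive
    (k : Type u) [Field k] [IsAlgClosed k]
    (X Y : Prevariety k) (p : X.carrier ⟶ Y.carrier)
    (hp : p ≫ Y.struct = X.struct)
    (hsurj : Function.Surjective p.base) :
    CurveCoveringProperty p ↔ Topology.IsQuotientMap p.base := by
  have := X.locallyOfFiniteType
  have := X.quasiCompact
  have := Y.locallyOfFiniteType
  have := Y.quasiCompact
  have : LocallyOfFiniteType (p ≫ Y.struct) := hp ▸ X.locallyOfFiniteType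
  have : QuasiCompact (p ≫ Y.struct) := hp ▸ X.quasiCompact
  exact ⟨mainA p Y.struct hsurj, mainB p X.struct⟩
end
end

section
/- For a surjective morphism p : X → Y of prevarieties over the field ℂ of complex numbers, the following are equivalent: (i) p satisfies the universal curve covering property; (ii) p is universally submersive, i.e. p is submersive and this property is preserved by every base change. -/
open AlgebraicGeometry CategoryTheory CategoryTheory.Limits

universe u

noncomputable section

lemma cc_minimal {k D : Type*} [Field k] [CommRing D] [IsDomain D] [Algebra k D]
    [Algebra.FiniteType k D] (m : Ideal D) [m.IsMaximal] (f : D) (hfm : f ∈ m) (hf0 : f ≠ 0)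
    (H : ∀ p : Ideal D, p.IsPrime → p ≠ ⊥ → p ≤ m → f ∈ p) :
    m ∈ (Ideal.span {f}).minimalPrimes := by
  have : IsNoetherianRing D := Algebra.FiniteType.isNoetherianRing k D
  by_contra hm
  have hfin := Ideal.finite_minimalPrimes_of_isNoetherianRing D (Ideal.span {f})
  have hnot : ¬ ((m : Set D) ⊆ ⋃ p ∈ (↑hfin.toFinset : Set (Ideal D)), ((id p : Ideal D) : Set D)) := by
    rw [Ideal.subset_union_prime ⊥ ⊥]
    · rintro ⟨p, hp, hmp⟩
      have hp' : p ∈ (Ideal.span {f}).minimalPrimes := by simpa using hp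
      have : m = p := Ideal.IsMaximal.eq_of_le inferInstance hp'.1.1.ne_top hmp
      exact hm (this ▸ hp')
    · intro p hp _ _
      have hp' : p ∈ (Ideal.span {f}).minimalPrimes := by simpa using hp
      exact hp'.1.1
  obtain ⟨g, hgm, hg⟩ := Set.not_subset.mp hnot
  simp only [id, Set.mem_iUnion, not_exists, SetLike.mem_coe,
    Set.Finite.mem_toFinset] at hg
  have hg0 : g ≠ 0 := by
    rintro rfl
    obtain ⟨p, hp, -⟩ := Ideal.exists_minimalPrimes_le (I := Ideal.span {f}) (J := m)
      (by simpa [Ideal.span_le] using hfm)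
    exact hg p hp p.zero_mem
  obtain ⟨q, hq, hqm⟩ := Ideal.exists_minimalPrimes_le (I := Ideal.span {g}) (J := m)
      (by simpa [Ideal.span_le] using hgm)
  have hqp : q.IsPrime := hq.1.1
  have hgq : g ∈ q := hq.1.2 (Ideal.mem_span_singleton_self g)
  have hq0 : q ≠ ⊥ := by
    rintro rfl; exact hg0 (by simpa using hgq)
  have hfq := H q hqp hq0 hqm
  obtain ⟨p, hp, hpq⟩ := Ideal.exists_minimalPrimes_le (I := Ideal.span {f}) (J := q)
      (by simpa [Ideal.span_le] using hfq)
  have hpp : p.IsPrime := hp.1.1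
  have hp0 : p ≠ ⊥ := by
    rintro rfl
    exact hf0 (by simpa using hp.1.2 (Ideal.mem_span_singleton_self f))
  have hlt : p < q := lt_of_le_of_ne hpq (by rintro rfl; exact hg p hp hgq)
  have h1 : q.height ≤ 1 := Ideal.height_le_one_of_isPrincipal_of_mem_minimalPrimes _ q hq
  have h2 := Ideal.height_add_one_le_of_lt_of_isPrime hlt
  have h3 : p.height ≠ 0 := by rwa [Ne, Ideal.height_eq_zero_iff_eq_bot]
  have h4 : 1 ≤ p.height := Order.one_le_iff_ne_zero.mpr h3
  have h5 : (1 : ℕ∞) + 1 ≤ 1 := (add_le_add_left h4 1).trans (h2.trans h1)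
  exact absurd h5 (by decide)

lemma cc_algebraic {k D : Type*} [Field k] [CommRing D] [IsDomain D] [Algebra k D]
    [Algebra.FiniteType k D] (m : Ideal D) [hmax : m.IsMaximal] (f : D) 
    (hm : m ∈ (Ideal.span {f}).minimalPrimes) (d : D) :
    IsAlgebraic (Algebra.adjoin k {f}) d := by
  have : IsNoetherianRing D := Algebra.FiniteType.isNoetherianRing k D
  have hft : Algebra.FiniteType (Algebra.adjoin k {f}) D :=
    Algebra.FiniteType.of_restrictScalars_finiteType k _ D
  let M : PrimeSpectrum D := ⟨m, hmax.isPrime⟩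
  have hqf : Algebra.QuasiFiniteAt (Algebra.adjoin k {f}) M.asIdeal := by
    apply Algebra.QuasiFiniteAt.of_isOpen_singleton_fiber M
    have hfin := (Ideal.finite_minimalPrimes_of_isNoetherianRing D (Ideal.span {f})).subset
      (Set.sdiff_subset (t := {m}))
    have hcl : IsClosed (⋃ p ∈ (Ideal.span {f}).minimalPrimes \ {m},
      PrimeSpectrum.zeroLocus (p : Set D)) :=
      hfin.isClosed_biUnion fun p _ => PrimeSpectrum.isClosed_zeroLocus _
    refine isOpen_induced_iff.mpr ⟨_, hcl.isOpen_compl, ?_⟩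
    ext ⟨q, hq⟩
    simp only [Set.mem_preimage, Set.mem_compl_iff, Set.mem_iUnion, not_exists,
      Set.mem_singleton_iff]
    constructor
    · intro h
      apply Subtype.ext
      change q = M
      have hfq : f ∈ q.asIdeal := by
        have hfm : f ∈ m := hm.1.2 (Ideal.mem_span_singleton_self f)
        have h1 : (⟨f, Algebra.self_mem_adjoin_singleton k f⟩ : Algebra.adjoin k {f}) ∈
            (PrimeSpectrum.comap (algebraMap (Algebra.adjoin k {f}) D) M).asIdeal := hfm
        have h2 : PrimeSpectrum.comap (algebraMap (Algebra.adjoin k {f}) D) q = _ := hq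
        rw [← h2] at h1
        exact h1
      obtain ⟨p, hp, hpq⟩ := Ideal.exists_minimalPrimes_le (I := Ideal.span {f}) (J := q.asIdeal)
        (by simpa [Ideal.span_le] using hfq)
      by_cases hpm : p = m
      · subst hpm
        exact PrimeSpectrum.ext (x := q) (y := M) (hmax.eq_of_le q.2.ne_top hpq).symm
      · exact absurd hpq (h p ⟨hp, hpm⟩)
    · intro hqM p ⟨hp, hpm⟩ hpm'
      obtain rfl : q = M := congrArg Subtype.val hqM
      exact hpm (le_antisymm hpm' (hm.2 hp.1 hpm'))
  have hqf' : Algebra.QuasiFiniteAt (Algebra.adjoin k {f}) m := hqf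
  obtain ⟨S', hS', r, hr, hbij⟩ :=
    Algebra.QuasiFiniteAt.exists_fg_and_exists_notMem_and_awayMap_bijective
    (R := Algebra.adjoin k {f}) (S := D) m
  have : Module.Finite (Algebra.adjoin k {f}) S' := ⟨(Submodule.fg_top _).mpr hS'⟩
  have hint : ∀ x ∈ S', IsAlgebraic (Algebra.adjoin k {f}) x := by
    intro x hx
    have : IsIntegral (Algebra.adjoin k {f}) (⟨x, hx⟩ : S') := Algebra.IsIntegral.isIntegral _
    exact (this.map S'.val).isAlgebraic
  obtain ⟨y, hy⟩ := hbij.2 (algebraMap D _ d)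
  obtain ⟨y, ⟨_, n, rfl⟩, rfl⟩ := IsLocalization.exists_mk'_eq (.powers r) y
  have hr0 : (r : D) ≠ 0 := by intro h; exact hr (h ▸ m.zero_mem)
  have key : d * (r : D) ^ n = (y : D) := by
    have hinj : Function.Injective (algebraMap D (Localization.Away (S'.val.toRingHom r))) :=
      IsLocalization.injective (M := .powers (S'.val.toRingHom r)) _ (powers_le_nonZeroDivisors_of_noZeroDivisors hr0)
    apply hinj
    rw [map_mul, ← hy]
    simp only [Localization.awayMap, IsLocalization.Away.map, IsLocalization.map_mk']
    exact IsLocalization.mk'_spec _ _ _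
  have hpow : (r : D) ^ n ∈ S' := pow_mem r.2 n
  have : IsDomain (Algebra.adjoin k {f}) := inferInstance
  have h1 := hint _ hpow
  have h2 := hint _ y.2
  rw [← key] at h2
  exact IsAlgebraic.of_mul (mem_nonZeroDivisors_of_ne_zero (pow_ne_zero n hr0)) h1
    (by rwa [mul_comm] at h2)


lemma cc_trdeg {k A K : Type*} [Field k] [CommRing A] [Algebra k A] [Algebra.FiniteType k A]
    [Field K] [Algebra k K] (φ : A →ₐ[k] K)
    (hφ : ∀ z : K, ∃ a b, φ b ≠ 0 ∧ z * φ b = φ a)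
    (m : Ideal A) [hmax : m.IsMaximal] (hm : RingHom.ker φ ≤ m) (f : A) (hfm : f ∈ m)
    (hf0 : φ f ≠ 0)
    (H : ∀ p : Ideal A, p.IsPrime → RingHom.ker φ < p → p ≤ m → f ∈ p) :
    Algebra.trdeg k K ≤ 1 := by
  have hsurj : Function.Surjective φ.rangeRestrict := φ.rangeRestrict_surjective
  have : Algebra.FiniteType k φ.range := .of_surjective φ.rangeRestrict hsurj
  have hker : ∀ x, φ.rangeRestrict x = 0 ↔ φ x = 0 := fun x => by
    rw [← Subtype.coe_inj]; simp
  have hcm : (m.map φ.rangeRestrict).comap φ.rangeRestrict = m := by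
    rw [Ideal.comap_map_of_surjective _ hsurj]
    refine sup_eq_left.mpr fun x hx => hm ?_
    rw [RingHom.mem_ker, ← hker]
    simpa using hx
  have hm' : (m.map φ.rangeRestrict).IsMaximal := by
    refine (Ideal.map_eq_top_or_isMaximal_of_surjective _ hsurj hmax).resolve_left fun h => ?_
    rw [h, Ideal.comap_top] at hcm
    exact hmax.ne_top hcm.symm
  have hmin := cc_minimal (k := k) (m.map φ.rangeRestrict) (φ.rangeRestrict f)
    (Ideal.mem_map_of_mem _ hfm) (by rwa [Ne, hker]) (by
      intro p hp hp0 hpm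
      refine H (p.comap φ.rangeRestrict) (hp.comap _) (lt_of_le_of_ne ?_ ?_) ?_
      · intro x hx
        rw [RingHom.mem_ker, ← hker] at hx
        rw [Ideal.mem_comap, hx]; exact p.zero_mem
      · intro h
        apply hp0
        rw [eq_bot_iff]
        intro y hy
        obtain ⟨x, rfl⟩ := hsurj y
        have : x ∈ RingHom.ker φ := by rw [h]; exact hy
        rw [RingHom.mem_ker, ← hker] at this
        simpa using this
      · calc _ ≤ _ := Ideal.comap_mono hpm
          _ = m := hcm)
  have halg : Algebra.IsAlgebraic (Algebra.adjoin k {φ.rangeRestrict f}) φ.range :=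
    ⟨cc_algebraic (m.map φ.rangeRestrict) _ hmin⟩
  have h1 : Algebra.trdeg k φ.range ≤ 1 := by
    simpa using Algebra.IsAlgebraic.trdeg_le_cardinalMk k {φ.rangeRestrict f}
  have halg2 : Algebra.IsAlgebraic φ.range K := by
    refine ⟨fun z => ?_⟩
    obtain ⟨a, b, hb, hab⟩ := hφ z
    refine IsAlgebraic.of_mul (y := φ b) (mem_nonZeroDivisors_of_ne_zero hb) ?_ ?_
    · exact isAlgebraic_algebraMap (φ.rangeRestrict b)
    · rw [mul_comm, hab]; exact isAlgebraic_algebraMap (φ.rangeRestrict a)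
  have h2 := trdeg_add_eq k φ.range (A := K)
  rw [trdeg_eq_zero (R := φ.range) (A := K), add_zero] at h2
  rwa [← h2]

open Polynomial in
lemma cc_isMaximal {k B K : Type*} [Field k] [CommRing B] [Algebra k B]
    [Field K] [Algebra k K] (ψ : B →ₐ[k] K) (hK : Algebra.trdeg k K ≤ 1)
    (q : Ideal B) [hq : q.IsPrime] (hlt : RingHom.ker ψ < q) : q.IsMaximal := by
  obtain ⟨hle, h, hhq, hhk⟩ := SetLike.lt_iff_le_and_exists.mp hlt
  have hh0 : ψ h ≠ 0 := hhk
  rw [Ideal.Quotient.maximal_ideal_iff_isField_quotient]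
  have hint : Algebra.IsIntegral k (B ⧸ q) := by
    refine ⟨fun b => ?_⟩
    obtain ⟨b, rfl⟩ := Ideal.Quotient.mk_surjective b
    rw [← isAlgebraic_iff_isIntegral]
    have hdep : ∃ F : k[X][X], F ≠ 0 ∧ (F.eval₂ (aeval (R := k) (ψ h)).toRingHom (ψ b)) = 0 := by
      by_cases hal : IsAlgebraic k (ψ h)
      · obtain ⟨P, hP0, hP⟩ := hal
        refine ⟨C P, by simpa using hP0, ?_⟩
        rw [eval₂_C]; exact hP
      · have hind : AlgebraicIndependent k ![ψ h] :=
          algebraicIndependent_unique_type_iff.mpr hal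
        have htb := AlgebraicIndependent.isTranscendenceBasis_of_lift_trdeg_le_of_finite hind (by simpa using hK)
        have halg := htb.isAlgebraic
        obtain ⟨P, hP0, hP⟩ := halg.isAlgebraic (ψ b)
        have hl : P.map (algebraMap _ K) ∈ lifts (aeval (R := k) (ψ h)).toRingHom := by
          rw [lifts_iff_coeff_lifts]
          intro n
          rw [coeff_map]
          have h3 : ((P.coeff n : _) : K) ∈ Algebra.adjoin k {ψ h} := by
            have := (P.coeff n).2
            simpa using this
          rw [Algebra.adjoin_singleton_eq_range_aeval] at h3
          exact h3
        obtain ⟨F, hF⟩ := (mem_lifts _).mp hl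
        refine ⟨F, ?_, ?_⟩
        · rintro rfl
          rw [Polynomial.map_zero, eq_comm, Polynomial.map_eq_zero_iff (FaithfulSMul.algebraMap_injective _ _)] at hF
          exact hP0 hF
        · rw [eval₂_eq_eval_map, hF, ← eval₂_eq_eval_map]
          exact hP
    obtain ⟨F, hF0, hF⟩ := hdep
    have hnu : ¬ IsUnit (C (X : k[X])) := by
      rw [isUnit_C]; exact not_isUnit_X
    obtain ⟨G, hFG, hG⟩ := (FiniteMultiplicity.of_not_isUnit hnu hF0).exists_eq_pow_mul_and_not_dvd
    have hG0 : G.eval₂ (aeval (R := k) (ψ h)).toRingHom (ψ b) = 0 := by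
      rw [hFG, eval₂_mul, eval₂_pow, eval₂_C] at hF
      refine (mul_eq_zero.mp hF).resolve_left (pow_ne_zero _ ?_)
      simpa using hh0
    rw [C_dvd_iff_dvd_coeff] at hG
    push Not at hG
    obtain ⟨i, hi⟩ := hG
    rw [X_dvd_iff] at hi
    refine ⟨G.map (evalRingHom 0), ?_, ?_⟩
    · intro h0
      have := congrArg (fun p => p.coeff i) h0
      simp only [coeff_map, coe_evalRingHom, coeff_zero] at this
      rw [coeff_zero_eq_eval_zero] at hi
      exact hi this
    · have h1 : G.eval₂ (aeval (R := k) h).toRingHom b ∈ q := by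
        apply hle
        rw [RingHom.mem_ker, ← AlgHom.coe_toRingHom, hom_eval₂]
        have he : (ψ.toRingHom).comp (aeval (R := k) h).toRingHom = (aeval (R := k) (ψ h)).toRingHom := by
          ext <;> simp
        exact (congrArg (fun r => G.eval₂ r (ψ b)) he).trans hG0
      rw [← Ideal.Quotient.eq_zero_iff_mem, hom_eval₂] at h1
      rw [aeval_def, eval₂_map]
      have he : (algebraMap k (B ⧸ q)).comp (evalRingHom 0) =
          (Ideal.Quotient.mk q).comp (aeval (R := k) h).toRingHom := by
        ext
        · simp
        · simp [Ideal.Quotient.eq_zero_iff_mem.mpr hhq]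
      exact (congrArg (fun r => G.eval₂ r (Ideal.Quotient.mk q b)) he).trans h1
  exact isField_of_isIntegral_of_isField' (Field.toIsField k)

/-- prime ideal of a point in an open set. -/
def ccP {S : Scheme.{u}} (U : S.Opens) (x : S) (hx : x ∈ U) : Ideal Γ(S, U) :=
  RingHom.ker (S.evaluation U x hx).hom

lemma mem_ccP {S : Scheme.{u}} (U : S.Opens) (x : S) (hx : x ∈ U) (f : Γ(S, U)) :
    f ∈ ccP U x hx ↔ x ∉ S.basicOpen f :=
  S.evaluation_eq_zero_iff_notMem_basicOpen x hx f

instance ccP_prime {S : Scheme.{u}} (U : S.Opens) (x : S) (hx : x ∈ U) : (ccP U x hx).IsPrime :=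
  RingHom.ker_isPrime _

lemma ccP_eq {S : Scheme.{u}} {U : S.Opens} (hU : IsAffineOpen U) (x : S) (hx : x ∈ U) :
    ccP U x hx = (hU.primeIdealOf ⟨x, hx⟩).asIdeal := by
  ext f
  rw [mem_ccP]
  have h : hU.primeIdealOf ⟨x, hx⟩ ∈ hU.fromSpec ⁻¹ᵁ S.basicOpen f ↔
      hU.primeIdealOf ⟨x, hx⟩ ∈ PrimeSpectrum.basicOpen f := by
    rw [hU.fromSpec_preimage_basicOpen]
    rfl
  have h2 : hU.primeIdealOf ⟨x, hx⟩ ∈ hU.fromSpec ⁻¹ᵁ S.basicOpen f ↔ x ∈ S.basicOpen f := by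
    change hU.fromSpec (hU.primeIdealOf ⟨x, hx⟩) ∈ S.basicOpen f ↔ _
    rw [hU.fromSpec_primeIdealOf]
  rw [← h2, h, PrimeSpectrum.mem_basicOpen, not_not]

lemma ccP_le_iff {S : Scheme.{u}} {U : S.Opens} (hU : IsAffineOpen U) (x y : S) (hx : x ∈ U)
    (hy : y ∈ U) : ccP U x hx ≤ ccP U y hy ↔ x ⤳ y := by
  rw [ccP_eq hU, ccP_eq hU]
  change hU.primeIdealOf ⟨x, hx⟩ ≤ hU.primeIdealOf ⟨y, hy⟩ ↔ _
  rw [PrimeSpectrum.le_iff_specializes]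
  refine (hU.fromSpec.isOpenEmbedding.isInducing.specializes_iff
    (x := hU.primeIdealOf ⟨x, hx⟩) (y := hU.primeIdealOf ⟨y, hy⟩)).symm.trans ?_
  rw [hU.fromSpec_primeIdealOf, hU.fromSpec_primeIdealOf]

lemma ccP_surj {S : Scheme.{u}} {U : S.Opens} (hU : IsAffineOpen U) (P : Ideal Γ(S, U))
    [hP : P.IsPrime] : ∃ c, ∃ hc : c ∈ U, ccP U c hc = P := by
  let Q : PrimeSpectrum Γ(S, U) := ⟨P, hP⟩
  have hc : hU.fromSpec Q ∈ U := by
    have : hU.fromSpec Q ∈ hU.fromSpec.opensRange := ⟨Q, rfl⟩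
    rwa [hU.opensRange_fromSpec] at this
  refine ⟨hU.fromSpec Q, hc, ?_⟩
  rw [ccP_eq hU]
  have : hU.primeIdealOf ⟨hU.fromSpec Q, hc⟩ = Q :=
    hU.fromSpec.isOpenEmbedding.injective (hU.fromSpec_primeIdealOf _)
  rw [this]

lemma ccP_max {S : Scheme.{u}} {U : S.Opens} (hU : IsAffineOpen U) (x : S) (hx : x ∈ U)
    (h : IsClosed {x}) : (ccP U x hx).IsMaximal := by
  rw [ccP_eq hU]
  exact hU.primeIdealOf_isMaximal_of_isClosed ⟨x, hx⟩ h

lemma ccP_frac {S : Scheme.{u}} {U : S.Opens} (hU : IsAffineOpen U) (x : S) (hx : x ∈ U)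
    (z : S.residueField x) : ∃ a b, (S.evaluation U x hx).hom b ≠ 0 ∧
      z * (S.evaluation U x hx).hom b = (S.evaluation U x hx).hom a := by
  obtain ⟨t, rfl⟩ := S.residue_surjective x z
  let _ := (TopCat.Presheaf.algebra_section_stalk S.presheaf (⟨x, hx⟩ : U))
  have := hU.isLocalization_stalk ⟨x, hx⟩
  obtain ⟨⟨a, b⟩, h⟩ := IsLocalization.surj (hU.primeIdealOf ⟨x, hx⟩).asIdeal.primeCompl t
  refine ⟨a, b, ?_, ?_⟩
  · have hb := b.2
    rw [Ideal.mem_primeCompl_iff] at hb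
    have hb2 : (b : Γ(S, U)) ∉ ccP U x hx := by rw [ccP_eq hU]; exact hb
    exact hb2
  · have := congrArg (S.residue x).hom h
    rw [map_mul] at this
    exact this

def ccAlg {S : Scheme.{u}} {k : Type u} [Field k] (s : S ⟶ Spec (CommRingCat.of k))
    (U : S.Opens) : k →+* Γ(S, U) :=
  ((Scheme.ΓSpecIso (CommRingCat.of k)).inv ≫ s.appLE ⊤ U le_top).hom

def ccKappa {S : Scheme.{u}} {k : Type u} [Field k] (s : S ⟶ Spec (CommRingCat.of k))
    (c : S) : k →+* S.residueField c :=
  ((Scheme.ΓSpecIso (CommRingCat.of k)).inv ≫ s.appTop ≫ S.evaluation ⊤ c trivial).hom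

lemma ccAlg_eval {S : Scheme.{u}} {k : Type u} [Field k] (s : S ⟶ Spec (CommRingCat.of k))
    (U : S.Opens) (c : S) (hc : c ∈ U) :
    (S.evaluation U c hc).hom.comp (ccAlg s U) = ccKappa s c := by
  rw [ccAlg, ccKappa, ← CommRingCat.hom_comp]
  congr 1
  simp only [Category.assoc, Scheme.Hom.appLE, Scheme.evaluation]
  rw [TopCat.Presheaf.germ_res_assoc]
  rfl

lemma ccAlg_finiteType {S : Scheme.{u}} {k : Type u} [Field k] (s : S ⟶ Spec (CommRingCat.of k))
    [LocallyOfFiniteType s] {U : S.Opens} (hU : IsAffineOpen U) : (ccAlg s U).FiniteType := by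
  rw [ccAlg, CommRingCat.hom_comp]
  refine RingHom.FiniteType.comp (s.finiteType_appLE (isAffineOpen_top _) hU le_top) ?_
  exact RingHom.FiniteType.of_surjective _
    (ConcreteCategory.bijective_of_isIso (Scheme.ΓSpecIso (CommRingCat.of k)).inv).2

lemma cc_points {S : Scheme.{u}} {k : Type u} [Field k] (s : S ⟶ Spec (CommRingCat.of k))
    (c : S) (hK : @Algebra.trdeg k (S.residueField c) _ _ (ccKappa s c).toAlgebra ≤ 1)
    (a b : S) (hca : c ⤳ a) (hne : c ≠ a) (hab : a ⤳ b) : a = b := by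
  obtain ⟨U, hU, hbU, -⟩ := exists_isAffineOpen_mem_and_subset (x := b) (U := ⊤) trivial
  have haU : a ∈ U := hab.mem_open U.2 hbU
  have hcU : c ∈ U := hca.mem_open U.2 haU
  let _ := (ccKappa s c).toAlgebra
  let _ := (ccAlg s U).toAlgebra
  let ψ : Γ(S, U) →ₐ[k] S.residueField c :=
    { (S.evaluation U c hcU).hom with
      commutes' := fun r => congrArg (fun f => f r) (ccAlg_eval s U c hcU) }
  have hlt : RingHom.ker ψ < ccP U a haU := by
    change ccP U c hcU < _
    refine lt_of_le_of_ne ((ccP_le_iff hU _ _ _ _).mpr hca) fun h => hne ?_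
    exact hca.antisymm ((ccP_le_iff hU _ _ haU hcU).mp h.ge) |>.eq
  have hmax := cc_isMaximal ψ hK (ccP U a haU) hlt
  have h := hmax.eq_of_le (ccP_prime U b hbU).ne_top ((ccP_le_iff hU _ _ _ _).mpr hab)
  exact hab.antisymm ((ccP_le_iff hU _ _ hbU haU).mp h.ge) |>.eq

lemma cc_dim_le {X : Type*} [TopologicalSpace X] [T0Space X] [QuasiSober X] {C : Set X}
    (hC : IsClosed C) : topologicalKrullDim C ≤ 1 ↔
      ∀ x ∈ C, (∀ y ∈ C, x ⤳ y → y = x) ∨ (∀ y ∈ C, y ⤳ x → y = x) := by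
  have : QuasiSober C := hC.isClosedEmbedding_subtypeVal.quasiSober
  let _ : PartialOrder C := specializationOrder C
  have e : Order.krullDim (TopologicalSpace.IrreducibleCloseds C) = Order.krullDim C :=
    Order.krullDim_eq_of_orderIso (irreducibleSetEquivPoints (α := C))
  rw [topologicalKrullDim, e,
    Order.krullDim_le_one_iff]
  simp only [isMin_iff_forall_not_lt, isMax_iff_forall_not_lt]
  have key : ∀ x y : C, ¬ (x < y) ↔ (y.1 ⤳ x.1 → y.1 = x.1) := by
    intro x y
    rw [Topology.IsInducing.subtypeVal.specializes_iff]
    change ¬ (x < y) ↔ (x ≤ y → y.1 = x.1)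
    rw [lt_iff_le_and_ne, not_and, not_ne_iff, Subtype.coe_inj, eq_comm]
  simp only [key, Subtype.forall]
  refine forall₂_congr fun x hx => or_congr ?_ Iff.rfl
  exact forall₂_congr fun y hy => forall_congr' fun _ => eq_comm

lemma cc_one_le_dim {X : Type*} [TopologicalSpace X] [T0Space X] [QuasiSober X] {C : Set X}
    (hC : IsClosed C) : 1 ≤ topologicalKrullDim C ↔
      ∃ x ∈ C, ∃ y ∈ C, x ⤳ y ∧ x ≠ y := by
  have : QuasiSober C := hC.isClosedEmbedding_subtypeVal.quasiSober
  let _ : PartialOrder C := specializationOrder C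
  have e : Order.krullDim (TopologicalSpace.IrreducibleCloseds C) = Order.krullDim C :=
    Order.krullDim_eq_of_orderIso (irreducibleSetEquivPoints (α := C))
  rw [topologicalKrullDim, e,
    Order.one_le_krullDim_iff]
  have key : ∀ x y : C, (x < y) ↔ (y.1 ⤳ x.1 ∧ y.1 ≠ x.1) := by
    intro x y
    rw [Topology.IsInducing.subtypeVal.specializes_iff]
    change (x < y) ↔ (x ≤ y ∧ y.1 ≠ x.1)
    rw [lt_iff_le_and_ne, Ne, Ne, Subtype.coe_inj, eq_comm]
  simp only [key]
  constructor
  · rintro ⟨x, y, h⟩; exact ⟨y, y.2, x, x.2, h⟩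
  · rintro ⟨x, hx, y, hy, h⟩; exact ⟨⟨y, hy⟩, ⟨x, hx⟩, h⟩

lemma cc_dim_closure {X : Type*} [TopologicalSpace X] [T0Space X] [QuasiSober X] (c x : X)
    (hcx : c ⤳ x) (hne : c ≠ x) (H : ∀ a b, c ⤳ a → c ≠ a → a ⤳ b → a = b) :
    topologicalKrullDim (closure {c}) = 1 := by
  refine le_antisymm ((cc_dim_le isClosed_closure).mpr ?_) ((cc_one_le_dim isClosed_closure).mpr ?_)
  · intro a ha
    rw [← specializes_iff_mem_closure] at ha
    by_cases hca : c = a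
    · subst hca
      exact .inr fun y hy hyc => (hyc.antisymm (specializes_iff_mem_closure.mpr hy)).eq
    · exact .inl fun y _ hay => (H a y ha hca hay).symm
  · exact ⟨c, subset_closure rfl, x, specializes_iff_mem_closure.mp hcx, hcx, hne⟩

theorem curveSel {S : Scheme.{u}} {k : Type u} [Field k] (s : S ⟶ Spec (CommRingCat.of k))
    [LocallyOfFiniteType s] (w x : S) (hwx : w ⤳ x) (hx : IsClosed {x}) (V : Set S)
    (hV : IsOpen V) (hwV : w ∈ V) (hxV : x ∉ V) :
    ∃ c, w ⤳ c ∧ c ⤳ x ∧ c ∈ V ∧ topologicalKrullDim (closure {c}) = 1 := by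
  obtain ⟨U, hU, hxU, -⟩ := exists_isAffineOpen_mem_and_subset (x := x) (U := ⊤) trivial
  have hwU : w ∈ U := hwx.mem_open U.2 hxU
  obtain ⟨f, hfV, hwf⟩ := hU.exists_basicOpen_le (V := ⟨V, hV⟩) ⟨w, hwV⟩ hwU
  have hft := ccAlg_finiteType s hU
  let _ := (ccAlg s U).toAlgebra
  have hft' : Algebra.FiniteType k Γ(S, U) := hft
  have : IsNoetherianRing Γ(S, U) := Algebra.FiniteType.isNoetherianRing k _
  have hmax := ccP_max hU x hxU hx
  obtain ⟨P, ⟨hP, hwP, hPx, hfP⟩, hPm⟩ := set_has_maximal_iff_noetherian.mpr this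
    {P : Ideal Γ(S, U) | P.IsPrime ∧ ccP U w hwU ≤ P ∧ P ≤ ccP U x hxU ∧ f ∉ P}
    ⟨ccP U w hwU, inferInstance, le_rfl, (ccP_le_iff hU _ _ _ _).mpr hwx,
      by rw [mem_ccP]; simpa using hwf⟩
  obtain ⟨c, hcU, rfl⟩ := ccP_surj hU P
  rw [ccP_le_iff hU] at hwP hPx
  have hcf : c ∈ S.basicOpen f := by rw [mem_ccP, not_not] at hfP; exact hfP
  have hcV : c ∈ V := hfV hcf
  refine ⟨c, hwP, hPx, hcV, cc_dim_closure c x hPx (by rintro rfl; exact hxV hcV) ?_⟩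
  apply cc_points s
  let _ := (ccKappa s c).toAlgebra
  let φ : Γ(S, U) →ₐ[k] S.residueField c :=
    { (S.evaluation U c hcU).hom with
      commutes' := fun r => congrArg (fun f => f r) (ccAlg_eval s U c hcU) }
  refine cc_trdeg φ (ccP_frac hU c hcU) (ccP U x hxU) ((ccP_le_iff hU c x hcU hxU).mpr hPx) f ?_ hfP ?_
  · rw [mem_ccP]; exact fun h => hxV (hfV h)
  · intro p hp hlt hpx
    by_contra hfp
    exact hPm p ⟨hp, ((ccP_le_iff hU w c hwU hcU).mpr hwP).trans hlt.le, hpx, hfp⟩ hlt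

lemma cc_constr {X : Type*} [TopologicalSpace X] {Z : Set X} (hZ : Topology.IsConstructible Z) :
    (∀ w ∈ Z, ∃ V, IsOpen V ∧ w ∈ V ∧ V ∩ closure {w} ⊆ Z) ∧
    (∀ w ∈ Zᶜ, ∃ V, IsOpen V ∧ w ∈ V ∧ V ∩ closure {w} ⊆ Zᶜ) := by
  induction hZ using Topology.IsConstructible.empty_union_induction with
  | open_retrocompact U hU _ =>
    refine ⟨fun w hw => ⟨U, hU, hw, Set.inter_subset_left⟩, fun w hw =>
      ⟨Set.univ, isOpen_univ, trivial, ?_⟩⟩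
    rw [Set.univ_inter]
    exact hU.isClosed_compl.closure_subset_iff.mpr (by simpa using hw)
  | union s hs t ht ihs iht =>
    refine ⟨?_, ?_⟩
    · rintro w (hw | hw)
      · obtain ⟨V, h1, h2, h3⟩ := ihs.1 w hw
        exact ⟨V, h1, h2, h3.trans Set.subset_union_left⟩
      · obtain ⟨V, h1, h2, h3⟩ := iht.1 w hw
        exact ⟨V, h1, h2, h3.trans Set.subset_union_right⟩
    · intro w hw
      rw [Set.compl_union] at hw ⊢
      obtain ⟨V, h1, h2, h3⟩ := ihs.2 w hw.1
      obtain ⟨V', h1', h2', h3'⟩ := iht.2 w hw.2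
      exact ⟨V ∩ V', h1.inter h1', ⟨h2, h2'⟩, fun z hz =>
        ⟨h3 ⟨hz.1.1, hz.2⟩, h3' ⟨hz.1.2, hz.2⟩⟩⟩
  | compl s hs ih => exact ⟨ih.2, by rw [compl_compl]; exact ih.1⟩

lemma cc_closed {Y : Scheme.{u}} {Z : Set Y} (hZ : Topology.IsConstructible Z)
    (hs : StableUnderSpecialization Z) : IsClosed Z := by
  rw [← isOpen_compl_iff, isOpen_iff_forall_mem_open]
  intro y hy
  obtain ⟨U, hU, hyU, -⟩ := exists_isAffineOpen_mem_and_subset (x := y) (U := ⊤) trivial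
  have h1 : IsClosed (hU.fromSpec ⁻¹' Z) :=
    PrimeSpectrum.isClosed_of_stableUnderSpecialization_of_isConstructible
      (fun a b hab ha => hs (hab.map hU.fromSpec.continuous) ha)
      (hU.fromSpec.isConstructible_preimage hZ)
  refine ⟨hU.fromSpec '' (hU.fromSpec ⁻¹' Z)ᶜ, ?_,
    hU.fromSpec.isOpenEmbedding.isOpenMap _ h1.isOpen_compl, ?_⟩
  · rintro _ ⟨z, hz, rfl⟩
    exact hz
  · refine ⟨hU.primeIdealOf ⟨y, hyU⟩, ?_, hU.fromSpec_primeIdealOf _⟩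
    change hU.fromSpec (hU.primeIdealOf ⟨y, hyU⟩) ∉ Z
    rw [hU.fromSpec_primeIdealOf]
    exact hy

lemma isIrreducibleCurve_closure {S : Scheme.{u}} (c : S)
    (h : topologicalKrullDim (closure {c}) = 1) : IsIrreducibleCurve (closure {c}) :=
  ⟨isClosed_closure, isIrreducible_singleton.closure, h⟩

theorem cc_dir1 {X Y : Scheme.{u}} {k : Type u} [Field k] (f : X ⟶ Y)
    (s : Y ⟶ Spec (CommRingCat.of k)) [LocallyOfFiniteType s] [QuasiCompact s]
    [LocallyOfFiniteType f] [QuasiCompact f] (hf : Function.Surjective f.base)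
    (H : CurveCoveringProperty f) : Topology.IsQuotientMap f.base := by
  have : IsLocallyNoetherian Y := LocallyOfFiniteType.isLocallyNoetherian s
  have : CompactSpace Y := QuasiCompact.compactSpace_of_compactSpace s
  have : CompactSpace X := QuasiCompact.compactSpace_of_compactSpace f
  have : IsNoetherian Y := {}
  have : IsLocallyNoetherian X := LocallyOfFiniteType.isLocallyNoetherian f
  have : IsNoetherian X := {}
  have : LocallyOfFinitePresentation f := LocallyOfFinitePresentation.iff_locallyOfFiniteType.mpr ‹_›
  have : JacobsonSpace Y := LocallyOfFiniteType.jacobsonSpace s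
  rw [Topology.isQuotientMap_iff_isClosed]
  refine ⟨hf, fun Z => ⟨fun h => h.preimage f.continuous, fun hZ => ?_⟩⟩
  have hZX : Topology.IsConstructible (f.base ⁻¹' Z) := by
    rw [← Topology.isConstructible_compl]
    exact ((TopologicalSpace.NoetherianSpace.isCompact _).isConstructible hZ.isOpen_compl)
  have hZc : Topology.IsConstructible Z := by
    have := f.isConstructible_image hZX
    have h2 : f '' (f.base ⁻¹' Z) = Z := Set.image_preimage_eq Z hf
    rwa [h2] at this
  apply cc_closed hZc
  intro w y hwy hw
  by_contra hy
  obtain ⟨V, hVo, hwV, hV⟩ := (cc_constr hZc).1 w hw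
  obtain ⟨V', hVo', hyV', hV'⟩ := (cc_constr hZc).2 y hy
  obtain ⟨x, ⟨hx1, hx2⟩, hx3⟩ := nonempty_inter_closedPoints (X := Y) (Z := V' ∩ closure {y})
    ⟨y, hyV', subset_closure rfl⟩ (hVo'.isLocallyClosed.inter isClosed_closure.isLocallyClosed)
  have hxZ : x ∉ Z := hV' ⟨hx1, hx2⟩
  have hwx : w ⤳ x := hwy.trans (specializes_iff_mem_closure.mpr hx2)
  obtain ⟨c, hwc, hcx, hcV, hdim⟩ := curveSel s w x hwx hx3 V hVo hwV
    (fun h => hxZ (hV ⟨h, specializes_iff_mem_closure.mp hwx⟩))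
  have hcZ : c ∈ Z := hV ⟨hcV, specializes_iff_mem_closure.mp hwc⟩
  obtain ⟨C', ⟨hC'1, hC'2, -⟩, ⟨x', hx', hx'x⟩, hsub, hdense⟩ := H _ (isIrreducibleCurve_closure c hdim)
    x (specializes_iff_mem_closure.mp hcx) hx3
  obtain ⟨g, hg⟩ := QuasiSober.sober hC'2 hC'1
  have hfg : f.base g = c := by
    have h1 : c ⤳ f.base g := specializes_iff_mem_closure.mpr (hsub ⟨g, hg.mem, rfl⟩)
    refine (Specializes.antisymm ?_ h1).eq
    rw [specializes_iff_mem_closure]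
    have h2 := hdense (subset_closure rfl : c ∈ closure {c})
    refine closure_minimal ?_ isClosed_closure h2
    rintro _ ⟨z, hz, rfl⟩
    exact specializes_iff_mem_closure.mp ((hg.specializes hz).map f.continuous)
  apply hxZ
  rw [← hx'x]
  have h3 : g ∈ f.base ⁻¹' Z := by change f.base g ∈ Z; rw [hfg]; exact hcZ
  exact (hg.specializes hx').mem_closed hZ h3

lemma cc_reduced {Y : Scheme.{u}} (Z : TopologicalSpace.Closeds Y) :
    IsReduced (Scheme.IdealSheafData.vanishingIdeal Z).subscheme := by
  have (U : Y.affineOpens) : _root_.IsReduced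
      (Γ(Y, U) ⧸ (Scheme.IdealSheafData.vanishingIdeal Z).ideal U) := by
    rw [← Ideal.isRadical_iff_quotient_reduced, Scheme.IdealSheafData.vanishingIdeal_ideal]
    exact PrimeSpectrum.isRadical_vanishingIdeal _
  let 𝒰 := (Scheme.IdealSheafData.vanishingIdeal Z).subschemeCover.openCover
  have h2 : ∀ i : 𝒰.I₀, AlgebraicGeometry.IsReduced (𝒰.X i) := by
    intro i
    have h1 := this i
    change AlgebraicGeometry.IsReduced (Spec (CommRingCat.of _))
    exact (affine_isReduced_iff _).mpr h1
  exact IsReduced.of_openCover _ 𝒰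

theorem cc_dir2 {X Y XC C0 : Scheme.{u}} {k : Type u} [Field k] (f : X ⟶ Y)
    (s : X ⟶ Spec (CommRingCat.of k)) [LocallyOfFiniteType s]
    (C : Set Y) (hC : IsIrreducibleCurve C) (y : Y) (hyC : y ∈ C) (hy : IsClosed ({y} : Set Y))
    (i : C0 ⟶ Y) [IsClosedImmersion i] (hi : Set.range i.base = C)
    (fC : XC ⟶ C0) (q : XC ⟶ X) (hq : q ≫ f = fC ≫ i) [IsNoetherian XC]
    (hfC : Topology.IsQuotientMap fC.base) :
    ∃ C' : Set X, IsIrreducibleCurve C' ∧ y ∈ f.base '' C' ∧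
      f.base '' C' ⊆ C ∧ C ⊆ closure (f.base '' C') := by
  obtain ⟨hCc, hCi, hCd⟩ := hC
  have : JacobsonSpace X := LocallyOfFiniteType.jacobsonSpace s
  have hie : Topology.IsClosedEmbedding i.base := i.isClosedEmbedding
  obtain ⟨η, hη⟩ := QuasiSober.sober hCi hCc
  have hyη : y ≠ η := by
    rintro rfl
    obtain ⟨a, ha, b, hb, -, hab⟩ := (cc_one_le_dim hCc).mp hCd.ge
    rw [← hη.def, hy.closure_eq] at ha hb
    exact hab (ha.trans hb.symm)
  obtain ⟨y0, hy0⟩ : y ∈ Set.range i.base := hi ▸ hyC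
  obtain ⟨η0, hη0⟩ : η ∈ Set.range i.base := hi ▸ hη.mem
  have hqf : ∀ z, f.base (q.base z) = i.base (fC.base z) := fun z =>
    congrArg (fun r : XC ⟶ Y => r.base z) hq
  obtain ⟨w, x, hwx, hw, hx⟩ : ∃ w x, w ⤳ x ∧ fC.base w ≠ y0 ∧ fC.base x = y0 := by
    by_contra! H
    have hy0c : IsClosed {y0} := by
      have := hy.preimage hie.continuous
      convert this
      ext z
      simp only [Set.mem_singleton_iff, Set.mem_preimage, ← hy0]
      exact hie.injective.eq_iff.symm
    have ho : IsOpen (fC.base ⁻¹' {y0})ᶜ := (hy0c.preimage fC.continuous).isOpen_compl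
    have hcl : IsClosed (fC.base ⁻¹' {y0})ᶜ := by
      apply cc_closed ((TopologicalSpace.NoetherianSpace.isCompact _).isConstructible ho)
      intro a b hab ha
      exact H a b hab ha
    have h1 : IsOpen {y0} := by
      rw [← hfC.isOpen_preimage]
      simpa using hcl.isOpen_compl
    have h2 : η0 ⤳ y0 := by
      rw [← hie.isInducing.specializes_iff, hy0, hη0]
      exact hη.specializes hyC
    have h3 : η0 = y0 := h2.mem_open h1 rfl
    exact hyη (by rw [← hy0, ← hη0, h3])
  have hwx' : q.base w ⤳ q.base x := hwx.map q.continuous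
  have hcl : IsClosed (f.base ⁻¹' {y}) := hy.preimage f.continuous
  obtain ⟨x', ⟨hx'1, hx'2⟩, hx'3⟩ := nonempty_inter_closedPoints
    (Z := closure {q.base w} ∩ f.base ⁻¹' {y})
    ⟨q.base x, specializes_iff_mem_closure.mp hwx', by
      change f.base _ = y
      rw [hqf, hx, hy0]⟩ (isClosed_closure.inter hcl).isLocallyClosed
  obtain ⟨c, hwc, hcx, hcV, hdim⟩ := curveSel s (q.base w) x' (specializes_iff_mem_closure.mpr hx'1)
    hx'3 (f.base ⁻¹' {y})ᶜ hcl.isOpen_compl (by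
      intro h
      have h : f.base (q.base w) = y := h
      rw [hqf, ← hy0] at h
      exact hw (hie.injective h)) (fun h => h hx'2)
  have hfcy : f.base c ⤳ y := by
    have := hcx.map f.continuous
    rwa [show f x' = y from hx'2] at this
  have hfw : f.base (q.base w) ∈ C := by rw [hqf, ← hi]; exact ⟨_, rfl⟩
  have hfc : f.base c ∈ C := (hwc.map f.continuous).mem_closed hCc hfw
  have hfη : η = f.base c := by
    rcases (cc_dim_le hCc).mp hCd.le _ hfc with h | h
    · exact absurd (h y hyC hfcy).symm hcV
    · exact h η hη.mem (hη.specializes hfc)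
  refine ⟨closure {c}, isIrreducibleCurve_closure c hdim,
    ⟨x', specializes_iff_mem_closure.mp hcx, hx'2⟩, ?_, ?_⟩
  · rintro _ ⟨z, hz, rfl⟩
    exact ((specializes_iff_mem_closure.mpr hz).map f.continuous).mem_closed hCc hfc
  · rw [← hη.def, hfη]
    exact closure_mono (by rintro _ rfl; exact ⟨c, subset_closure rfl, rfl⟩)

/-- For a surjective morphism of prevarieties over ℂ, the universal curve covering
property is equivalent to being universally submersive. -/
theorem universal_curve_covering_iff_universally_submersive
    (X Y : Prevariety ℂ) (p : X.carrier ⟶ Y.carrier)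
    (hp : p ≫ Y.struct = X.struct)
    (hsurj : Function.Surjective p.base) :
    (∀ (Y' : Prevariety ℂ) (g : Y'.carrier ⟶ Y.carrier), g ≫ Y.struct = Y'.struct →
        CurveCoveringProperty (pullback.snd p g)) ↔
      (Topology.IsQuotientMap p.base ∧
        ∀ (Y' : Prevariety ℂ) (g : Y'.carrier ⟶ Y.carrier), g ≫ Y.struct = Y'.struct →
          Topology.IsQuotientMap (pullback.snd p g).base) := by
  have := X.locallyOfFiniteType
  have := X.quasiCompact
  have := Y.locallyOfFiniteType
  have := Y.quasiCompact
  have hpft : LocallyOfFiniteType p := by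
    have : LocallyOfFiniteType (p ≫ Y.struct) := by rw [hp]; infer_instance
    exact locallyOfFiniteType_of_comp p Y.struct
  have hXn : IsNoetherian X.carrier :=
    { toIsLocallyNoetherian := LocallyOfFiniteType.isLocallyNoetherian X.struct
      toCompactSpace := QuasiCompact.compactSpace_of_compactSpace X.struct }
  have hpqc : QuasiCompact p := inferInstance
  have hps : Surjective p := ⟨hsurj⟩
  constructor
  · intro H
    have key : ∀ (Y' : Prevariety ℂ) (g : Y'.carrier ⟶ Y.carrier), g ≫ Y.struct = Y'.struct →
          Topology.IsQuotientMap (pullback.snd p g).base := by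
      intro Y' g hg
      have := Y'.locallyOfFiniteType
      have := Y'.quasiCompact
      exact cc_dir1 (pullback.snd p g) Y'.struct (pullback.snd p g).surjective (H Y' g hg)
    refine ⟨?_, key⟩
    have h1 := key Y (𝟙 _) (Category.id_comp _)
    have h2 : p.base ∘ (pullback.fst p (𝟙 _)).base = (pullback.snd p (𝟙 _)).base := by
      have h3 : pullback.fst p (𝟙 _) ≫ p = pullback.snd p (𝟙 _) := by
        rw [pullback.condition, Category.comp_id]
      ext z
      exact congrArg (fun r : pullback p (𝟙 _) ⟶ Y.carrier => r.base z) h3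
    rw [← h2] at h1
    exact Topology.IsQuotientMap.of_comp (pullback.fst p (𝟙 _)).continuous p.continuous h1
  · rintro ⟨-, H⟩ Y' g hg C hC y hyC hy
    have := Y'.locallyOfFiniteType
    have := Y'.quasiCompact
    let Z : TopologicalSpace.Closeds Y'.carrier := ⟨C, hC.1⟩
    let i := (Scheme.IdealSheafData.vanishingIdeal Z).subschemeι
    let W : Prevariety ℂ :=
      { carrier := (Scheme.IdealSheafData.vanishingIdeal Z).subscheme
        struct := i ≫ Y'.struct
        reduced := cc_reduced Z
        locallyOfFiniteType := inferInstance
        quasiCompact := inferInstance }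
    have := W.locallyOfFiniteType
    have := W.quasiCompact
    have hW := H W (i ≫ g) (by rw [Category.assoc, hg])
    have hN : IsNoetherian (pullback p (i ≫ g)) :=
      { toIsLocallyNoetherian :=
          LocallyOfFiniteType.isLocallyNoetherian (pullback.snd p (i ≫ g) ≫ W.struct)
        toCompactSpace :=
          QuasiCompact.compactSpace_of_compactSpace (pullback.snd p (i ≫ g) ≫ W.struct) }
    refine cc_dir2 (pullback.snd p g) (pullback.snd p g ≫ Y'.struct) C hC y hyC hy i ?_
      (pullback.snd p (i ≫ g))
      (pullback.lift (pullback.fst _ _) (pullback.snd p (i ≫ g) ≫ i) (by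
        rw [pullback.condition, Category.assoc])) (pullback.lift_snd _ _ _) hW
    exact (Scheme.IdealSheafData.vanishingIdeal Z).range_subschemeι
end
end

section
/- Let p : X → Y be a surjective, universally submersive morphism of prevarieties over ℂ (this is equivalent to p being weakly proper), let Y be normal, and let f : X → Z be a morphism into a variety Z. If f is constant on the fibres of p, then there is a unique morphism f̃ : Y → Z such that f = f̃ ∘ p. -/
open AlgebraicGeometry CategoryTheory CategoryTheory.Limits

universe u

noncomputable section

section AlgebraCore
open Polynomial TensorProduct

lemma exists_field_pair {R S : Type u} [CommRing R] [CommRing S] (φ : R →+* S)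
    (w w' : PrimeSpectrum S) (h : PrimeSpectrum.comap φ w = PrimeSpectrum.comap φ w') :
    ∃ (Ω : Type u) (_ : Field Ω) (α β : S →+* Ω), α.comp φ = β.comp φ ∧
      RingHom.ker α = w.asIdeal ∧ RingHom.ker β = w'.asIdeal := by
  let v : Ideal R := w.asIdeal.comap φ
  have hv' : v = w'.asIdeal.comap φ := congrArg PrimeSpectrum.asIdeal h
  have : v.IsPrime := inferInstanceAs (w.asIdeal.comap φ).IsPrime
  let f₁ : v.ResidueField →+* w.asIdeal.ResidueField := Ideal.ResidueField.map v w.asIdeal φ rfl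
  let f₂ : v.ResidueField →+* w'.asIdeal.ResidueField := Ideal.ResidueField.map v w'.asIdeal φ hv'
  let := f₁.toAlgebra
  let := f₂.toAlgebra
  let T := w.asIdeal.ResidueField ⊗[v.ResidueField] w'.asIdeal.ResidueField
  obtain ⟨m, hm⟩ := Ideal.exists_maximal T
  let Ω := T ⧸ m
  let : Field Ω := Ideal.Quotient.field m
  let a : w.asIdeal.ResidueField →+* Ω :=
    (Ideal.Quotient.mk m).comp Algebra.TensorProduct.includeLeftRingHom
  let b : w'.asIdeal.ResidueField →+* Ω :=
    (Ideal.Quotient.mk m).comp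
      (Algebra.TensorProduct.includeRight (R := v.ResidueField)
        (A := w.asIdeal.ResidueField)).toRingHom
  refine ⟨Ω, inferInstance, a.comp (algebraMap S _), b.comp (algebraMap S _), ?_, ?_, ?_⟩
  · ext r
    have e1 : algebraMap S w.asIdeal.ResidueField (φ r) =
        algebraMap v.ResidueField _ (algebraMap R _ r) :=
      (Ideal.ResidueField.map_algebraMap v w.asIdeal φ rfl r).symm
    have e2 : algebraMap S w'.asIdeal.ResidueField (φ r) =
        algebraMap v.ResidueField _ (algebraMap R _ r) :=
      (Ideal.ResidueField.map_algebraMap v w'.asIdeal φ hv' r).symm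
    simp only [RingHom.comp_apply, e1, e2, a, b]
    congr 1
    exact Algebra.TensorProduct.tmul_one_eq_one_tmul _
  · ext x
    simp [RingHom.mem_ker, map_eq_zero]
  · ext x
    simp [RingHom.mem_ker, map_eq_zero]

lemma isClosed_image_of_saturated {R S : Type u} [CommRing R] [CommRing S] (φ : R →+* S)
    (hq : Topology.IsQuotientMap (PrimeSpectrum.comap φ)) (t : S)
    (ht : ∀ (Ω : Type u) [Field Ω] (α β : S →+* Ω), α.comp φ = β.comp φ → α t = 0 → β t = 0) :
    IsClosed (PrimeSpectrum.comap φ '' PrimeSpectrum.zeroLocus {t}) := by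
  rw [← hq.isClosed_preimage]
  convert PrimeSpectrum.isClosed_zeroLocus {t}
  refine subset_antisymm ?_ (Set.subset_preimage_image _ _)
  rintro w' ⟨w, hw, e⟩
  obtain ⟨Ω, _, α, β, h, hα, hβ⟩ := exists_field_pair φ w w' e
  rw [PrimeSpectrum.mem_zeroLocus, Set.singleton_subset_iff, SetLike.mem_coe] at hw ⊢
  rw [← hα, RingHom.mem_ker] at hw
  rw [← hβ, RingHom.mem_ker]
  exact ht Ω α β h hw

lemma isIntegral_of_geomConst {R S : Type u} [CommRing R] [CommRing S] [Algebra R S]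
    (hq : Topology.IsQuotientMap (PrimeSpectrum.comap (mapRingHom (algebraMap R S)))) (r : S)
    (hr : ∀ (Ω : Type u) [Field Ω] (α β : S →+* Ω),
      α.comp (algebraMap R S) = β.comp (algebraMap R S) → α r = β r) : IsIntegral R r := by
  nontriviality R
  nontriviality S
  let p : S[X] := C r * X - 1
  have : (1 : R[X]) ∈ Ideal.span {X} ⊔ (Ideal.span {p}).comap (mapRingHom (algebraMap R S)) := by
    have H := isClosed_image_of_saturated _ hq p (by
      intro Ω _ α β h h0
      have h1 : α (C r) = β (C r) := by
        refine hr Ω (α.comp C) (β.comp C) ?_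
        ext x
        simpa using congr($h (C x))
      have h2 : α X = β X := by simpa using congr($h X)
      simpa [p, h1, h2] using h0)
    rw [← PrimeSpectrum.zeroLocus_span, ← closure_eq_iff_isClosed, PrimeSpectrum.closure_image_comap_zeroLocus] at H
    rw [← Ideal.eq_top_iff_one, sup_comm, ← PrimeSpectrum.zeroLocus_empty_iff_eq_top, PrimeSpectrum.zeroLocus_sup, H]
    suffices ∀ (a : PrimeSpectrum S[X]), p ∈ a.asIdeal → X ∉ a.asIdeal by
      simpa [Set.eq_empty_iff_forall_notMem]
    intro q hpq hXq
    have : 1 ∈ q.asIdeal := by simpa [p] using! (sub_mem (q.asIdeal.mul_mem_left (C r) hXq) hpq)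
    exact q.2.ne_top (q.asIdeal.eq_top_iff_one.mpr this)
  obtain ⟨a, b, hb, e⟩ := Ideal.mem_span_singleton_sup.mp this
  obtain ⟨c, hc : b.map (algebraMap R S) = _⟩ := Ideal.mem_span_singleton.mp hb
  refine ⟨b.reverse * X ^ (1 + c.natDegree), ?_, ?_⟩
  · refine Monic.mul ?_ (by simp)
    have h : b.coeff 0 = 1 := by simpa using! congr(($e).coeff 0)
    have : b.natTrailingDegree = 0 := by simp [h]
    rw [Monic.def, reverse_leadingCoeff, trailingCoeff, this, h]
  · have : p.natDegree ≤ 1 := by simpa using! natDegree_linear_le (a := r) (b := -1)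
    rw [eval₂_eq_eval_map, reverse, Polynomial.map_mul, ← reflect_map, Polynomial.map_pow,
      map_X, ← revAt_zero (1 + _), ← reflect_monomial,
      ← reflect_mul _ _ natDegree_map_le (by simp), pow_zero, mul_one, hc,
      ← add_assoc, reflect_mul _ _ (this.trans (by simp)) le_rfl,
      eval_mul, reflect_sub, reflect_mul _ _ (by simp) (by simp)]
    simp [← pow_succ']

lemma mem_range_of_geomConst_field {K L : Type u} [Field K] [CharZero K] [Field L] [Algebra K L]
    (s : L) (hs : IsIntegral K s)
    (hr : ∀ (Ω : Type u) [Field Ω] (α β : L →+* Ω),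
      α.comp (algebraMap K L) = β.comp (algebraMap K L) → α s = β s) :
    s ∈ (algebraMap K L).range := by
  let E := IntermediateField.adjoin K {s}
  have : FiniteDimensional K E := IntermediateField.adjoin.finiteDimensional hs
  have : Algebra.FormallyUnramified K E := Algebra.FormallyUnramified.of_isSeparable K E
  have : _root_.IsReduced (E ⊗[K] E) := Algebra.FormallyUnramified.isReduced_of_field E (E ⊗[K] E)
  let s' : E := IntermediateField.AdjoinSimple.gen K s
  have hinj : Function.Injective (Algebra.TensorProduct.map E.val E.val) :=
    TensorProduct.map_injective_of_flat_flat E.val.toLinearMap E.val.toLinearMap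
      E.val.injective E.val.injective
  have h0 : s' ⊗ₜ[K] (1 : E) - (1 : E) ⊗ₜ[K] s' = 0 := by
    apply IsNilpotent.eq_zero
    rw [← IsNilpotent.map_iff hinj]
    rw [← mem_nilradical, nilradical_eq_sInf, Ideal.mem_sInf]
    intro J hJ
    have : J.IsPrime := hJ
    let q : (L ⊗[K] L) →+* FractionRing ((L ⊗[K] L) ⧸ J) :=
      (algebraMap ((L ⊗[K] L) ⧸ J) (FractionRing ((L ⊗[K] L) ⧸ J))).comp (Ideal.Quotient.mk J)
    have key := hr _ (q.comp Algebra.TensorProduct.includeLeftRingHom)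
      (q.comp (Algebra.TensorProduct.includeRight (R := K) (A := L) (B := L)).toRingHom) (by
        ext x
        exact congrArg q (Algebra.TensorProduct.tmul_one_eq_one_tmul (A := L) (B := L) x))
    rw [← Ideal.Quotient.eq_zero_iff_mem]
    apply IsFractionRing.injective ((L ⊗[K] L) ⧸ J) (FractionRing ((L ⊗[K] L) ⧸ J))
    rw [map_zero]
    change q _ = 0
    rw [map_sub, map_sub, sub_eq_zero]
    simpa using! key
  have hmem (x : E) : (x : E) ⊗ₜ[K] (1 : E) = (1 : E) ⊗ₜ[K] x := by
    have : (Algebra.TensorProduct.includeLeft : E →ₐ[K] E ⊗[K] E) =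
        Algebra.TensorProduct.includeRight := by
      apply (IntermediateField.adjoin.powerBasis hs).algHom_ext
      rw [IntermediateField.adjoin.powerBasis_gen]
      exact sub_eq_zero.mp h0
    exact congr($this x)
  have hepi : Algebra.IsEpi K E :=
    (Algebra.isEpi_iff_forall_one_tmul_eq K E).mpr fun x ↦ (hmem x).symm
  obtain ⟨k, hk⟩ := Algebra.isEpi_iff_surjective_algebraMap_of_finite.mp hepi s'
  exact ⟨k, congrArg (algebraMap E L) hk⟩

lemma core {A B : Type u} [CommRing A] [IsDomain A] [IsIntegrallyClosed A] [CharZero A]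
    [CommRing B] [_root_.IsReduced B] [Algebra A B]
    (hq0 : Topology.IsQuotientMap (PrimeSpectrum.comap (algebraMap A B)))
    (hq : Topology.IsQuotientMap (PrimeSpectrum.comap (mapRingHom (algebraMap A B)))) (s : B)
    (hs : ∀ (Ω : Type u) [Field Ω] (α β : B →+* Ω),
      α.comp (algebraMap A B) = β.comp (algebraMap A B) → α s = β s) :
    s ∈ (algebraMap A B).range := by
  have hInteg := isIntegral_of_geomConst hq s hs
  obtain ⟨ξ, hξ⟩ := hq0.surjective ⊥
  have hξ' : ξ.asIdeal.comap (algebraMap A B) = ⊥ := congrArg PrimeSpectrum.asIdeal hξ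
  let L := ξ.asIdeal.ResidueField
  let K := FractionRing A
  have hAL (a : A) : algebraMap A L a = algebraMap B L (algebraMap A B a) :=
    IsScalarTower.algebraMap_apply A B L a
  have : FaithfulSMul A L := by
    rw [faithfulSMul_iff_algebraMap_injective, injective_iff_map_eq_zero]
    intro a ha
    rw [hAL, Ideal.algebraMap_residueField_eq_zero, ← Ideal.mem_comap, hξ'] at ha
    exact ha
  let : Algebra K L := FractionRing.liftAlgebra A L
  have : IsScalarTower A K L := FractionRing.isScalarTower_liftAlgebra A L
  let sb : L := algebraMap B L s
  have hsb : IsIntegral A sb := hInteg.algebraMap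
  obtain ⟨k, hk⟩ := mem_range_of_geomConst_field (K := K) sb hsb.tower_top (by
    intro Ω _ α β h
    refine hs Ω (α.comp (algebraMap B L)) (β.comp (algebraMap B L)) ?_
    ext a
    simp only [RingHom.comp_apply]
    rw [← hAL, IsScalarTower.algebraMap_apply A K L]
    exact congr($h _))
  have hkint : IsIntegral A k := by
    rw [← isIntegral_algebraMap_iff (algebraMap K L).injective, hk]
    exact hsb
  obtain ⟨a, rfl⟩ := IsIntegrallyClosed.isIntegral_iff.mp hkint
  refine ⟨a, ?_⟩
  have hcl := isClosed_image_of_saturated _ hq0 (s - algebraMap A B a) (by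
    intro Ω _ α β h h0
    have h1 := hs Ω α β h
    have h2 : α (algebraMap A B a) = β (algebraMap A B a) := congr($h a)
    rwa [map_sub, ← h1, ← h2, ← map_sub])
  have hbot : (⊥ : PrimeSpectrum A) ∈ PrimeSpectrum.comap (algebraMap A B) ''
      PrimeSpectrum.zeroLocus {s - algebraMap A B a} := by
    refine ⟨ξ, ?_, hξ⟩
    rw [PrimeSpectrum.mem_zeroLocus, Set.singleton_subset_iff, SetLike.mem_coe,
      ← Ideal.algebraMap_residueField_eq_zero, map_sub, sub_eq_zero, ← hAL,
      IsScalarTower.algebraMap_apply A K L]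
    exact hk.symm
  symm
  rw [← sub_eq_zero]
  apply IsNilpotent.eq_zero
  rw [← mem_nilradical, nilradical_eq_sInf, Ideal.mem_sInf]
  intro J hJ
  have hJ' : J.IsPrime := hJ
  have hin : PrimeSpectrum.comap (algebraMap A B) ⟨J, hJ'⟩ ∈ PrimeSpectrum.comap (algebraMap A B) ''
      PrimeSpectrum.zeroLocus {s - algebraMap A B a} :=
    hcl.stableUnderSpecialization ((PrimeSpectrum.le_iff_specializes _ _).mp bot_le) hbot
  obtain ⟨w, hw, e⟩ := hin
  obtain ⟨Ω, _, α, β, h, hα, hβ⟩ := exists_field_pair _ w ⟨J, hJ'⟩ e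
  rw [PrimeSpectrum.mem_zeroLocus, Set.singleton_subset_iff, SetLike.mem_coe] at hw
  rw [← hα, RingHom.mem_ker] at hw
  change _ = J at hβ
  rw [← hβ, RingHom.mem_ker]
  have h1 := hs Ω α β h
  have h2 : α (algebraMap A B a) = β (algebraMap A B a) := congr($h a)
  rwa [map_sub, ← h1, ← h2, ← map_sub]

end AlgebraCore

lemma epi_of_surjective_of_isReduced {X Y : Scheme.{u}} (f : X ⟶ Y) [Surjective f] [IsReduced Y] :
    Epi f := by
  constructor
  intro Z g h e
  have hs : Surjective (equalizer.ι g h) := by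
    have : Surjective (equalizer.lift f e ≫ equalizer.ι g h) := by
      rw [equalizer.lift_ι]; infer_instance
    exact Surjective.of_comp (equalizer.lift f e) _
  have : IsClosedImmersion (equalizer.ι g h) :=
    .of_isPreimmersion _ (by rw [hs.surj.range_eq]; exact isClosed_univ)
  have := isIso_of_isClosedImmersion_of_surjective (equalizer.ι g h)
  rw [← cancel_epi (equalizer.ι g h)]
  exact equalizer.condition g h

lemma geomConst {X Y Z : Scheme.{0}} (p : X ⟶ Y) (f : X ⟶ Z)
    (sX : X ⟶ Spec (.of ℂ)) (sY : Y ⟶ Spec (.of ℂ)) (sZ : Z ⟶ Spec (.of ℂ))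
    [LocallyOfFiniteType sX] [LocallyOfFiniteType sY] [LocallyOfFiniteType sZ] [IsSeparated sZ]
    (hp : p ≫ sY = sX) (hf : f ≫ sZ = sX)
    (hconst : ∀ x x' : X, p x = p x' → f x = f x')
    (Ω : Type) [Field Ω] (a b : Spec (.of Ω) ⟶ X) (h : a ≫ p = b ≫ p) : a ≫ f = b ≫ f := by
  let l := pullback.lift a b h
  obtain ⟨R, j, hj, hz⟩ : ∃ (R : CommRingCat.{0}) (j : Spec R ⟶ pullback p p),
      IsOpenImmersion j ∧ Set.range l ⊆ Set.range j := by
    let z := l default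
    obtain ⟨R, j, hj, hz, -⟩ := Scheme.exists_affine_mem_range_and_range_subset
      (x := z) (U := ⊤) trivial
    refine ⟨R, j, hj, ?_⟩
    rintro _ ⟨x, rfl⟩
    rwa [Subsingleton.elim x default]
  let l' : Spec (.of Ω) ⟶ Spec R := IsOpenImmersion.lift j l hz
  have hl' : l' ≫ j = l := IsOpenImmersion.lift_fac _ _ _
  obtain ⟨ρ, hρ⟩ := Spec.map_surjective l'
  let π : R ⟶ .of (R ⧸ nilradical R) := CommRingCat.ofHom (Ideal.Quotient.mk _)
  let σ : CommRingCat.of (R ⧸ nilradical R) ⟶ .of Ω :=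
    CommRingCat.ofHom (Ideal.Quotient.lift _ ρ.hom fun x hx ↦ by
      have : IsNilpotent (ρ.hom x) := (mem_nilradical.mp hx).map ρ.hom
      exact this.eq_zero)
  have hσ : π ≫ σ = ρ := by
    ext x
    rfl
  let k : Spec (.of (R ⧸ nilradical R)) ⟶ pullback p p := Spec.map π ≫ j
  have hk : Spec.map σ ≫ k = l := by
    rw [← hl', ← hρ, ← hσ, Spec.map_comp, Category.assoc]
  have : IsReduced (Spec (.of (R ⧸ nilradical R))) := by
    have : _root_.IsReduced (R ⧸ nilradical R) :=
      (Ideal.isRadical_iff_quotient_reduced _).mp (Ideal.radical_isRadical _)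
    have : _root_.IsReduced (CommRingCat.of (R ⧸ nilradical R)) := this
    infer_instance
  have : IsClosedImmersion (Spec.map π) :=
    IsClosedImmersion.spec_of_surjective _ Ideal.Quotient.mk_surjective
  have : LocallyOfFiniteType p := by
    have : LocallyOfFiniteType (p ≫ sY) := hp ▸ inferInstance
    exact locallyOfFiniteType_of_comp p sY
  have key : k ≫ pullback.fst p p ≫ f = k ≫ pullback.snd p p ≫ f := by
    have e1 : (k ≫ pullback.fst p p ≫ f) ≫ sZ = k ≫ pullback.fst p p ≫ sX := by
      simp only [Category.assoc, hf]
    have : LocallyOfFiniteType ((k ≫ pullback.fst p p ≫ f) ≫ sZ) := by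
      rw [e1]; infer_instance
    refine ext_of_apply_eq sZ Set.univ isOpen_univ.isLocallyClosed dense_univ ?_ ?_
    · intro x _ _
      simp only [Scheme.Hom.comp_apply]
      apply hconst
      rw [← Scheme.Hom.comp_apply, ← Scheme.Hom.comp_apply, pullback.condition]
      rfl
    · rw [e1]
      simp only [Category.assoc, hf]
      rw [← hp, pullback.condition_assoc]
  have := congr(Spec.map σ ≫ $key)
  rw [reassoc_of% hk, reassoc_of% hk] at this
  simp only [l] at this
  rwa [pullback.lift_fst_assoc, pullback.lift_snd_assoc] at this

lemma exists_affine_nbhd {Y : Scheme.{0}} (sY : Y ⟶ Spec (.of ℂ)) [LocallyOfFiniteType sY]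
    (hnormal : ∀ y : Y, IsDomain (Y.presheaf.stalk y) ∧ IsIntegrallyClosed (Y.presheaf.stalk y))
    (y : Y) (W : Y.Opens) (hy : y ∈ W) :
    ∃ (A : CommRingCat.{0}) (j : Spec A ⟶ Y), IsOpenImmersion j ∧ y ∈ Set.range j ∧
      Set.range j ⊆ W ∧ IsDomain A ∧ IsIntegrallyClosed A ∧ CharZero A := by
  have : IsLocallyNoetherian Y := LocallyOfFiniteType.isLocallyNoetherian sY
  obtain ⟨U, hyU, hU, hUW, hinj⟩ := Y.exists_le_and_germ_injective y W hy
  have := (hnormal y).1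
  have hdom : IsDomain Γ(Y, U) := hinj.isDomain (Y.presheaf.germ U y hyU).hom
  have hchar : CharZero Γ(Y, U) := by
    obtain ⟨ρ, -⟩ := Spec.map_surjective (hU.fromSpec ≫ sY)
    let φ : ℂ →+* Γ(Y, U) := ρ.hom
    exact charZero_of_injective_ringHom φ.injective
  refine ⟨Γ(Y, U), hU.fromSpec, inferInstance, ?_, ?_, hdom, ?_, hchar⟩
  · rw [hU.range_fromSpec]; exact hyU
  · rw [hU.range_fromSpec]; exact hUW
  · apply IsIntegrallyClosed.of_localization_maximal
    intro m _ hm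
    let q : PrimeSpectrum Γ(Y, U) := ⟨m, hm.isPrime⟩
    have hq : hU.fromSpec q ∈ U := by
      have : hU.fromSpec q ∈ Set.range hU.fromSpec := ⟨_, rfl⟩
      rwa [hU.range_fromSpec] at this
    let := TopCat.Presheaf.algebra_section_stalk Y.presheaf ⟨_, hq⟩
    have h1 : IsLocalization m.primeCompl (Y.presheaf.stalk (hU.fromSpec q)) := hU.isLocalization_stalk' q hq
    have := (hnormal (hU.fromSpec q)).2
    have e := IsLocalization.algEquiv m.primeCompl (Y.presheaf.stalk (hU.fromSpec q)) (Localization.AtPrime m)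
    exact IsIntegrallyClosed.of_equiv e.toRingEquiv


lemma quot_of_pullback {X Y S S' W W' : Scheme.{u}} (p : X ⟶ Y) (j : S ⟶ Y) (c : S' ⟶ S)
    (q : W ⟶ pullback p j) [Surjective q] [UniversallyOpen q]
    (a : W' ⟶ W) (b : W' ⟶ S') (hP : IsPullback a b (q ≫ pullback.snd p j) c)
    (h : Topology.IsQuotientMap (pullback.snd p (c ≫ j))) : Topology.IsQuotientMap b := by
  have t := IsPullback.of_right' (IsPullback.of_hasPullback p (c ≫ j)) (IsPullback.of_hasPullback p j)
  have t2 := IsPullback.of_bot' hP t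
  have hl := t.lift_snd (a ≫ q) b (by rw [Category.assoc, hP.w])
  have h1 : Surjective (t.lift (a ≫ q) b (by rw [Category.assoc, hP.w])) :=
    MorphismProperty.of_isPullback (P := @Surjective) t2 inferInstance
  have h2 : UniversallyOpen (t.lift (a ≫ q) b (by rw [Category.assoc, hP.w])) :=
    MorphismProperty.of_isPullback (P := @UniversallyOpen) t2 inferInstance
  rw [← hl, Scheme.Hom.comp_base, TopCat.coe_comp]
  exact h.comp ((Scheme.Hom.isOpenMap _).isQuotientMap (Scheme.Hom.continuous _) h1.surj)

lemma exists_affine_local_cover (X : Scheme.{u}) [CompactSpace X] [IsReduced X] :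
    ∃ (B : CommRingCat.{u}) (q : Spec B ⟶ X), Surjective q ∧ UniversallyOpen q ∧
      _root_.IsReduced B := by
  have h1 : MorphismProperty.IsMultiplicative (C := Scheme.{u}) @IsLocalIso := inferInstance
  have h2 := h1.toContainsIdentities
  obtain ⟨W, q, hs, hq, hW⟩ := X.exists_hom_isAffine_of_isZariskiLocalAtSource
    (@IsLocalIso : MorphismProperty Scheme.{u})
  have h3 : MorphismProperty.ContainsIdentities (C := Scheme.{u}) @UniversallyOpen :=
    ⟨fun _ ↦ inferInstance⟩
  have ho : UniversallyOpen q := IsLocalIso.le_of_isZariskiLocalAtSource @UniversallyOpen _ _ q hq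
  have : IsReduced W := by
    have (x : W) : _root_.IsReduced (W.presheaf.stalk x) := by
      obtain ⟨U, hxU, hU⟩ := hq.exists_isOpenImmersion x
      have h4 : IsReduced U.toScheme := isReduced_of_isOpenImmersion (U.ι ≫ q)
      have h5 : _root_.IsReduced (U.toScheme.presheaf.stalk ⟨x, hxU⟩) := isReduced_stalk_of_isReduced _ _
      have e := (U.stalkIso ⟨x, hxU⟩).symm.commRingCatIsoToRingEquiv
      exact isReduced_of_injective e.toRingHom e.injective
    exact isReduced_of_isReduced_stalk W
  exact ⟨Γ(W, ⊤), W.isoSpec.inv ≫ q, inferInstance, inferInstance, inferInstance⟩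


lemma exists_local_factorization (X Y Z : Prevariety ℂ) (p : X.carrier ⟶ Y.carrier)
    (hp : p ≫ Y.struct = X.struct)
    (hsurj : Function.Surjective p.base)
    (hsub : Topology.IsQuotientMap p.base)
    (huniv : ∀ (Y' : Prevariety ℂ) (g : Y'.carrier ⟶ Y.carrier), g ≫ Y.struct = Y'.struct →
      Topology.IsQuotientMap (pullback.snd p g).base)
    (hnormal : ∀ y : Y.carrier, IsDomain (Y.carrier.presheaf.stalk y) ∧
      IsIntegrallyClosed (Y.carrier.presheaf.stalk y))
    (hZsep : IsSeparated Z.struct)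
    (f : X.carrier ⟶ Z.carrier) (hf : f ≫ Z.struct = X.struct)
    (hconst : ∀ x x' : X.carrier, p.base x = p.base x' → f.base x = f.base x') (y : Y.carrier) :
    ∃ (A : CommRingCat.{0}) (j : Spec A ⟶ Y.carrier) (g : Spec A ⟶ Z.carrier), IsOpenImmersion j ∧
      y ∈ Set.range j ∧ pullback.snd p j ≫ g = pullback.fst p j ≫ f := by
  have := X.reduced
  have := Y.reduced
  have := X.locallyOfFiniteType
  have := Y.locallyOfFiniteType
  have := Z.locallyOfFiniteType
  have := X.quasiCompact
  have := Y.quasiCompact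
  have : IsLocallyNoetherian X.carrier := LocallyOfFiniteType.isLocallyNoetherian X.struct
  have : CompactSpace X.carrier := QuasiCompact.compactSpace_of_compactSpace X.struct
  have : IsLocallyNoetherian Y.carrier := LocallyOfFiniteType.isLocallyNoetherian Y.struct
  have : CompactSpace Y.carrier := QuasiCompact.compactSpace_of_compactSpace Y.struct
  have : IsNoetherian X.carrier := {}
  have : IsNoetherian Y.carrier := {}
  -- shrink
  obtain ⟨x, rfl⟩ := hsurj y
  obtain ⟨C, i, hi, hx, -⟩ := Scheme.exists_affine_mem_range_and_range_subset
      (X := Z.carrier) (x := f x) (U := ⊤) trivial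
  have hW : IsOpen (p '' (f ⁻¹' Set.range i)) := by
    refine hsub.isOpen_preimage.mp ?_
    have : p ⁻¹' (p '' (f ⁻¹' Set.range i)) = f ⁻¹' Set.range i := by
      ext a
      constructor
      · rintro ⟨b, hb, hab⟩
        have := hconst _ _ hab
        change f a ∈ Set.range i
        have h2 : f b = f a := this
        rw [← h2]; exact hb
      · intro ha
        exact ⟨a, ha, rfl⟩
    change IsOpen (p ⁻¹' (p '' (f ⁻¹' Set.range i)))
    rw [this]
    exact i.isOpenEmbedding.isOpen_range.preimage f.continuous
  obtain ⟨A, j, hj, hyj, hjW, hA1, hA2, hA3⟩ := exists_affine_nbhd Y.struct hnormal (p x) ⟨_, hW⟩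
    ⟨x, hx, rfl⟩
  refine ⟨A, j, ?_⟩
  have : CompactSpace (pullback p j : Scheme.{0}) :=
    QuasiCompact.compactSpace_of_compactSpace (pullback.fst p j)
  have : IsReduced (pullback p j) := isReduced_of_isOpenImmersion (pullback.fst p j)
  obtain ⟨B, q, hqs, hqo, hB⟩ := exists_affine_local_cover (pullback p j)
  obtain ⟨φ, hφ⟩ := Spec.map_surjective (q ≫ pullback.snd p j)
  have hrange : Set.range (q ≫ pullback.fst p j ≫ f) ⊆ Set.range i := by
    rintro _ ⟨z, rfl⟩
    have h1 : p ((q ≫ pullback.fst p j) z) ∈ Set.range j := by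
      refine ⟨(q ≫ pullback.snd p j) z, ?_⟩
      simp only [← Scheme.Hom.comp_apply, Category.assoc, pullback.condition]
    obtain ⟨b, hb, hb'⟩ := hjW h1
    have h2 := hconst _ _ hb'
    have h3 : f b = f ((q ≫ pullback.fst p j) z) := h2
    have h4 : (q ≫ pullback.fst p j ≫ f) z = f b := by
      rw [h3]; rfl
    rw [h4]; exact hb
  obtain ⟨ψ, hψ⟩ := Spec.map_surjective (IsOpenImmersion.lift i _ hrange)
  have hψi : Spec.map ψ ≫ i = q ≫ pullback.fst p j ≫ f := by
    rw [hψ, IsOpenImmersion.lift_fac]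
  let : Algebra A B := φ.hom.toAlgebra
  have hφa : φ.hom = algebraMap A B := rfl
  have hq0 : Topology.IsQuotientMap (PrimeSpectrum.comap (algebraMap A B)) := by
    let Y' : Prevariety ℂ := ⟨Spec A, 𝟙 _ ≫ j ≫ Y.struct, inferInstance, inferInstance, inferInstance⟩
    have h1 := huniv Y' (𝟙 _ ≫ j) (by simp [Y'])
    exact quot_of_pullback p j (𝟙 _) q (𝟙 _) (Spec.map φ) (by
      rw [hφ]; exact IsPullback.of_horiz_isIso ⟨by simp⟩) h1
  have hq1 : Topology.IsQuotientMap
      (PrimeSpectrum.comap (Polynomial.mapRingHom (algebraMap A B))) := by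
    let c : Spec (.of (Polynomial A)) ⟶ Spec A :=
      Spec.map (CommRingCat.ofHom (algebraMap A (Polynomial A)))
    have hred : IsReduced (Spec (.of (Polynomial A))) := by
      have : _root_.IsReduced (CommRingCat.of (Polynomial A)) :=
        inferInstanceAs (_root_.IsReduced (Polynomial A))
      infer_instance
    have hc : LocallyOfFiniteType c := by
      refine (HasRingHomProperty.Spec_iff (P := @LocallyOfFiniteType)).mpr ?_
      exact (RingHom.finiteType_algebraMap).mpr inferInstance
    let Y' : Prevariety ℂ :=
      ⟨Spec (.of (Polynomial A)), (c ≫ j) ≫ Y.struct, hred, inferInstance, inferInstance⟩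
    have h1 := huniv Y' (c ≫ j) (by simp [Y'])
    algebraize [Polynomial.mapRingHom φ.hom]
    have hP := (isPullback_SpecMap_of_isPushout _ _ _ _
      (CommRingCat.isPushout_of_isPushout A B (Polynomial A) (Polynomial B)))
    exact quot_of_pullback p j c q
      (Spec.map (CommRingCat.ofHom (algebraMap B (Polynomial B))))
      (Spec.map (CommRingCat.ofHom (Polynomial.mapRingHom (algebraMap A B))))
      (by rw [← hφ]; exact hP) h1
  have hmem : ∀ c : C, ψ.hom c ∈ (algebraMap A B).range := by
    intro c
    refine core hq0 hq1 _ ?_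
    intro Ω _ α β hαβ
    let a : Spec (.of Ω) ⟶ Spec B := Spec.map (CommRingCat.ofHom α)
    let b : Spec (.of Ω) ⟶ Spec B := Spec.map (CommRingCat.ofHom β)
    have hab : a ≫ Spec.map φ = b ≫ Spec.map φ := by
      simp only [a, b, ← Spec.map_comp]
      congr 1
      ext z
      exact congr($hαβ z)
    have := geomConst p f X.struct Y.struct Z.struct hp hf hconst Ω
      (a ≫ q ≫ pullback.fst p j) (b ≫ q ≫ pullback.fst p j) (by
        simp only [Category.assoc, pullback.condition]
        rw [← reassoc_of% hφ, reassoc_of% hab])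
    simp only [Category.assoc, ← hψi] at this
    rw [← Category.assoc, ← Category.assoc, cancel_mono] at this
    simp only [a, b, ← Spec.map_comp] at this
    have h2 := Spec.map_injective this
    exact congr($(h2).hom c)
  have hφinj : Function.Injective φ.hom := by
    rw [injective_iff_map_eq_zero]
    intro a ha
    obtain ⟨P, hP⟩ := hq0.surjective ⟨⊥, Ideal.isPrime_bot⟩
    have h1 : a ∈ (PrimeSpectrum.comap (algebraMap A B) P).asIdeal := by
      change φ.hom a ∈ P.asIdeal
      rw [ha]; exact zero_mem _
    rw [hP] at h1
    exact h1
  choose χ0 hχ0 using hmem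
  let χ : C →+* A := {
    toFun := χ0
    map_one' := hφinj (by simp [hφa, hχ0])
    map_zero' := hφinj (by simp [hφa, hχ0])
    map_add' a b := hφinj (by simp [hφa, hχ0])
    map_mul' a b := hφinj (by simp [hφa, hχ0]) }
  have hχ : CommRingCat.ofHom χ ≫ φ = ψ := by
    ext c
    exact hχ0 c
  refine ⟨Spec.map (CommRingCat.ofHom χ) ≫ i, hj, hyj, ?_⟩
  have := epi_of_surjective_of_isReduced q
  rw [← cancel_epi q, ← hψi, ← reassoc_of% hφ, ← hχ, Spec.map_comp, Category.assoc]

/-- Factorization through a weakly proper (= surjective and universally submersive)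
morphism onto a normal prevariety: a morphism to a variety that is constant on the
fibres factors uniquely. -/
theorem factorization_through_weakly_proper
    (X Y Z : Prevariety ℂ) (p : X.carrier ⟶ Y.carrier)
    (hp : p ≫ Y.struct = X.struct)
    (hsurj : Function.Surjective p.base)
    (hsub : Topology.IsQuotientMap p.base)
    (huniv : ∀ (Y' : Prevariety ℂ) (g : Y'.carrier ⟶ Y.carrier), g ≫ Y.struct = Y'.struct →
      Topology.IsQuotientMap (pullback.snd p g).base)
    (hnormal : ∀ y : Y.carrier, IsDomain (Y.carrier.presheaf.stalk y) ∧
      IsIntegrallyClosed (Y.carrier.presheaf.stalk y))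
    (hZsep : IsSeparated Z.struct)
    (f : X.carrier ⟶ Z.carrier) (hf : f ≫ Z.struct = X.struct)
    (hconst : ∀ x x' : X.carrier, p.base x = p.base x' → f.base x = f.base x') :
    ∃! ft : Y.carrier ⟶ Z.carrier, f = p ≫ ft := by
  have := X.reduced
  have := Y.reduced
  have hs : Surjective p := ⟨hsurj⟩
  have hepi := epi_of_surjective_of_isReduced p
  choose A j g hj hy hg using
    exists_local_factorization X Y Z p hp hsurj hsub huniv hnormal hZsep f hf hconst
  let 𝒰 : Y.carrier.OpenCover := Scheme.Cover.mkOfCovers Y.carrier (fun y ↦ Spec (A y)) j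
    (fun y ↦ ⟨y, hy y⟩) hj
  have hcompat : ∀ y y', pullback.fst (j y) (j y') ≫ g y = pullback.snd (j y) (j y') ≫ g y' := by
    intro y y'
    have hr : IsReduced (pullback (j y) (j y')) :=
      isReduced_of_isOpenImmersion (pullback.fst (j y) (j y') ≫ j y)
    let r := pullback.snd p (pullback.fst (j y) (j y') ≫ j y)
    let t := pullback.fst p (pullback.fst (j y) (j y') ≫ j y)
    have hr2 := epi_of_surjective_of_isReduced r
    have ht : t ≫ p = r ≫ pullback.fst (j y) (j y') ≫ j y := pullback.condition
    have h1 : r ≫ pullback.fst (j y) (j y') ≫ g y = t ≫ f := by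
      let l := pullback.lift t (r ≫ pullback.fst (j y) (j y')) (by rw [ht, Category.assoc])
      have e1 : l ≫ pullback.snd p (j y) = r ≫ pullback.fst (j y) (j y') := pullback.lift_snd ..
      have e2 : l ≫ pullback.fst p (j y) = t := pullback.lift_fst ..
      rw [← reassoc_of% e1, hg, reassoc_of% e2]
    have h2 : r ≫ pullback.snd (j y) (j y') ≫ g y' = t ≫ f := by
      let l := pullback.lift (f := p) (g := j y') t (r ≫ pullback.snd (j y) (j y'))
        (ht.trans (by simp only [Category.assoc, pullback.condition]))
      have e1 : l ≫ pullback.snd p (j y') = r ≫ pullback.snd (j y) (j y') := pullback.lift_snd ..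
      have e2 : l ≫ pullback.fst p (j y') = t := pullback.lift_fst ..
      rw [← reassoc_of% e1, hg, reassoc_of% e2]
    rw [← cancel_epi r, h1, h2]
  let ft : Y.carrier ⟶ Z.carrier := Scheme.Cover.glueMorphisms 𝒰 g hcompat
  have hft : ∀ y, j y ≫ ft = g y := fun y ↦ Scheme.Cover.ι_glueMorphisms 𝒰 g hcompat y
  have hloc : ∀ y, pullback.fst p (j y) ≫ f = pullback.fst p (j y) ≫ p ≫ ft := by
    intro y
    rw [pullback.condition_assoc, hft, hg]
  have hfac : f = p ≫ ft := by
    refine Scheme.Cover.hom_ext (𝒰.pullback₁ p) _ _ fun y ↦ ?_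
    exact hloc y
  refine ⟨ft, hfac, fun ft' h' ↦ ?_⟩
  rw [← cancel_epi p]
  exact h'.symm.trans hfac
end
end

section
/- Let ℙ¹ be the projective line over ℂ, 𝔸¹ the affine line over ℂ, and Z a variety over ℂ. Let ψ : ℙ¹ ×_ℂ 𝔸¹ → Z be a morphism of ℂ-schemes which maps all closed points of ℙ¹ × {0} to one single point z ∈ Z. Then ψ is constant on the closed points of ℙ¹ × {s} for every closed point s of 𝔸¹, i.e. ψ does not depend on the first coordinate. -/
open AlgebraicGeometry CategoryTheory CategoryTheory.Limits

universe u

noncomputable section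

attribute [local instance] MvPolynomial.gradedAlgebra

/-- The standard grading on `ℂ[X₀, X₁]`. -/
abbrev P1grading : ℕ → Submodule ℂ (MvPolynomial (Fin 2) ℂ) :=
  MvPolynomial.homogeneousSubmodule (Fin 2) ℂ

/-- The projective line `ℙ¹ = Proj ℂ[X₀, X₁]` over `ℂ`. -/
def ProjLine : Scheme := Proj P1grading

/-- The structure morphism of `ℙ¹` over `ℂ`. -/
def ProjLineStruct : ProjLine ⟶ Spec (CommRingCat.of ℂ) :=
  Proj.toSpecZero P1grading ≫ Spec.map (CommRingCat.ofHom (algebraMap ℂ (P1grading 0)))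

/-- The affine line `𝔸¹ = Spec ℂ[t]` over `ℂ`. -/
def AffLine : Scheme := Spec (CommRingCat.of (Polynomial ℂ))

/-- The structure morphism of `𝔸¹` over `ℂ`. -/
def AffLineStruct : AffLine ⟶ Spec (CommRingCat.of ℂ) :=
  Spec.map (CommRingCat.ofHom (algebraMap ℂ (Polynomial ℂ)))

/-- The closed point `0` of the affine line, i.e. the maximal ideal `(t)`. -/
def originA1 : AffLine :=
  (⟨Ideal.span {Polynomial.X}, (Ideal.span_singleton_prime Polynomial.X_ne_zero).mpr
      Polynomial.prime_X⟩ : PrimeSpectrum (Polynomial ℂ))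

/-- The fibre product `ℙ¹ ×_ℂ 𝔸¹`. -/
def P1xA1 : Scheme := pullback ProjLineStruct AffLineStruct

/-- The second projection `ℙ¹ ×_ℂ 𝔸¹ ⟶ 𝔸¹`. -/
def sndP1xA1 : P1xA1 ⟶ AffLine := pullback.snd ProjLineStruct AffLineStruct

/-- Rigidity lemma over an algebraically closed field. -/
theorem rigidity_aux {K : Type u} [Field K] [IsAlgClosed K] {X Y Z : Scheme.{u}}
    (f : X ⟶ Spec (CommRingCat.of K)) (g : Y ⟶ Spec (CommRingCat.of K))
    (h : Z ⟶ Spec (CommRingCat.of K))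
    [IsProper f] [IrreducibleSpace X] [LocallyOfFiniteType g] [IsIntegral Y]
    [IsSeparated h] [LocallyOfFiniteType h]
    (ψ : pullback f g ⟶ Z) (hψ : ψ ≫ h = pullback.snd f g ≫ g)
    (y₀ : Y) (hy₀ : IsClosed ({y₀} : Set Y)) (z : Z)
    (hz : ∀ w : (pullback f g : Scheme.{u}), IsClosed ({w} : Set (pullback f g : Scheme.{u})) →
      pullback.snd f g w = y₀ → ψ w = z)
    (w w' : (pullback f g : Scheme.{u})) (hw : IsClosed ({w} : Set (pullback f g : Scheme.{u})))
    (hw' : IsClosed ({w'} : Set (pullback f g : Scheme.{u})))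
    (hww : pullback.snd f g w = pullback.snd f g w') : ψ w = ψ w' := by
  let pt : Spec (CommRingCat.of K) := IsLocalRing.closedPoint K
  let q := pullback.snd f g ≫ g
  have hq : LocallyOfFiniteType q := inferInstance
  have hJ : JacobsonSpace (pullback f g : Scheme.{u}) :=
    LocallyOfFiniteType.jacobsonSpace (Y := Spec _) q
  have hJX : JacobsonSpace X := LocallyOfFiniteType.jacobsonSpace (Y := Spec _) f
  let γ : pullback f g ⟶ pullback g h := pullback.lift (pullback.snd f g) ψ hψ.symm
  have hγ1 : γ ≫ pullback.fst g h = pullback.snd f g := pullback.lift_fst _ _ _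
  have hγ2 : γ ≫ pullback.snd g h = ψ := pullback.lift_snd _ _ _
  have hγ1' (x) : pullback.fst g h (γ x) = pullback.snd f g x := by
    rw [← hγ1]; rfl
  have hγ2' (x) : pullback.snd g h (γ x) = ψ x := by
    rw [← hγ2]; rfl
  have hP : IsProper (γ ≫ pullback.fst g h) := by rw [hγ1]; infer_instance
  have hPγ : IsProper γ := .of_comp γ (pullback.fst g h)
  have hpt (v) (hv : IsClosed ({v} : Set (pullback f g : Scheme.{u}))) {T : Scheme.{u}}
      (φ : pullback f g ⟶ T) : (pointOfClosedPoint q v hv ≫ φ) pt = φ v := by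
    rw [Scheme.Hom.comp_apply, pointOfClosedPoint_apply]
  have hfin : (γ '' ((γ ≫ pullback.fst g h) ⁻¹' {y₀})).Finite := by
    rw [hγ1]
    have hcl : IsClosed (pullback.snd f g ⁻¹' {y₀}) :=
      hy₀.preimage (pullback.snd f g).continuous
    by_cases hne : (pullback.snd f g ⁻¹' {y₀}).Nonempty
    swap
    · rw [Set.not_nonempty_iff_eq_empty.mp hne]; simp
    obtain ⟨w₀, hw₀, hw₀c⟩ := nonempty_inter_closedPoints hne hcl.isLocallyClosed
    refine (Set.finite_singleton (γ w₀)).subset ?_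
    rw [Set.image_subset_iff, ← Set.sdiff_eq_empty, ← Set.not_nonempty_iff_eq_empty]
    intro H
    obtain ⟨c, ⟨hc₁, hc₂⟩, hc₃⟩ := nonempty_inter_closedPoints H <| by
      rw [Set.sdiff_eq_compl_inter]
      refine (IsOpen.isLocallyClosed ?_).inter hcl.isLocallyClosed
      refine (IsClosed.preimage γ.continuous ?_).isOpen_compl
      simpa using γ.isClosedMap _ hw₀c
    refine hc₂ ?_
    replace hc₃ : IsClosed ({c} : Set (pullback f g : Scheme.{u})) := hc₃
    replace hw₀c : IsClosed ({w₀} : Set (pullback f g : Scheme.{u})) := hw₀c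
    have e : pointOfClosedPoint q c hc₃ ≫ γ = pointOfClosedPoint q w₀ hw₀c ≫ γ := by
      apply pullback.hom_ext
      · simp only [Category.assoc, hγ1]
        refine ext_of_apply_closedPoint_eq g ?_ ?_ ?_
        · exact (Category.assoc _ _ _).trans (pointOfClosedPoint_comp q c hc₃)
        · exact (Category.assoc _ _ _).trans (pointOfClosedPoint_comp q w₀ hw₀c)
        · exact (hpt c hc₃ _).trans ((hc₁.trans hw₀.symm).trans (hpt w₀ hw₀c _).symm)
      · simp only [Category.assoc, hγ2]
        refine ext_of_apply_closedPoint_eq h ?_ ?_ ?_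
        · rw [Category.assoc, hψ]; exact pointOfClosedPoint_comp q c hc₃
        · rw [Category.assoc, hψ]; exact pointOfClosedPoint_comp q w₀ hw₀c
        · exact (hpt c hc₃ _).trans (((hz c hc₃ hc₁).trans (hz w₀ hw₀c hw₀).symm).trans
            (hpt w₀ hw₀c _).symm)
    exact (hpt c hc₃ γ).symm.trans (congr($e pt).trans (hpt w₀ hw₀c γ))
  obtain ⟨U, hyU, hU⟩ := exists_finite_imageι_comp_morphismRestrict_of_finite_image_preimage
    γ (pullback.fst g h) y₀ hfin
  have HU (y : Y) (hy : y ∈ U) : (γ '' (pullback.snd f g ⁻¹' {y})).Finite := by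
    refine (((((γ.imageι ≫ pullback.fst g h) ∣_ U).finite_preimage_singleton ⟨y, hy⟩).image
      (Scheme.Opens.ι _ ≫ γ.imageι))).subset ?_
    rintro _ ⟨x, hx, rfl⟩
    have hx' : (γ.imageι ≫ pullback.fst g h) (γ.toImage x) = y := by
      rw [← Scheme.Hom.comp_apply, Scheme.Hom.toImage_imageι_assoc, hγ1]; exact hx
    refine ⟨⟨γ.toImage x, ?_⟩, ?_, ?_⟩
    · change (γ.imageι ≫ pullback.fst g h) (γ.toImage x) ∈ U
      rw [hx']; exact hy
    · apply Subtype.ext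
      exact (morphismRestrict_base_coe _ U _).trans hx'
    · change γ.imageι (γ.toImage x) = γ x
      rw [← Scheme.Hom.comp_apply, Scheme.Hom.toImage_imageι]
  -- slices
  have key (y : Y) (hyU : y ∈ U) (b : Spec (CommRingCat.of K) ⟶ Y) (hb : b ≫ g = 𝟙 _)
      (hby : b pt = y) (x x' : X) :
      (pullback.lift (𝟙 X) (f ≫ b) (by simp [hb]) ≫ ψ) x =
      (pullback.lift (𝟙 X) (f ≫ b) (by simp [hb]) ≫ ψ : X ⟶ Z) x' := by
    set σ : X ⟶ pullback f g := pullback.lift (𝟙 X) (f ≫ b) (by simp [hb]) with hσ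
    have hσ2 : σ ≫ pullback.snd f g = f ≫ b := pullback.lift_snd _ _ _
    have hp : IsProper ((σ ≫ ψ) ≫ h) := by
      rw [Category.assoc, hψ, reassoc_of% hσ2, hb, Category.comp_id]; infer_instance
    have hp' : IsProper (σ ≫ ψ) := .of_comp (σ ≫ ψ) h
    refine subsingleton_image_closure_of_finite_of_isPreirreducible (S := (Set.univ : Set X))
      isClosed_univ.isLocallyClosed (IrreducibleSpace.isIrreducible_univ X).isPreirreducible
      (σ ≫ ψ).continuous (σ ≫ ψ).isClosedMap ?_
      ⟨x, subset_closure (Set.mem_univ _), rfl⟩ ⟨x', subset_closure (Set.mem_univ _), rfl⟩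
    refine ((HU y hyU).image (pullback.snd g h)).subset ?_
    rintro _ ⟨a, -, rfl⟩
    refine ⟨γ (σ a), ⟨σ a, ?_, rfl⟩, ?_⟩
    · change pullback.snd f g (σ a) = y
      rw [← Scheme.Hom.comp_apply, hσ2, Scheme.Hom.comp_apply, ← hby]
      congr 1
      exact Subsingleton.elim (α := PrimeSpectrum K) _ _
    · rw [hγ2', Scheme.Hom.comp_apply]
  let τ (p : Spec (CommRingCat.of K) ⟶ X) (hp : p ≫ f = 𝟙 _) : Y ⟶ pullback f g :=
    pullback.lift (g ≫ p) (𝟙 Y) (by simp [hp])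
  have hτ1 (p : Spec (CommRingCat.of K) ⟶ X) (hp : p ≫ f = 𝟙 _) :
      τ p hp ≫ pullback.fst f g = g ≫ p := pullback.lift_fst _ _ _
  have hτ2 (p : Spec (CommRingCat.of K) ⟶ X) (hp : p ≫ f = 𝟙 _) :
      τ p hp ≫ pullback.snd f g = 𝟙 Y := pullback.lift_snd _ _ _
  have hττ (p p' : Spec (CommRingCat.of K) ⟶ X) (hp : p ≫ f = 𝟙 _) (hp' : p' ≫ f = 𝟙 _) :
      τ p hp ≫ ψ = τ p' hp' ≫ ψ := by
    have h1 (p : Spec (CommRingCat.of K) ⟶ X) (hp : p ≫ f = 𝟙 _) : (τ p hp ≫ ψ) ≫ h = g := by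
      rw [Category.assoc, hψ, ← Category.assoc, hτ2 p hp, Category.id_comp]
    have : LocallyOfFiniteType ((τ p hp ≫ ψ) ≫ h) := by rw [h1 p hp]; infer_instance
    refine ext_of_apply_eq h (U : Set Y) U.isOpen.isLocallyClosed (U.isOpen.dense ⟨_, hyU⟩) ?_ ?_
    · intro y hy hyc
      have h2 (p : Spec (CommRingCat.of K) ⟶ X) (hp : p ≫ f = 𝟙 _) : (τ p hp ≫ ψ) y =
          (pullback.lift (𝟙 X) (f ≫ pointOfClosedPoint g y hyc) (by simp) ≫ ψ : X ⟶ Z)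
            (p pt) := by
        have e : pointOfClosedPoint g y hyc ≫ τ p hp =
            p ≫ pullback.lift (𝟙 X) (f ≫ pointOfClosedPoint g y hyc) (by simp) := by
          apply pullback.hom_ext
          · rw [Category.assoc, Category.assoc, hτ1 p hp, pullback.lift_fst, ← Category.assoc,
              pointOfClosedPoint_comp, Category.id_comp, Category.comp_id]
          · rw [Category.assoc, Category.assoc, hτ2 p hp, pullback.lift_snd, ← Category.assoc,
              hp, Category.id_comp, Category.comp_id]
        have e' := congr(($e ≫ ψ) pt)
        simpa only [Scheme.Hom.comp_apply, pointOfClosedPoint_apply] using e'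
      rw [h2 p hp, h2 p' hp']
      exact key y hy _ (by simp) (by simp) _ _
    · rw [h1 p hp, h1 p' hp']
  have hq1 (v) (hv : IsClosed ({v} : Set (pullback f g : Scheme.{u}))) :
      (pointOfClosedPoint q v hv ≫ pullback.snd f g) ≫ g = 𝟙 _ := by
    exact (Category.assoc _ _ _).trans (pointOfClosedPoint_comp q v hv)
  have hq2 (v) (hv : IsClosed ({v} : Set (pullback f g : Scheme.{u}))) :
      (pointOfClosedPoint q v hv ≫ pullback.fst f g) ≫ f = 𝟙 _ := by
    rw [Category.assoc, pullback.condition]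
    exact pointOfClosedPoint_comp q v hv
  have hv (v) (hv : IsClosed ({v} : Set (pullback f g : Scheme.{u}))) :
      ψ v = (τ _ (hq2 v hv) ≫ ψ) (pullback.snd f g v) := by
    have e : pointOfClosedPoint q v hv =
        (pointOfClosedPoint q v hv ≫ pullback.snd f g) ≫ τ _ (hq2 v hv) := by
      apply pullback.hom_ext
      · rw [Category.assoc _ (τ _ (hq2 v hv)), hτ1 _ (hq2 v hv), ← Category.assoc, hq1 v hv, Category.id_comp]
      · rw [Category.assoc _ (τ _ (hq2 v hv)), hτ2 _ (hq2 v hv), Category.comp_id]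
    have e' : (pointOfClosedPoint q v hv ≫ ψ) pt =
        (pointOfClosedPoint q v hv ≫ pullback.snd f g ≫ τ _ (hq2 v hv) ≫ ψ) pt := by
      conv_lhs => rw [e]
      simp only [Category.assoc]
    rw [hpt, hpt] at e'
    exact e'
  rw [hv w hw, hv w' hw', hww, hττ _ _ (hq2 w hw) (hq2 w' hw')]

theorem P1_algebraMap_surjective :
    Function.Surjective (algebraMap ℂ (P1grading 0)) := by
  rintro ⟨a, ha⟩
  have ha' := ha
  rw [P1grading, MvPolynomial.homogeneousSubmodule_zero] at ha'
  obtain ⟨c, hc⟩ := Submodule.mem_one.mp ha'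
  exact ⟨c, Subtype.ext hc⟩

instance P1_isProper : IsProper ProjLineStruct := by
  have h1 : Algebra.FiniteType (P1grading 0) (MvPolynomial (Fin 2) ℂ) :=
    have : IsScalarTower ℂ (P1grading 0) (MvPolynomial (Fin 2) ℂ) :=
      ⟨fun a b c => by
        rw [Algebra.smul_def (a • b) c, Algebra.smul_def b c]
        exact smul_mul_assoc a (b : MvPolynomial (Fin 2) ℂ) c⟩
    Algebra.FiniteType.of_restrictScalars_finiteType ℂ _ _
  have h2 : IsClosedImmersion
      (Spec.map (CommRingCat.ofHom (algebraMap ℂ (P1grading 0)))) :=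
    IsClosedImmersion.spec_of_surjective _ P1_algebraMap_surjective
  have h3 : IsProper (Proj.toSpecZero P1grading) := inferInstance
  exact inferInstanceAs (IsProper (Proj.toSpecZero P1grading ≫
    Spec.map (CommRingCat.ofHom (algebraMap ℂ (P1grading 0)))))

instance P1_irreducible : IrreducibleSpace ProjLine := by
  let η : ProjectiveSpectrum P1grading :=
    ⟨⊥, by
      change (⊥ : Ideal (MvPolynomial (Fin 2) ℂ)).IsPrime
      exact Ideal.isPrime_bot, by
      intro hle
      have hX : (MvPolynomial.X 0 : MvPolynomial (Fin 2) ℂ) ∈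
          HomogeneousIdeal.irrelevant P1grading := by
        rw [HomogeneousIdeal.mem_irrelevant_iff, GradedRing.proj_apply]
        rw [DirectSum.decompose_of_mem_ne (i := 1) P1grading
          (MvPolynomial.isHomogeneous_X ℂ 0) one_ne_zero]
      have := hle hX
      exact MvPolynomial.X_ne_zero (R := ℂ) (0 : Fin 2) this⟩
  have : IsIrreducible (Set.univ : Set (ProjectiveSpectrum P1grading)) := by
    have h1 : closure ({η} : Set (ProjectiveSpectrum P1grading)) = Set.univ := by
      refine Set.eq_univ_of_forall fun x => ?_
      rw [← ProjectiveSpectrum.le_iff_mem_closure, ← ProjectiveSpectrum.as_ideal_le_as_ideal]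
      exact bot_le
    rw [← h1]
    exact isIrreducible_singleton.closure
  exact (irreducibleSpace_def (ProjectiveSpectrum P1grading)).mpr this

theorem originA1_isClosed : IsClosed ({originA1} : Set AffLine) := by
  refine (PrimeSpectrum.isClosed_singleton_iff_isMaximal
    (R := Polynomial ℂ) originA1).mpr ?_
  exact PrincipalIdealRing.isMaximal_of_irreducible Polynomial.prime_X.irreducible

instance AffLineStruct_ft : LocallyOfFiniteType AffLineStruct := by
  have : LocallyOfFiniteType
      (Spec.map (CommRingCat.ofHom (algebraMap ℂ (Polynomial ℂ)))) := by
    rw [HasRingHomProperty.Spec_iff (P := @LocallyOfFiniteType)]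
    exact (RingHom.finiteType_algebraMap).mpr inferInstance
  exact this

instance AffLine_integral : IsIntegral AffLine := by
  unfold AffLine
  infer_instance

/-- Let `ψ : ℙ¹ ×_ℂ 𝔸¹ → Z` be a morphism of `ℂ`-schemes into a variety `Z` over `ℂ`
which maps all closed points of the fibre `ℙ¹ × {0}` of the second projection to a single
point `z ∈ Z`. Then `ψ` is constant on the closed points of `ℙ¹ × {s}` for every
closed point `s` of `𝔸¹`, i.e. `ψ` does not depend on the first coordinate. -/
theorem psi_constant_on_fibres
    (Z : Scheme.{0}) (sZ : Z ⟶ Spec (CommRingCat.of ℂ))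
    (hZred : IsReduced Z) (hZft : LocallyOfFiniteType sZ) (hZqc : QuasiCompact sZ)
    (hZsep : IsSeparated sZ)
    (ψ : P1xA1 ⟶ Z)
    (hψ : ψ ≫ sZ = sndP1xA1 ≫ AffLineStruct)
    (z : Z)
    (hz : ∀ w : P1xA1, IsClosed ({w} : Set P1xA1) → sndP1xA1.base w = originA1 →
      ψ.base w = z) :
    ∀ s : AffLine, IsClosed ({s} : Set AffLine) →
      ∀ w w' : P1xA1, IsClosed ({w} : Set P1xA1) → IsClosed ({w'} : Set P1xA1) →
        sndP1xA1.base w = s → sndP1xA1.base w' = s →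
          ψ.base w = ψ.base w' := by
  intro s _ w w' hw hw' hs hs'
  exact rigidity_aux ProjLineStruct AffLineStruct sZ ψ hψ originA1 originA1_isClosed z hz w w'
    hw hw' (hs.trans hs'.symm)
end
end

section
/- Let Y be a scheme of finite type over an algebraically closed field k, let A ⊆ Y be a constructible subset, and let y be a closed point of Y with y ∈ closure(A) \ A. Then there exists an irreducible closed subset C ⊆ Y of topological Krull dimension 1 with y ∈ C such that C ∩ A contains a subset that is open and dense in C. -/
open AlgebraicGeometry CategoryTheory

universe u

noncomputable section

open Polynomial in
lemma core_minpoly {A B : Type*} [CommRing A] [IsDomain A] [IsIntegrallyClosed A] [CommRing B]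
    [IsDomain B] [Algebra A B] [Algebra.IsIntegral A B] [Module.IsTorsionFree A B]
    (g x : A) (hg : Prime g) (hgx : ¬ g ∣ x) (s b : B) (h : x • s = g • b) :
    ∃ n, s ^ n ∈ Ideal.span {algebraMap A B g} := by
  have hs : IsIntegral A s := Algebra.IsIntegral.isIntegral s
  have hb : IsIntegral A b := Algebra.IsIntegral.isIntegral b
  have hx0 : x ≠ 0 := by rintro rfl; exact hgx (dvd_zero _)
  have h1 := IsIntegrallyClosed.minpoly_smul (R := A) hx0 hs
  have h2 := IsIntegrallyClosed.minpoly_smul (R := A) hg.ne_zero hb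
  rw [h, h2] at h1
  have hdeg : (minpoly A s).natDegree = (minpoly A b).natDegree := by
    have := congrArg natDegree h1
    simpa using this.symm
  have hco : ∀ i < (minpoly A s).natDegree, g ∣ (minpoly A s).coeff i := by
    intro i hi
    have h3 := congrArg (fun p => p.coeff i) h1
    simp only [coeff_scaleRoots] at h3
    have h4 : g ∣ (minpoly A s).coeff i * x ^ ((minpoly A s).natDegree - i) := by
      rw [← h3]
      exact Dvd.dvd.mul_left (dvd_pow_self g (by omega)) _
    rcases hg.dvd_or_dvd h4 with h5 | h5
    · exact h5
    · exact absurd (hg.dvd_of_dvd_pow h5) hgx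
  refine ⟨(minpoly A s).natDegree, ?_⟩
  have h6 := minpoly.aeval A s
  rw [aeval_eq_sum_range, Finset.sum_range_succ, (minpoly.monic hs).coeff_natDegree, one_smul] at h6
  rw [eq_neg_of_add_eq_zero_right h6]
  refine neg_mem (Ideal.sum_mem _ fun i hi => ?_)
  obtain ⟨c, hc⟩ := hco i (Finset.mem_range.1 hi)
  rw [Ideal.mem_span_singleton, hc, Algebra.smul_def, map_mul, mul_assoc]
  exact dvd_mul_right _ _

open MvPolynomial in
lemma lin_prime {k : Type*} [Field k] {n : ℕ} (a b : k) (i j : Fin n) (hij : i ≠ j)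
    (h : a ≠ 0 ∨ b ≠ 0) (t : Fin n → k) :
    Prime (C a * (X i - C (t i)) + C b * (X j - C (t j)) : MvPolynomial (Fin n) k) := by
  set p := (C a * (X i - C (t i)) + C b * (X j - C (t j)) : MvPolynomial (Fin n) k) with hp
  have h0 : eval t p = 0 := by simp [hp]
  have hex : ∃ u, eval u p ≠ 0 := by
    rcases h with h | h
    · refine ⟨Function.update t i (t i + 1), ?_⟩
      simpa [hp, hij.symm] using h
    · refine ⟨Function.update t j (t j + 1), ?_⟩
      simpa [hp, hij] using h
  obtain ⟨u, hu⟩ := hex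
  rw [← irreducible_iff_prime]
  apply MvPolynomial.irreducible_of_totalDegree_eq_one
  · have hle : p.totalDegree ≤ 1 := by
      refine (totalDegree_add _ _).trans (max_le ?_ ?_)
      · refine (totalDegree_mul _ _).trans ?_
        have := totalDegree_sub (X i : MvPolynomial (Fin n) k) (C (t i))
        simp at this ⊢
        exact this
      · refine (totalDegree_mul _ _).trans ?_
        have := totalDegree_sub (X j : MvPolynomial (Fin n) k) (C (t j))
        simp at this ⊢
        exact this
    have hne : p.totalDegree ≠ 0 := by
      intro h1
      rw [totalDegree_eq_zero_iff_eq_C] at h1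
      rw [h1] at h0 hu
      simp at h0 hu
      exact hu h0
    omega
  · intro x hx
    rw [isUnit_iff_ne_zero]
    rintro rfl
    apply hu
    have : p = 0 := by
      ext i
      simpa using hx i
    simp [this]

lemma dim_le_one_of_forall {k : Type*} [Field k] [IsAlgClosed k] {B : Type*} [CommRing B]
    [IsDomain B] [Algebra k B] {d : ℕ} (φ : MvPolynomial (Fin d) k →ₐ[k] B)
    (hinj : Function.Injective φ) (hint : φ.IsIntegral) (m : Ideal B) [hm : m.IsMaximal] (f : B)
    (hf : f ≠ 0) (H : ∀ Q : Ideal B, Q.IsPrime → Q ≠ ⊥ → Q ≤ m → f ∈ Q) : d ≤ 1 := by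
  by_contra hd
  push Not at hd
  let i : Fin d := ⟨0, by omega⟩
  let j : Fin d := ⟨1, by omega⟩
  have hij : i ≠ j := by simp [i, j]
  let _ : Algebra (MvPolynomial (Fin d) k) B := φ.toRingHom.toAlgebra
  have : Algebra.IsIntegral (MvPolynomial (Fin d) k) B := ⟨hint⟩
  have : FaithfulSMul (MvPolynomial (Fin d) k) B :=
    (faithfulSMul_iff_algebraMap_injective _ _).2 hinj
  have : Module.IsTorsionFree (MvPolynomial (Fin d) k) B := inferInstance
  have hn := Ideal.isMaximal_comap_of_isIntegral_of_isMaximal (R := MvPolynomial (Fin d) k) m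
  obtain ⟨t, ht⟩ := (MvPolynomial.isMaximal_iff_eq_vanishingIdeal_singleton (K := k)).1 hn
  have hne := Ideal.comap_ne_bot_of_integral_mem (R := MvPolynomial (Fin d) k)
    (I := Ideal.span {f}) hf (Ideal.mem_span_singleton_self f) (Algebra.IsIntegral.isIntegral f)
  obtain ⟨a, ha, ha0⟩ := Submodule.exists_mem_ne_zero_of_ne_bot hne
  rw [Ideal.mem_comap, Ideal.mem_span_singleton] at ha
  obtain ⟨c, hc⟩ := ha
  obtain ⟨u, hu⟩ : ∃ u, MvPolynomial.eval u a ≠ 0 := by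
    by_contra hcon
    push Not at hcon
    exact ha0 (MvPolynomial.funext (fun x => by simp [hcon]))
  obtain ⟨α, β, hαβ, h0⟩ : ∃ α β : k, (α ≠ 0 ∨ β ≠ 0) ∧ α * (u i - t i) + β * (u j - t j) = 0 := by
    by_cases h : u i - t i = 0
    · exact ⟨1, 0, by simp, by simp [h]⟩
    · exact ⟨-(u j - t j), u i - t i, Or.inr h, by ring⟩
  have hl := lin_prime α β i j hij hαβ t
  set l := (MvPolynomial.C α * (MvPolynomial.X i - MvPolynomial.C (t i)) +
    MvPolynomial.C β * (MvPolynomial.X j - MvPolynomial.C (t j)) : MvPolynomial (Fin d) k)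
  have hlu : MvPolynomial.eval u l = 0 := by simpa [l] using h0
  have hla : ¬ l ∣ a := by
    rintro ⟨r, hr⟩
    apply hu
    rw [hr, map_mul, hlu, zero_mul]
  have hlm : algebraMap _ B l ∈ m := by
    rw [← Ideal.mem_comap, ht]
    simp [l]
  have hex : ∃ s ∉ m, ∃ N, s * f ^ N ∈ Ideal.span {algebraMap _ B l} := by
    by_contra hcon
    push Not at hcon
    have hdis : Disjoint (Ideal.span {algebraMap _ B l} : Set B)
        (m.primeCompl ⊔ Submonoid.powers f : Submonoid B) := by
      rw [Set.disjoint_left]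
      intro z hz hz'
      obtain ⟨s, hs, y, ⟨N, rfl⟩, rfl⟩ := Submonoid.mem_sup.1 hz'
      exact hcon s hs N hz
    obtain ⟨Q, hQ, hlQ, hQd⟩ := Ideal.exists_le_prime_disjoint _ _ hdis
    rw [Set.disjoint_left] at hQd
    refine hQd (H Q hQ ?_ ?_) (Submonoid.mem_sup_right (Submonoid.mem_powers f))
    · rintro rfl
      have := hlQ (Ideal.mem_span_singleton_self _)
      rw [Ideal.mem_bot] at this
      exact hl.ne_zero (hinj (this.trans (map_zero φ).symm))
    · intro z hz
      by_contra hzm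
      exact hQd hz (Submonoid.mem_sup_left hzm)
  obtain ⟨s, hs, N, hsN⟩ := hex
  obtain ⟨b, hb⟩ := Ideal.mem_span_singleton.1 hsN
  obtain ⟨n, hn⟩ := core_minpoly l (a ^ N) hl (fun h => hla (hl.dvd_of_dvd_pow h)) s (b * c ^ N)
    (by rw [Algebra.smul_def, Algebra.smul_def, map_pow, hc, mul_pow]
        linear_combination c ^ N * hb)
  exact hs (hm.isPrime.mem_of_pow_mem n
    ((Ideal.span_singleton_le_iff_mem _).2 hlm hn))

lemma exists_chain_of_two_le {k : Type*} [Field k] [IsAlgClosed k] {B : Type*} [CommRing B]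
    [IsDomain B] [Algebra k B] {d : ℕ} (φ : MvPolynomial (Fin d) k →ₐ[k] B)
    (hinj : Function.Injective φ) (hint : φ.IsIntegral) (hd : 2 ≤ d) (h : B) (hh : h ≠ 0) :
    ∃ Q₁ Q₂ : Ideal B, Q₁.IsPrime ∧ Q₂.IsPrime ∧ Q₁ ≠ ⊥ ∧ Q₁ < Q₂ ∧ h ∉ Q₂ := by
  let i : Fin d := ⟨0, by omega⟩
  let j : Fin d := ⟨1, by omega⟩
  have hij : i ≠ j := by simp [i, j]
  let _ : Algebra (MvPolynomial (Fin d) k) B := φ.toRingHom.toAlgebra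
  have : Algebra.IsIntegral (MvPolynomial (Fin d) k) B := ⟨hint⟩
  have : FaithfulSMul (MvPolynomial (Fin d) k) B :=
    (faithfulSMul_iff_algebraMap_injective _ _).2 hinj
  have hne := Ideal.comap_ne_bot_of_integral_mem (R := MvPolynomial (Fin d) k)
    (I := Ideal.span {h}) hh (Ideal.mem_span_singleton_self h) (Algebra.IsIntegral.isIntegral h)
  obtain ⟨a, ha, ha0⟩ := Submodule.exists_mem_ne_zero_of_ne_bot hne
  rw [Ideal.mem_comap, Ideal.mem_span_singleton] at ha
  obtain ⟨u, hu⟩ : ∃ u, MvPolynomial.eval u a ≠ 0 := by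
    by_contra hcon
    push Not at hcon
    exact ha0 (MvPolynomial.funext (fun x => by simp [hcon]))
  have hl := lin_prime (1 : k) 0 i j hij (by simp) u
  set l := (MvPolynomial.C 1 * (MvPolynomial.X i - MvPolynomial.C (u i)) +
    MvPolynomial.C 0 * (MvPolynomial.X j - MvPolynomial.C (u j)) : MvPolynomial (Fin d) k)
  have hP1 : (Ideal.span {l}).IsPrime := (Ideal.span_singleton_prime hl.ne_zero).2 hl
  have hP2 : (RingHom.ker (MvPolynomial.eval u : MvPolynomial (Fin d) k →+* k)).IsPrime :=
    RingHom.ker_isPrime _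
  obtain ⟨Q₁, -, hQ₁, hQ₁'⟩ := Ideal.exists_ideal_over_prime_of_isIntegral (S := B)
    (Ideal.span {l}) ⊥ (by
      exact (Ideal.comap_bot_of_injective (algebraMap _ B) hinj).le.trans bot_le)
  obtain ⟨Q₂, hQ12, hQ₂, hQ₂'⟩ := Ideal.exists_ideal_over_prime_of_isIntegral (S := B)
    (RingHom.ker (MvPolynomial.eval u : MvPolynomial (Fin d) k →+* k)) Q₁ (by
      rw [hQ₁', Ideal.span_singleton_le_iff_mem]
      simp [RingHom.mem_ker, l])
  refine ⟨Q₁, Q₂, hQ₁, hQ₂, ?_, lt_of_le_of_ne hQ12 ?_, ?_⟩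
  · rintro rfl
    rw [Ideal.comap_bot_of_injective (algebraMap _ B) hinj] at hQ₁'
    exact hl.ne_zero (Ideal.span_singleton_eq_bot.1 hQ₁'.symm)
  · rintro rfl
    rw [hQ₁'] at hQ₂'
    have hm : (MvPolynomial.X j - MvPolynomial.C (u j) : MvPolynomial (Fin d) k) ∈
        Ideal.span {l} := by
      rw [hQ₂']; simp [RingHom.mem_ker]
    obtain ⟨r, hr⟩ := Ideal.mem_span_singleton.1 hm
    have := congrArg (MvPolynomial.eval (Function.update u j (u j + 1))) hr
    simp [l, hij] at this
  · intro hhQ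
    apply hu
    have : a ∈ Q₂.comap (algebraMap _ B) := by
      rw [Ideal.mem_comap]
      exact Q₂.mem_of_dvd ha hhQ
    rw [hQ₂'] at this
    exact this

lemma krullDimLE_one_of_le_one {k : Type*} [Field k] {B : Type*} [CommRing B]
    [IsDomain B] [Algebra k B] {d : ℕ} (φ : MvPolynomial (Fin d) k →ₐ[k] B)
    (hint : φ.IsIntegral) (hd : d ≤ 1) :
    ∀ I : Ideal B, I ≠ ⊥ → I.IsPrime → I.IsMaximal := by
  let _ : Algebra (MvPolynomial (Fin d) k) B := φ.toRingHom.toAlgebra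
  have : Algebra.IsIntegral (MvPolynomial (Fin d) k) B := ⟨hint⟩
  have hA : Ring.KrullDimLE 1 (MvPolynomial (Fin d) k) := by
    rw [Ring.krullDimLE_iff, MvPolynomial.ringKrullDim_of_isNoetherianRing,
      ringKrullDim_eq_zero_of_field]
    simpa using hd
  intro I hI hIp
  have h1 : I.comap (algebraMap (MvPolynomial (Fin d) k) B) ≠ ⊥ :=
    fun h => hI (Ideal.eq_bot_of_comap_eq_bot h)
  have h2 : (I.comap (algebraMap (MvPolynomial (Fin d) k) B)).IsPrime := inferInstance
  exact Ideal.isMaximal_of_isIntegral_of_isMaximal_comap I (h2.isMaximal_of_ne_bot h1)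

lemma lt_comap_mk {R : Type*} [CommRing R] (q : Ideal R) (Q : Ideal (R ⧸ q)) (hQ : Q ≠ ⊥) :
    q < Q.comap (Ideal.Quotient.mk q) := by
  have hsurj := Ideal.Quotient.mk_surjective (I := q)
  have hb : (⊥ : Ideal (R ⧸ q)).comap (Ideal.Quotient.mk q) = q := by
    rw [← RingHom.ker_eq_comap_bot, Ideal.mk_ker]
  refine lt_of_le_of_ne ?_ ?_
  · conv_lhs => rw [← hb]
    exact Ideal.comap_mono bot_le
  · intro h
    exact hQ (Ideal.comap_injective_of_surjective _ hsurj (h.symm.trans hb.symm))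

lemma comap_map_mk {R : Type*} [CommRing R] (q x : Ideal R) (hqx : q ≤ x) :
    (x.map (Ideal.Quotient.mk q)).comap (Ideal.Quotient.mk q) = x := by
  rw [Ideal.comap_map_of_surjective _ Ideal.Quotient.mk_surjective, ← RingHom.ker_eq_comap_bot,
    Ideal.mk_ker]
  exact sup_eq_left.2 hqx

lemma no_chain {R : Type*} [CommRing R] (q : PrimeSpectrum R)
    (H : ∀ I : Ideal (R ⧸ q.asIdeal), I ≠ ⊥ → I.IsPrime → I.IsMaximal) (z w : PrimeSpectrum R)
    (hqz : q < z) (hzw : z < w) : False := by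
  have hsurj := Ideal.Quotient.mk_surjective (I := q.asIdeal)
  have hcm := comap_map_mk q.asIdeal z.asIdeal hqz.le
  have hmax : (z.asIdeal.map (Ideal.Quotient.mk q.asIdeal)).IsMaximal := by
    refine H _ ?_ (Ideal.map_isPrime_of_surjective hsurj (by rw [Ideal.mk_ker]; exact hqz.le))
    intro h
    rw [h, ← RingHom.ker_eq_comap_bot, Ideal.mk_ker] at hcm
    exact hqz.ne (PrimeSpectrum.ext hcm)
  have hz := Ideal.comap_isMaximal_of_surjective _ hsurj
    (K := z.asIdeal.map (Ideal.Quotient.mk q.asIdeal))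
  rw [hcm] at hz
  exact hzw.ne (PrimeSpectrum.ext (hz.eq_of_le w.2.ne_top hzw.le))

lemma exists_curve_prime {k : Type*} [Field k] [IsAlgClosed k] {R : Type*} [CommRing R]
    [Algebra k R] [Algebra.FiniteType k R] (p x : PrimeSpectrum R) (hpx : p ≤ x)
    (hx : x.asIdeal.IsMaximal) (f : R) (hfp : f ∉ p.asIdeal) (hfx : f ∈ x.asIdeal) :
    ∃ q : PrimeSpectrum R, p ≤ q ∧ q < x ∧ f ∉ q.asIdeal ∧ ∀ z w, q < z → ¬ z < w := by
  have : IsNoetherianRing R := Algebra.FiniteType.isNoetherianRing k R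
  obtain ⟨q, ⟨hq, hpq, hqx, hfq⟩, hmax⟩ := (wellFounded_gt (α := Ideal R)).has_min
    {I : Ideal R | I.IsPrime ∧ p.asIdeal ≤ I ∧ I ≤ x.asIdeal ∧ f ∉ I}
    ⟨p.asIdeal, p.2, le_rfl, hpx, hfp⟩
  have hqx' : q < x.asIdeal := lt_of_le_of_ne hqx (by rintro rfl; exact hfq hfx)
  refine ⟨⟨q, hq⟩, hpq, hqx', hfq, ?_⟩
  obtain ⟨d, φ, hinj, hint⟩ := exists_integral_inj_algHom_of_fg k (R ⧸ q)
  have hsurj := Ideal.Quotient.mk_surjective (I := q)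
  have hcm := comap_map_mk q x.asIdeal hqx
  have hm : (x.asIdeal.map (Ideal.Quotient.mk q)).IsMaximal := by
    rcases Ideal.map_eq_top_or_isMaximal_of_surjective _ hsurj hx with h | h
    · rw [h, Ideal.comap_top] at hcm
      exact absurd hcm.symm hx.ne_top
    · exact h
  have hd : d ≤ 1 := by
    refine dim_le_one_of_forall φ hinj hint (x.asIdeal.map (Ideal.Quotient.mk q))
      (Ideal.Quotient.mk q f) (by rwa [Ne, Ideal.Quotient.eq_zero_iff_mem]) ?_
    intro Q hQ hQ0 hQm
    by_contra hfQ
    have hlt := lt_comap_mk q Q hQ0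
    refine hmax (Q.comap (Ideal.Quotient.mk q)) ⟨inferInstance, hpq.trans hlt.le, ?_, hfQ⟩ hlt
    rw [← hcm]; exact Ideal.comap_mono hQm
  exact no_chain ⟨q, hq⟩ (krullDimLE_one_of_le_one φ hint hd)

lemma exists_chain_prime {k : Type*} [Field k] [IsAlgClosed k] {R : Type*} [CommRing R]
    [Algebra k R] [Algebra.FiniteType k R] (q z w : PrimeSpectrum R) (hqz : q < z) (hzw : z < w)
    (h : R) (hh : h ∉ q.asIdeal) :
    ∃ z' w' : PrimeSpectrum R, q < z' ∧ z' < w' ∧ h ∉ w'.asIdeal := by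
  obtain ⟨d, φ, hinj, hint⟩ := exists_integral_inj_algHom_of_fg k (R ⧸ q.asIdeal)
  have hd : 2 ≤ d := by
    by_contra hd
    exact no_chain q (krullDimLE_one_of_le_one φ hint (by omega)) z w hqz hzw
  obtain ⟨Q₁, Q₂, h1, h2, h3, h4, h5⟩ := exists_chain_of_two_le φ hinj hint hd
    (Ideal.Quotient.mk q.asIdeal h) (by rwa [Ne, Ideal.Quotient.eq_zero_iff_mem])
  refine ⟨⟨Q₁.comap (Ideal.Quotient.mk q.asIdeal), inferInstance⟩,
    ⟨Q₂.comap (Ideal.Quotient.mk q.asIdeal), inferInstance⟩, lt_comap_mk _ _ h3, ?_, h5⟩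
  refine lt_of_le_of_ne (Ideal.comap_mono h4.le) ?_
  intro he
  exact h4.ne (Ideal.comap_injective_of_surjective _ Ideal.Quotient.mk_surjective
    (congrArg PrimeSpectrum.asIdeal he))

/-- In a Noetherian ring, a point in the closure of a locally closed subset is a specialization
of a point of the subset. -/
lemma exists_le_of_mem_closure {R : Type*} [CommRing R] [IsNoetherianRing R]
    (T : Set (PrimeSpectrum R)) (hT : IsLocallyClosed T) (x : PrimeSpectrum R)
    (hx : x ∈ closure T) : ∃ p ∈ T, p ≤ x := by
  obtain ⟨S, hSf, hSc, hSi, hSu⟩ :=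
    TopologicalSpace.NoetherianSpace.exists_finite_set_isClosed_irreducible (α := T) isClosed_univ
  have hTu : T = ⋃ Z ∈ S, Subtype.val '' Z := by
    rw [← Set.image_iUnion₂, ← Set.sUnion_eq_biUnion, ← hSu]; simp
  rw [hTu, hSf.closure_biUnion] at hx
  simp only [Set.mem_iUnion] at hx
  obtain ⟨Z, hZ, hxZ⟩ := hx
  have hirr : IsIrreducible (closure (Subtype.val '' Z : Set (PrimeSpectrum R))) :=
    ((hSi Z hZ).image _ continuous_subtype_val.continuousOn).closure
  have hg := hirr.isGenericPoint_genericPoint isClosed_closure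
  refine ⟨hirr.genericPoint, ?_, ?_⟩
  · obtain ⟨U, F, hU, hF, rfl⟩ := hT
    have hsub : (Subtype.val '' Z : Set (PrimeSpectrum R)) ⊆ U ∩ F := by
      rintro _ ⟨a, -, rfl⟩; exact a.2
    refine ⟨?_, ?_⟩
    · rw [hg.mem_open_set_iff hU]
      obtain ⟨a, ha⟩ := (hSi Z hZ).nonempty
      exact ⟨a.1, subset_closure ⟨a, ha, rfl⟩, a.2.1⟩
    · exact closure_minimal (hsub.trans Set.inter_subset_right) hF hg.mem
  · rw [PrimeSpectrum.le_iff_specializes]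
    exact hg.specializes hxZ


lemma exists_chart_s7 (k : Type u) [Field k] (Y : Scheme.{u}) (sY : Y ⟶ Spec (CommRingCat.of k))
    (hft : LocallyOfFiniteType sY) (y : Y) :
    ∃ (R : Type u) (_ : CommRing R) (_ : Algebra k R) (_ : Algebra.FiniteType k R)
      (ι : PrimeSpectrum R → Y), Topology.IsOpenEmbedding ι ∧ y ∈ Set.range ι := by
  obtain ⟨W, hW, hyW, -⟩ := exists_isAffineOpen_mem_and_subset (X := Y) (x := y) (U := ⊤) trivial
  obtain ⟨φ, hφ⟩ := Spec.map_surjective (hW.fromSpec ≫ sY)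
  have h1 : LocallyOfFiniteType (Spec.map φ) := by rw [hφ]; infer_instance
  have h2 := (HasRingHomProperty.Spec_iff (P := @LocallyOfFiniteType)).1 h1
  refine ⟨Γ(Y, W), inferInstance, φ.hom.toAlgebra, h2, hW.fromSpec,
    hW.fromSpec.isOpenEmbedding, ?_⟩
  have h3 : y ∈ (W : Set Y) := hyW
  rw [← hW.range_fromSpec] at h3
  exact h3

lemma topologicalKrullDim_eq_one {X : Type*} [TopologicalSpace X] [QuasiSober X] [T0Space X]
    (η c : X) (hη : ∀ z, η ⤳ z) (hne : η ≠ c)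
    (hno : ∀ z w, z ⤳ w → η ≠ z → z ≠ w → False) : topologicalKrullDim X = 1 := by
  let _ : PartialOrder X := specializationOrder X
  have hdim : topologicalKrullDim X = Order.krullDim X :=
    Order.krullDim_eq_of_orderIso irreducibleSetEquivPoints
  have hle : ∀ a b : X, a ≤ b ↔ b ⤳ a := fun a b => Iff.rfl
  rw [hdim]
  apply le_antisymm
  · rw [Order.krullDim_le_one_iff]
    intro z
    by_cases hz : η = z
    · right
      rintro w -
      rw [← hz]
      exact (hle _ _).2 (hη w)
    · left
      intro w hw
      by_cases hzw : z = w
      · exact hzw.le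
      · exact (hno z w ((hle _ _).1 hw) hz hzw).elim
  · rw [Order.one_le_krullDim_iff]
    exact ⟨c, η, lt_of_le_of_ne ((hle _ _).2 (hη c)) hne.symm⟩

lemma lt_of_specializes {R : Type*} [CommRing R] {Y : Type*} [TopologicalSpace Y]
    {ι : PrimeSpectrum R → Y} (hι : Topology.IsOpenEmbedding ι) {a b : PrimeSpectrum R}
    (h : ι a ⤳ ι b) (hne : ι a ≠ ι b) : a < b := by
  refine lt_of_le_of_ne ?_ (fun h => hne (by rw [h]))
  rw [PrimeSpectrum.le_iff_specializes]
  exact hι.toIsEmbedding.isInducing.specializes_iff.1 h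

lemma specializes_of_le {R : Type*} [CommRing R] {Y : Type*} [TopologicalSpace Y]
    {ι : PrimeSpectrum R → Y} (hι : Topology.IsOpenEmbedding ι) {a b : PrimeSpectrum R}
    (h : a ≤ b) : ι a ⤳ ι b :=
  ((PrimeSpectrum.le_iff_specializes _ _).1 h).map hι.continuous

/-- Let `Y` be a scheme of finite type over an algebraically closed field `k`, `A ⊆ Y` a
constructible subset (a finite union of locally closed subsets) and `y` a closed point of
`Y` lying in `closure A \ A`. Then there is an irreducible closed subset `C ⊆ Y` of
topological Krull dimension `1` containing `y` such that `C ∩ A` contains a subset that is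
open and dense in `C`. -/
theorem exists_curve_meeting_constructible
    (k : Type u) [Field k] [IsAlgClosed k]
    (Y : Scheme.{u}) (sY : Y ⟶ Spec (CommRingCat.of k))
    (hft : LocallyOfFiniteType sY) (hqc : QuasiCompact sY)
    (A : Set Y)
    (hA : ∃ s : Finset (Set Y), (∀ t ∈ s, IsLocallyClosed t) ∧ A = ⋃₀ ↑s)
    (y : Y) (hyc : IsClosed ({y} : Set Y))
    (hy : y ∈ closure A \ A) :
    ∃ C : Set Y, IsClosed C ∧ IsIrreducible C ∧ topologicalKrullDim C = 1 ∧ y ∈ C ∧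
      ∃ U : Set Y, U ⊆ C ∩ A ∧ IsOpen (Subtype.val ⁻¹' U : Set C) ∧
        Dense (Subtype.val ⁻¹' U : Set C) := by
  obtain ⟨s, hs, rfl⟩ := hA
  obtain ⟨hycl, hyA⟩ := hy
  obtain ⟨R, _, _, _, ι, hι, x, rfl⟩ := exists_chart_s7 k Y sY hft y
  have : IsNoetherianRing R := Algebra.FiniteType.isNoetherianRing k R
  have hx : x.asIdeal.IsMaximal := by
    rw [← PrimeSpectrum.isClosed_singleton_iff_isMaximal]
    have := hyc.preimage hι.continuous
    rwa [← Set.image_singleton, Set.preimage_image_eq _ hι.injective] at this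
  rw [s.finite_toSet.closure_sUnion] at hycl
  simp only [Set.mem_iUnion] at hycl
  obtain ⟨T, hTs, hyT⟩ := hycl
  have hTs' : T ∈ s := hTs
  have hT := hs T hTs'
  have hTl : IsLocallyClosed (ι ⁻¹' T) := hT.preimage hι.continuous
  have hxT : x ∈ closure (ι ⁻¹' T) := by
    rw [← hι.isOpenMap.preimage_closure_eq_closure_preimage hι.continuous]
    exact hyT
  obtain ⟨p, hpT, hpx⟩ := exists_le_of_mem_closure _ hTl x hxT
  obtain ⟨U, F, hU, hF, hUF⟩ := hTl
  rw [hUF] at hpT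
  obtain ⟨_, ⟨f, rfl⟩, hpf, hfU⟩ :=
    PrimeSpectrum.isTopologicalBasis_basic_opens.exists_subset_of_mem_open hpT.1 hU
  have hfT : ∀ r : PrimeSpectrum R, p ≤ r → f ∉ r.asIdeal → ι r ∈ ⋃₀ (s : Set (Set Y)) := by
    intro r hpr hfr
    refine ⟨T, hTs, ?_⟩
    change r ∈ ι ⁻¹' T
    rw [hUF]
    exact ⟨hfU hfr, ((PrimeSpectrum.le_iff_specializes _ _).1 hpr).mem_closed hF hpT.2⟩
  have hfx : f ∈ x.asIdeal := by
    by_contra h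
    exact hyA (hfT x hpx h)
  obtain ⟨q, hpq, hqx, hfq, hchain⟩ := exists_curve_prime (k := k) p x hpx hx f hpf hfx
  have hxC : ι x ∈ closure {ι q} := (specializes_of_le hι hqx.le).mem_closure
  have hqC : ι q ∈ closure {ι q} := subset_closure rfl
  have hClosed : IsClosed (closure {ι q}) := isClosed_closure
  -- there is no chain of length two starting at the generic point
  have hno : ∀ z w : Y, ι q ⤳ z → z ⤳ w → ι q ≠ z → z ≠ w → False := by
    intro z w h1 h2 h3 h4
    obtain ⟨R', _, _, _, κ, hκ, w, rfl⟩ := exists_chart_s7 k Y sY hft w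
    obtain ⟨z, rfl⟩ := h2.mem_open hκ.isOpen_range ⟨w, rfl⟩
    obtain ⟨q', hq'⟩ := h1.mem_open hκ.isOpen_range ⟨z, rfl⟩
    rw [← hq'] at h1 h3
    have hopen : IsOpen (κ ⁻¹' Set.range ι) := hι.isOpen_range.preimage hκ.continuous
    obtain ⟨_, ⟨h, rfl⟩, hq'h, hhU⟩ :=
      PrimeSpectrum.isTopologicalBasis_basic_opens.exists_subset_of_mem_open
        (a := q') (show q' ∈ κ ⁻¹' Set.range ι from ⟨q, hq'.symm⟩) hopen
    obtain ⟨z', w', hqz', hzw', hhw'⟩ := exists_chain_prime (k := k) q' z w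
      (lt_of_specializes hκ h1 h3) (lt_of_specializes hκ h2 h4) h hq'h
    obtain ⟨w₁, hw₁⟩ := hhU hhw'
    obtain ⟨z₁, hz₁⟩ := hhU (show h ∉ z'.asIdeal from fun hh => hhw' (hzw'.le hh))
    refine hchain z₁ w₁ (lt_of_specializes hι ?_ ?_) (lt_of_specializes hι ?_ ?_)
    · rw [← hq', hz₁]; exact specializes_of_le hκ hqz'.le
    · rw [← hq', hz₁]; exact fun h => hqz'.ne (hκ.injective h)
    · rw [hz₁, hw₁]; exact specializes_of_le hκ hzw'.le
    · rw [hz₁, hw₁]; exact fun h => hzw'.ne (hκ.injective h)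
  refine ⟨closure {ι q}, hClosed, isIrreducible_singleton.closure, ?_, hxC,
    closure {ι q} ∩ ι '' (PrimeSpectrum.basicOpen f : Set (PrimeSpectrum R)), ?_, ?_, ?_⟩
  · have : QuasiSober (closure {ι q} : Set Y) := hClosed.isClosedEmbedding_subtypeVal.quasiSober
    refine topologicalKrullDim_eq_one (⟨ι q, hqC⟩ : (closure {ι q} : Set Y)) ⟨ι x, hxC⟩ ?_ ?_ ?_
    · intro z
      rw [subtype_specializes_iff]
      exact specializes_iff_mem_closure.2 z.2
    · intro h
      exact hqx.ne (hι.injective (congrArg Subtype.val h))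
    · intro z w hzw hz hw
      rw [subtype_specializes_iff] at hzw
      exact hno z.1 w.1 (specializes_iff_mem_closure.2 z.2) hzw
        (fun h => hz (Subtype.ext h)) (fun h => hw (Subtype.ext h))
  · rintro _ ⟨h1, r, hr, rfl⟩
    refine ⟨h1, hfT r (hpq.trans ?_) hr⟩
    rw [PrimeSpectrum.le_iff_specializes]
    exact hι.toIsEmbedding.isInducing.specializes_iff.1 (specializes_iff_mem_closure.2 h1)
  · rw [Set.preimage_inter]
    simp only [Subtype.coe_preimage_self, Set.univ_inter]
    exact (hι.isOpenMap _ (PrimeSpectrum.basicOpen f).2).preimage continuous_subtype_val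
  · intro ⟨z, hz⟩
    rw [closure_subtype]
    refine closure_mono ?_ hz
    rintro _ rfl
    exact ⟨⟨ι q, hqC⟩, ⟨hqC, q, hfq, rfl⟩, rfl⟩
end
end
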